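/- Let P be a point of the open unit ball B(0,1) ⊂ ℝ^N, N ≥ 2, and for small ε > 0 let Ω_ε = B(0,1) \ B(P,ε) and let φ_{1,ε} be the first Dirichlet eigenfunction of −Δ on Ω_ε (the positive eigenfunction associated to the smallest eigenvalue). Then for all sufficiently small ε > 0: if P = 0 the set of critical points of φ_{1,ε} in Ω_ε is infinite, while if P ≠ 0 the number of critical points of φ_{1,ε} in Ω_ε is exactly 2. -/

import Mathlib

open Filter Set Topology Metric MeasureTheory

noncomputable section

/-- Euclidean space `ℝ^N`. -/
abbrev EN (N : ℕ) := EuclideanSpace ℝ (Fin N)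

/-- Partial derivative `∂u/∂x_i`. -/
def pd {N : ℕ} (u : EN N → ℝ) (i : Fin N) (x : EN N) : ℝ :=
  fderiv ℝ u x (EuclideanSpace.single i 1)

/-- Second partial derivative `∂²u/∂x_i∂x_j`. -/
def pd2 {N : ℕ} (u : EN N → ℝ) (i j : Fin N) (x : EN N) : ℝ :=
  fderiv ℝ (fun y => pd u i y) x (EuclideanSpace.single j 1)

/-- The Laplacian `Δu`. -/
def lap {N : ℕ} (u : EN N → ℝ) (x : EN N) : ℝ := ∑ i, pd2 u i i x

/-- The Hessian matrix of `u` at `x`. -/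
def hess {N : ℕ} (u : EN N → ℝ) (x : EN N) : Matrix (Fin N) (Fin N) ℝ :=
  Matrix.of fun i j => pd2 u i j x

/-- `u` is a (classical, positive) solution of `-Δu = f(u)` in `D`, `u > 0` in `D`,
`u = 0` on `∂D`. -/
def IsSol {N : ℕ} (f : ℝ → ℝ) (D : Set (EN N)) (u : EN N → ℝ) : Prop :=
  ContDiffOn ℝ 2 u D ∧ (∀ x ∈ D, lap u x = - f (u x)) ∧ (∀ x ∈ D, 0 < u x) ∧
    ContinuousOn u (closure D) ∧ (∀ x ∈ frontier D, u x = 0)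

/-- `u ε → u₀` in `C²(K)` as `ε → 0⁺`: uniform convergence on `K` of the functions and of
their first and second partial derivatives. -/
def C2ConvOn {N : ℕ} (u : ℝ → EN N → ℝ) (u₀ : EN N → ℝ) (K : Set (EN N)) : Prop :=
  TendstoUniformlyOn (fun ε => u ε) u₀ (𝓝[>] (0:ℝ)) K ∧
    (∀ i, TendstoUniformlyOn (fun ε => pd (u ε) i) (pd u₀ i) (𝓝[>] (0:ℝ)) K) ∧
    (∀ i j, TendstoUniformlyOn (fun ε => pd2 (u ε) i j) (pd2 u₀ i j) (𝓝[>] (0:ℝ)) K)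

/-- The common setting of the paper: `Ω` a bounded domain, `P ∈ Ω`, `f` smooth, and for every
small `ε > 0`, `u ε` solves `-Δu = f(u)`, `u > 0` in `Ω_ε = Ω \ B(P,ε)`, `u = 0` on `∂Ω_ε`,
with a uniform bound `|u ε| ≤ C`, and `u₀` is the weak limit: a solution on `Ω` such that
`u ε → u₀` in `C²(K)` for every compact `K ⊆ Ω \ {P}`. -/
def Setting {N : ℕ} (Ω : Set (EN N)) (P : EN N) (f : ℝ → ℝ) (ε₀ C : ℝ)
    (u : ℝ → EN N → ℝ) (u₀ : EN N → ℝ) : Prop :=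
  IsOpen Ω ∧ Bornology.IsBounded Ω ∧ P ∈ Ω ∧ ContDiff ℝ (⊤ : ℕ∞) f ∧ 0 < ε₀ ∧
    (∀ ε ∈ Ioo (0:ℝ) ε₀, IsSol f (Ω \ closedBall P ε) (u ε)) ∧
    (∀ ε ∈ Ioo (0:ℝ) ε₀, ∀ x ∈ Ω \ closedBall P ε, |u ε x| ≤ C) ∧
    IsSol f Ω u₀ ∧
    (∀ K ⊆ Ω \ {P}, IsCompact K → C2ConvOn u u₀ K)

/-- `φ` is a Dirichlet eigenfunction of `-Δ` on `D` with eigenvalue `μ`. -/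
def IsEigenfunction {N : ℕ} (D : Set (EN N)) (μ : ℝ) (φ : EN N → ℝ) : Prop :=
  ContDiffOn ℝ 2 φ D ∧ (∀ x ∈ D, lap φ x = -(μ * φ x)) ∧
    ContinuousOn φ (closure D) ∧ (∀ x ∈ frontier D, φ x = 0) ∧ ∃ x ∈ D, φ x ≠ 0

/-- `φ` is the first Dirichlet eigenfunction of `-Δ` on `D`: a positive eigenfunction whose
eigenvalue `μ > 0` is the smallest Dirichlet eigenvalue. -/
def IsFirstEigenfunction {N : ℕ} (D : Set (EN N)) (μ : ℝ) (φ : EN N → ℝ) : Prop :=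
  IsEigenfunction D μ φ ∧ 0 < μ ∧ (∀ x ∈ D, 0 < φ x) ∧
    ∀ μ' ψ, IsEigenfunction D μ' ψ → μ ≤ μ'

section Calculus

open Laplacian

variable {E : Type*} [NormedAddCommGroup E] [InnerProductSpace ℝ E]

open scoped RealInnerProductSpace

/-- The second derivative of `u` at `x` applied twice to `v`. -/
def D2 (u : E → ℝ) (x v : E) : ℝ := fderiv ℝ (fderiv ℝ u) x v v

theorem laplacian_eq_sum_D2 [FiniteDimensional ℝ E] {ι : Type*} [Fintype ι]
    (b : OrthonormalBasis ι ℝ E) (u : E → ℝ) (x : E) : Δ u x = ∑ i, D2 u x (b i) := by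
  rw [InnerProductSpace.laplacian_eq_iteratedFDeriv_orthonormalBasis u b]
  simp [D2, iteratedFDeriv_two_apply]

theorem ContDiffAt.eventually_differentiableAt {u : E → ℝ} {x : E} (hu : ContDiffAt ℝ 2 u x) :
    ∀ᶠ y in 𝓝 x, DifferentiableAt ℝ u y :=
  (hu.eventually (by simp)).mono fun _ h => h.differentiableAt (by simp)

theorem ContDiffAt.differentiableAt_fderiv {u : E → ℝ} {x : E} (hu : ContDiffAt ℝ 2 u x) :
    DifferentiableAt ℝ (fderiv ℝ u) x :=
  (hu.fderiv_right (m := 1) (by norm_num)).differentiableAt (by simp)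

/-- First derivative along a curve. -/
theorem eventually_deriv_curve {u : E → ℝ} {x : E} (hu : ContDiffAt ℝ 2 u x) {c c' : ℝ → E}
    (hc : ∀ t, HasDerivAt c (c' t) t) (h0 : c 0 = x) :
    ∀ᶠ t in 𝓝 (0 : ℝ), HasDerivAt (fun t => u (c t)) (fderiv ℝ u (c t) (c' t)) t := by
  have hcc : Tendsto c (𝓝 0) (𝓝 x) := h0 ▸ (hc 0).continuousAt.tendsto
  filter_upwards [hcc.eventually hu.eventually_differentiableAt] with t ht
  exact ht.hasFDerivAt.comp_hasDerivAt t (hc t)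

/-- Second derivative along a curve. -/
theorem hasDerivAt_deriv_curve {u : E → ℝ} {x : E} (hu : ContDiffAt ℝ 2 u x) {c c' : ℝ → E}
    {c'' : E} (hc : ∀ t, HasDerivAt c (c' t) t) (hc' : HasDerivAt c' c'' 0) (h0 : c 0 = x) :
    HasDerivAt (deriv fun t => u (c t)) (D2 u x (c' 0) + fderiv ℝ u x c'') 0 := by
  have h1 : (deriv fun t => u (c t)) =ᶠ[𝓝 0] fun t => fderiv ℝ u (c t) (c' t) :=
    (eventually_deriv_curve hu hc h0).mono fun t ht => ht.deriv
  have h2 : HasDerivAt (fun t => fderiv ℝ u (c t)) (fderiv ℝ (fderiv ℝ u) x (c' 0)) 0 := by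
    subst h0
    exact hu.differentiableAt_fderiv.hasFDerivAt.comp_hasDerivAt 0 (hc 0)
  have h3 := h2.clm_apply hc'
  rw [h0] at h3
  exact h3.congr_of_eventuallyEq h1

theorem deriv_curve {u : E → ℝ} {x : E} (hu : ContDiffAt ℝ 2 u x) {c c' : ℝ → E}
    (hc : ∀ t, HasDerivAt c (c' t) t) (h0 : c 0 = x) :
    deriv (fun t => u (c t)) 0 = fderiv ℝ u x (c' 0) := by
  subst h0
  exact (eventually_deriv_curve hu hc rfl).self_of_nhds.deriv

theorem IsLocalMin.deriv_deriv_nonneg {f : ℝ → ℝ} {a : ℝ} (h : IsLocalMin f a)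
    (hf : ContinuousAt f a) : 0 ≤ deriv (deriv f) a := by
  by_contra! hneg
  have hmax := isLocalMax_of_deriv_deriv_neg hneg h.deriv_eq_zero hf
  have hconst : f =ᶠ[𝓝 a] fun _ => f a := by
    filter_upwards [h, hmax] with t h1 h2
    exact le_antisymm h2 h1
  have h2 : deriv f =ᶠ[𝓝 a] fun _ => 0 := by
    filter_upwards [hconst.eventuallyEq_nhds] with t ht
    rw [ht.deriv_eq]; simp
  rw [h2.deriv_eq] at hneg
  simp at hneg

/-- Second-order necessary condition along a curve. -/
theorem IsLocalMin.D2_curve_nonneg {u : E → ℝ} {x : E} (hu : ContDiffAt ℝ 2 u x) {c c' : ℝ → E}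
    {c'' : E} (hc : ∀ t, HasDerivAt c (c' t) t) (hc' : HasDerivAt c' c'' 0) (h0 : c 0 = x)
    (hmin : IsLocalMin (fun t => u (c t)) 0) :
    0 ≤ D2 u x (c' 0) + fderiv ℝ u x c'' := by
  rw [← (hasDerivAt_deriv_curve hu hc hc' h0).deriv]
  exact hmin.deriv_deriv_nonneg (eventually_deriv_curve hu hc h0).self_of_nhds.continuousAt

theorem hasDerivAt_line (x v : E) (t : ℝ) : HasDerivAt (fun t : ℝ => x + t • v) v t := by
  simpa using ((hasDerivAt_id t).smul_const v).const_add x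

theorem hasDerivAt_deriv_line {u : E → ℝ} {x : E} (hu : ContDiffAt ℝ 2 u x) (v : E) :
    HasDerivAt (deriv fun t : ℝ => u (x + t • v)) (D2 u x v) 0 := by
  simpa using hasDerivAt_deriv_curve hu (hasDerivAt_line x v) (hasDerivAt_const 0 v) (by simp)

theorem D2_eq_deriv_line {u : E → ℝ} {x : E} (hu : ContDiffAt ℝ 2 u x) (v : E) :
    D2 u x v = deriv (deriv fun t : ℝ => u (x + t • v)) 0 :=
  (hasDerivAt_deriv_line hu v).deriv.symm

theorem IsLocalMin.D2_nonneg {u : E → ℝ} {x : E} (h : IsLocalMin u x) (hu : ContDiffAt ℝ 2 u x)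
    (v : E) : 0 ≤ D2 u x v := by
  have : IsLocalMin (fun t : ℝ => u (x + t • v)) 0 := by
    have hc : ContinuousAt (fun t : ℝ => x + t • v) 0 := by fun_prop
    have h' : ∀ᶠ y in 𝓝 (x + (0 : ℝ) • v), u (x + (0 : ℝ) • v) ≤ u y := by
      simp only [zero_smul, add_zero]; exact h
    exact hc.eventually h'
  simpa using this.D2_curve_nonneg hu (hasDerivAt_line x v) (hasDerivAt_const 0 v) (by simp)

theorem D2_comp_isometry {u : E → ℝ} (A : E ≃ₗᵢ[ℝ] E) (a x v : E)
    (hu : ContDiffAt ℝ 2 u (A x + a)) :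
    D2 (fun y => u (A y + a)) x v = D2 u (A x + a) (A v) := by
  have hA : ContDiffAt ℝ 2 (fun y => A y + a) x :=
    (A.toContinuousLinearEquiv.contDiff.add contDiff_const).contDiffAt
  rw [D2_eq_deriv_line (u := fun y => u (A y + a)) (hu.comp x hA), D2_eq_deriv_line hu]
  congr 2
  ext t
  simp only [map_add, map_smul]
  congr 1; abel

theorem contDiff_norm_sub_sq (z : E) : ContDiff ℝ 2 fun y : E => ‖y - z‖ ^ 2 :=
  (contDiff_id.sub contDiff_const).norm_sq ℝ

variable [FiniteDimensional ℝ E]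

theorem IsLocalMin.laplacian_nonneg {u : E → ℝ} {x : E} (h : IsLocalMin u x)
    (hu : ContDiffAt ℝ 2 u x) : 0 ≤ Δ u x := by
  rw [laplacian_eq_sum_D2 (stdOrthonormalBasis ℝ E)]
  exact Finset.sum_nonneg fun i _ => h.D2_nonneg hu _

theorem laplacian_sub_apply {u v : E → ℝ} {x : E} (hu : ContDiffAt ℝ 2 u x)
    (hv : ContDiffAt ℝ 2 v x) : Δ (fun y => u y - v y) x = Δ u x - Δ v x :=
  hu.laplacian_sub hv

theorem laplacian_add_apply {u v : E → ℝ} {x : E} (hu : ContDiffAt ℝ 2 u x)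
    (hv : ContDiffAt ℝ 2 v x) : Δ (fun y => u y + v y) x = Δ u x + Δ v x :=
  hu.laplacian_add hv

theorem laplacian_const_mul {u : E → ℝ} {x : E} (a : ℝ) (hu : ContDiffAt ℝ 2 u x) :
    Δ (fun y => a * u y) x = a * Δ u x := by
  exact InnerProductSpace.laplacian_smul a hu

theorem IsLocalMax.laplacian_nonpos {u : E → ℝ} {x : E} (h : IsLocalMax u x)
    (hu : ContDiffAt ℝ 2 u x) : Δ u x ≤ 0 := by
  have h1 : IsLocalMin (fun y => -1 * u y) x := by simpa using h.neg
  have h2 := h1.laplacian_nonneg (contDiffAt_const.mul hu)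
  rw [laplacian_const_mul _ hu] at h2
  linarith

theorem laplacian_comp_isometry {u : E → ℝ} (A : E ≃ₗᵢ[ℝ] E) (a x : E)
    (hu : ContDiffAt ℝ 2 u (A x + a)) :
    Δ (fun y => u (A y + a)) x = Δ u (A x + a) := by
  rw [laplacian_eq_sum_D2 (stdOrthonormalBasis ℝ E),
    laplacian_eq_sum_D2 ((stdOrthonormalBasis ℝ E).map A)]
  exact Finset.sum_congr rfl fun i _ => by rw [D2_comp_isometry A a x _ hu]; rfl

theorem laplacian_radial {f f' : ℝ → ℝ} {f'' : ℝ} (z x : E)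
    (hf : ContDiffAt ℝ 2 f (‖x - z‖ ^ 2))
    (h1 : ∀ᶠ s in 𝓝 (‖x - z‖ ^ 2), HasDerivAt f (f' s) s)
    (h2 : HasDerivAt f' f'' (‖x - z‖ ^ 2)) :
    Δ (fun y => f (‖y - z‖ ^ 2)) x =
      4 * ‖x - z‖ ^ 2 * f'' + 2 * Module.finrank ℝ E * f' (‖x - z‖ ^ 2) := by
  set b := stdOrthonormalBasis ℝ E
  have key : ∀ i, D2 (fun y => f (‖y - z‖ ^ 2)) x (b i) =
      4 * ⟪x - z, b i⟫ ^ 2 * f'' + 2 * f' (‖x - z‖ ^ 2) := by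
    intro i
    have hu : ContDiffAt ℝ 2 (fun y => f (‖y - z‖ ^ 2)) x :=
      hf.comp x (contDiff_norm_sub_sq z).contDiffAt
    rw [D2_eq_deriv_line (u := fun y => f (‖y - z‖ ^ 2)) hu]
    have hq : ∀ t : ℝ, ‖x + t • b i - z‖ ^ 2 =
        ‖x - z‖ ^ 2 + t * (2 * ⟪x - z, b i⟫) + t ^ 2 := by
      intro t
      rw [show x + t • b i - z = (x - z) + t • b i by abel, norm_add_sq_real, norm_smul,
        inner_smul_right, b.norm_eq_one]
      simp; ring
    set g : ℝ → ℝ := fun t => ‖x - z‖ ^ 2 + t * (2 * ⟪x - z, b i⟫) + t ^ 2 with hg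
    have hg' : ∀ t, HasDerivAt g (2 * ⟪x - z, b i⟫ + 2 * t) t := by
      intro t
      exact ((((hasDerivAt_id' t).mul_const (2 * ⟪x - z, b i⟫)).const_add
        (‖x - z‖ ^ 2)).add (hasDerivAt_pow 2 t)).congr_deriv (by simp)
    have hg0 : g 0 = ‖x - z‖ ^ 2 := by simp [hg]
    have hq2 : (fun t : ℝ => f (‖x + t • b i - z‖ ^ 2)) = fun t => f (g t) := by
      ext t; rw [hq]
    rw [show deriv (fun t : ℝ => (fun y => f (‖y - z‖ ^ 2)) (x + t • b i)) =
      deriv fun t => f (g t) from congrArg deriv hq2]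
    have hgt : Tendsto g (𝓝 0) (𝓝 (‖x - z‖ ^ 2)) := hg0 ▸ (hg' 0).continuousAt.tendsto
    have e1 : (deriv fun t => f (g t)) =ᶠ[𝓝 0]
        fun t => f' (g t) * (2 * ⟪x - z, b i⟫ + 2 * t) := by
      filter_upwards [hgt.eventually h1] with t ht
      exact (ht.comp t (hg' t)).deriv
    rw [← hg0] at h2
    have e2 : HasDerivAt (fun t => f' (g t) * (2 * ⟪x - z, b i⟫ + 2 * t))
        (f'' * (2 * ⟪x - z, b i⟫ + 2 * 0) * (2 * ⟪x - z, b i⟫ + 2 * 0) + f' (g 0) * 2) 0 := by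
      have h3 : HasDerivAt (fun t : ℝ => 2 * ⟪x - z, b i⟫ + 2 * t) 2 0 := by
        simpa using ((hasDerivAt_id (0 : ℝ)).const_mul 2).const_add (2 * ⟪x - z, b i⟫)
      exact (h2.comp 0 (hg' 0)).mul h3
    rw [e1.deriv_eq, e2.deriv, hg0]
    ring
  rw [laplacian_eq_sum_D2 b, Finset.sum_congr rfl fun i _ => key i, Finset.sum_add_distrib,
    ← Finset.sum_mul, ← Finset.mul_sum, b.sum_sq_inner_left]
  simp
  ring

end Calculus

section MaximumPrinciple

open Laplacian

theorem mem_nhds_of_norm_sub_mem_Ioo {E : Type*} [NormedAddCommGroup E] {z x : E} {a b : ℝ} (ha : a < ‖x - z‖) (hb : ‖x - z‖ < b) :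
    {x | a ≤ ‖x - z‖ ∧ ‖x - z‖ ≤ b} ∈ 𝓝 x := by
  have hc : ContinuousAt (fun x => ‖x - z‖) x := by fun_prop
  filter_upwards [hc.eventually (lt_mem_nhds ha), hc.eventually (gt_mem_nhds hb)] with w h1 h2
  exact ⟨h1.le, h2.le⟩

variable {E : Type*} [NormedAddCommGroup E] [InnerProductSpace ℝ E]

open scoped RealInnerProductSpace

theorem HasDerivAt.nonpos_of_right {f : ℝ → ℝ} {f' a : ℝ} (hf : HasDerivAt f f' a)
    (h : ∀ᶠ s in 𝓝[>] a, f s ≤ f a) : f' ≤ 0 := by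
  have h1 : Tendsto (slope f a) (𝓝[>] a) (𝓝 f') :=
    hf.tendsto_slope.mono_left (nhdsWithin_mono a fun s (hs : a < s) => ne_of_gt hs)
  refine le_of_tendsto h1 ?_
  filter_upwards [h, self_mem_nhdsWithin] with s hs (hs' : a < s)
  rw [slope_def_field]
  exact div_nonpos_of_nonpos_of_nonneg (by linarith) (by linarith)

variable [FiniteDimensional ℝ E]

theorem isCompact_shell (z : E) (a b : ℝ) : IsCompact {x | a ≤ ‖x - z‖ ∧ ‖x - z‖ ≤ b} := by
  refine (isCompact_closedBall z b).of_isClosed_subset ?_ fun x hx => ?_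
  · exact (isClosed_le continuous_const (continuous_id.sub continuous_const).norm).inter
      (isClosed_le (continuous_id.sub continuous_const).norm continuous_const)
  · rw [mem_closedBall, dist_eq_norm]; exact hx.2

/-- Weak maximum principle for strictly subharmonic functions. -/
theorem weak_max {S : Set E} (hS : IsCompact S) {F : E → ℝ} (hF : ContinuousOn F S)
    (h : ∀ x ∈ S, 0 < F x → S ∈ 𝓝 x ∧ ContDiffAt ℝ 2 F x ∧ 0 < Δ F x) :
    ∀ x ∈ S, F x ≤ 0 := by
  by_contra! hneg
  obtain ⟨x₁, hx₁, hpos⟩ := hneg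
  obtain ⟨x₀, hx₀, hmax⟩ := hS.exists_isMaxOn ⟨x₁, hx₁⟩ hF
  obtain ⟨h1, h2, h3⟩ := h x₀ hx₀ (hpos.trans_le (hmax hx₁))
  exact absurd ((hmax.isLocalMax h1).laplacian_nonpos h2) (not_le.2 h3)

/-- Comparison with a strict supersolution. -/
theorem le_barrier {S : Set E} (hS : IsCompact S) {y b : E → ℝ} {m l : ℝ} (hm : 0 ≤ m)
    (hy : ContinuousOn y S) (hb : ContinuousOn b S) (hb0 : ∀ x ∈ S, 0 < b x)
    (h : ∀ x ∈ S, m * b x < y x → S ∈ 𝓝 x ∧ ContDiffAt ℝ 2 y x ∧ ContDiffAt ℝ 2 b x ∧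
      -(l * y x) ≤ Δ y x ∧ Δ b x < -(l * b x)) :
    ∀ x ∈ S, y x ≤ m * b x := by
  by_contra! hneg
  obtain ⟨x₁, hx₁, hpos⟩ := hneg
  obtain ⟨x₀, hx₀, hmax⟩ := hS.exists_isMaxOn ⟨x₁, hx₁⟩
    (hy.div hb fun x hx => (hb0 x hx).ne')
  set T := y x₀ / b x₀ with hT
  have hb00 := hb0 x₀ hx₀
  have hmT : m < T := by
    have := hmax hx₁
    simp only [mem_ofPred_eq, Pi.div_apply] at this
    exact ((lt_div_iff₀ (hb0 x₁ hx₁)).2 hpos).trans_le this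
  have hyT : y x₀ = T * b x₀ := by rw [hT]; field_simp
  obtain ⟨h1, h2, h3, h4, h5⟩ := h x₀ hx₀ (by rw [hyT]; gcongr)
  have hF : IsMaxOn (fun x => y x - T * b x) S x₀ := fun x hx => by
    have := hmax hx
    simp only [mem_ofPred_eq, Pi.div_apply] at this ⊢
    rw [div_le_iff₀ (hb0 x hx)] at this
    linarith
  have h6 := (hF.isLocalMax h1).laplacian_nonpos (h2.sub (contDiffAt_const.mul h3))
  rw [laplacian_sub_apply h2 (contDiffAt_const.mul h3), laplacian_const_mul _ h3] at h6
  have h7 := mul_lt_mul_of_pos_left h5 (hm.trans_lt hmT)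
  rw [hyT] at h4
  linarith

/-- **Hopf boundary point lemma**. -/
theorem hopf {y : E → ℝ} {z b : E} {r : ℝ} (hr : 0 < r) (hb : ‖b - z‖ = r)
    (hC : ∀ x ∈ ball z r, ContDiffAt ℝ 2 y x) (hL : ∀ x ∈ ball z r, 0 ≤ Δ y x)
    (hneg : ∀ x ∈ ball z r, y x < 0) (hle : ∀ x ∈ closedBall z r, y x ≤ 0)
    (hc : ContinuousOn y (closedBall z r)) (hb0 : y b = 0) (hd : DifferentiableAt ℝ y b) :
    fderiv ℝ y b (z - b) < 0 := by
  set n : ℝ := (Module.finrank ℝ E : ℝ)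
  have hn : 0 ≤ n := by positivity
  set κ := (2 * n + 2) / r ^ 2 with hκ
  have hκ0 : 0 < κ := by positivity
  have hκr : κ * r ^ 2 = 2 * n + 2 := by rw [hκ]; field_simp
  set S := {x | r / 2 ≤ ‖x - z‖ ∧ ‖x - z‖ ≤ r}
  set h : E → ℝ := fun x => Real.exp (-κ * ‖x - z‖ ^ 2) - Real.exp (-κ * r ^ 2) with hh
  have hSb : S ⊆ closedBall z r := fun x hx => by
    rw [mem_closedBall, dist_eq_norm]; exact hx.2
  have hhc : ContDiff ℝ 2 h :=
    ((contDiff_const.mul (contDiff_norm_sub_sq z)).exp).sub contDiff_const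
  obtain ⟨m, hm, hym⟩ : ∃ m > 0, ∀ x, ‖x - z‖ = r / 2 → y x ≤ -m := by
    have hsub : sphere z (r / 2) ⊆ ball z r := fun x hx => by
      rw [mem_sphere] at hx; rw [mem_ball, hx]; linarith
    have hne : (sphere z (r / 2)).Nonempty :=
      ⟨z + (1 / 2 : ℝ) • (b - z), by simp [norm_smul, hb]; ring⟩
    obtain ⟨x₀, hx₀, hmax⟩ := (isCompact_sphere z (r / 2)).exists_isMaxOn hne
      (hc.mono (hsub.trans ball_subset_closedBall))
    refine ⟨-y x₀, by linarith [hneg x₀ (hsub hx₀)], fun x hx => ?_⟩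
    simpa using hmax (show x ∈ sphere z (r / 2) by rwa [mem_sphere, dist_eq_norm])
  have key : ∀ x ∈ S, y x + m * h x ≤ 0 := by
    refine weak_max (isCompact_shell z _ _) ((hc.mono hSb).add
      (continuousOn_const.mul hhc.continuous.continuousOn)) fun x hx hpos => ?_
    have h1 : ‖x - z‖ ≠ r / 2 := fun h1 => by
      have h2 : h x ≤ 1 := by
        have : Real.exp (-κ * ‖x - z‖ ^ 2) ≤ 1 :=
          Real.exp_le_one_iff.2 (by nlinarith [sq_nonneg ‖x - z‖])
        have := Real.exp_pos (-κ * r ^ 2)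
        simp only [hh]; linarith
      nlinarith [hym x h1]
    have h2 : ‖x - z‖ ≠ r := fun h2 => by
      have h3 : h x = 0 := by simp [hh, h2]
      have := hle x (hSb hx)
      rw [h3] at hpos; linarith
    have h1' := lt_of_le_of_ne hx.1 (Ne.symm h1)
    have h2' := lt_of_le_of_ne hx.2 h2
    have hxb : x ∈ ball z r := by rwa [mem_ball, dist_eq_norm]
    have hmh : ContDiffAt ℝ 2 (fun x => m * h x) x := contDiffAt_const.mul hhc.contDiffAt
    refine ⟨mem_nhds_of_norm_sub_mem_Ioo h1' h2', (hC x hxb).add hmh, ?_⟩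
    rw [laplacian_add_apply (hC x hxb) hmh, laplacian_const_mul _ hhc.contDiffAt]
    have hΔ : Δ h x = 2 * κ * Real.exp (-κ * ‖x - z‖ ^ 2) * (2 * κ * ‖x - z‖ ^ 2 - n) := by
      have hder : ∀ s : ℝ, HasDerivAt (fun s => Real.exp (-κ * s) - Real.exp (-κ * r ^ 2))
          (-κ * Real.exp (-κ * s)) s := fun s =>
        ((((hasDerivAt_id' s).const_mul (-κ)).exp).sub_const _).congr_deriv (by ring)
      have hder2 : ∀ s : ℝ, HasDerivAt (fun s => -κ * Real.exp (-κ * s))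
          (-κ * (-κ * Real.exp (-κ * s))) s := fun s =>
        ((((hasDerivAt_id' s).const_mul (-κ)).exp).const_mul _).congr_deriv (by ring)
      have := laplacian_radial (f := fun s => Real.exp (-κ * s) - Real.exp (-κ * r ^ 2)) z x
        (((contDiffAt_const.mul contDiffAt_id).exp).sub contDiffAt_const)
        (Eventually.of_forall hder) (hder2 _)
      rw [hh, this]; ring
    have h3 : n < 2 * κ * ‖x - z‖ ^ 2 := by
      have : (r / 2) ^ 2 ≤ ‖x - z‖ ^ 2 := by gcongr
      nlinarith
    have := hL x hxb
    have : 0 < Δ h x := by rw [hΔ]; exact mul_pos (by positivity) (by linarith)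
    have := mul_pos hm this
    linarith
  have hcurve : ∀ t : ℝ, HasDerivAt (fun t : ℝ => b + t • (z - b)) (z - b) t :=
    hasDerivAt_line b (z - b)
  have hnorm : ∀ t : ℝ, ‖b + t • (z - b) - z‖ ^ 2 = (1 - t) ^ 2 * r ^ 2 := fun t => by
    rw [show b + t • (z - b) - z = (1 - t) • (b - z) by module, norm_smul, mul_pow, hb]
    simp
  have hb0' : b + (0 : ℝ) • (z - b) = b := by simp
  have hd1 : HasDerivAt (fun t : ℝ => y (b + t • (z - b))) (fderiv ℝ y b (z - b)) 0 := by
    refine HasFDerivAt.comp_hasDerivAt (0 : ℝ) ?_ (hcurve 0)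
    rw [hb0']; exact hd.hasFDerivAt
  have hd2 : HasDerivAt (fun t : ℝ => Real.exp (-κ * ((1 - t) ^ 2 * r ^ 2)) -
      Real.exp (-κ * r ^ 2)) (2 * κ * r ^ 2 * Real.exp (-κ * r ^ 2)) 0 := by
    have h1 : HasDerivAt (fun t : ℝ => (1 - t) ^ 2) (-2) 0 :=
      (((hasDerivAt_id' (0 : ℝ)).const_sub 1).pow 2).congr_deriv (by simp)
    exact ((((h1.mul_const (r ^ 2)).const_mul (-κ)).exp).sub_const _).congr_deriv
      (by simp; ring)
  have h3 := (hd1.add (hd2.const_mul m)).nonpos_of_right (by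
    have : Ioo (0 : ℝ) (1 / 2) ∈ 𝓝[>] (0 : ℝ) := Ioo_mem_nhdsGT (by norm_num)
    filter_upwards [this] with t ht
    have hS : b + t • (z - b) ∈ S := by
      have : ‖b + t • (z - b) - z‖ = (1 - t) * r := by
        rw [← sq_eq_sq₀ (norm_nonneg _) (mul_nonneg (by linarith [ht.2]) hr.le), hnorm]; ring
      constructor <;> rw [this] <;> nlinarith [ht.1, ht.2]
    have := key _ hS
    simp only [hh, hnorm] at this
    simpa [hb0] using this)
  have : 0 < m * (2 * κ * r ^ 2 * Real.exp (-κ * r ^ 2)) := by positivity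
  linarith

/-- **Strong maximum principle** (local form). -/
theorem isOpen_zeros {G : Set E} (hG : IsOpen G) {y : E → ℝ}
    (hC : ∀ x ∈ G, ContDiffAt ℝ 2 y x) (hL : ∀ x ∈ G, 0 ≤ Δ y x) (hle : ∀ x ∈ G, y x ≤ 0) :
    IsOpen {x ∈ G | y x = 0} := by
  rw [isOpen_iff_mem_nhds]
  rintro x₀ ⟨hx₀, hy₀⟩
  obtain ⟨R, hR, hRG⟩ := Metric.nhds_basis_closedBall.mem_iff.1 (hG.mem_nhds hx₀)
  have hcont : ContinuousOn y (closedBall x₀ R) := fun x hx =>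
    (hC x (hRG hx)).continuousAt.continuousWithinAt
  filter_upwards [ball_mem_nhds x₀ (half_pos hR)] with x₁ hx₁
  have hx₁R : x₁ ∈ closedBall x₀ R := (ball_subset_closedBall.trans
    (closedBall_subset_closedBall (by linarith))) hx₁
  refine ⟨hRG hx₁R, ?_⟩
  by_contra hne
  set Z := {x ∈ closedBall x₀ R | y x = 0}
  have hZc : IsCompact Z := by
    refine (isCompact_closedBall x₀ R).of_isClosed_subset ?_ fun x hx => hx.1
    exact hcont.preimage_isClosed_of_isClosed isClosed_closedBall isClosed_singleton
  have hx₀Z : x₀ ∈ Z := ⟨mem_closedBall_self hR.le, hy₀⟩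
  obtain ⟨b, hbZ, hbd⟩ := hZc.exists_infDist_eq_dist ⟨x₀, hx₀Z⟩ x₁
  set r := dist x₁ b
  have hr : 0 < r := dist_pos.2 fun h => hne (h ▸ hbZ.2)
  have hrle : r ≤ dist x₁ x₀ := hbd ▸ infDist_le_dist_of_mem hx₀Z
  rw [mem_ball] at hx₁
  have hsub : closedBall x₁ r ⊆ ball x₀ R := fun x hx => by
    rw [mem_closedBall] at hx; rw [mem_ball]
    linarith [dist_triangle x x₁ x₀]
  have hsub' : closedBall x₁ r ⊆ closedBall x₀ R := hsub.trans ball_subset_closedBall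
  have hbG := hRG hbZ.1
  have hopf := hopf (y := y) (z := x₁) (b := b) hr (by rw [← dist_eq_norm, dist_comm])
    (fun x hx => hC x (hRG (hsub' (ball_subset_closedBall hx))))
    (fun x hx => hL x (hRG (hsub' (ball_subset_closedBall hx))))
    (fun x hx => by
      refine lt_of_le_of_ne (hle x (hRG (hsub' (ball_subset_closedBall hx)))) fun h => ?_
      have h1 : infDist x₁ Z ≤ dist x₁ x :=
        infDist_le_dist_of_mem ⟨hsub' (ball_subset_closedBall hx), h⟩
      rw [hbd, dist_comm x₁ x] at h1
      exact absurd (mem_ball.1 hx) (not_lt.2 h1))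
    (fun x hx => hle x (hRG (hsub' hx))) (hcont.mono hsub') hbZ.2
    ((hC b hbG).differentiableAt (by simp))
  have hmax : IsLocalMax y b := by
    filter_upwards [hG.mem_nhds hbG] with x hx
    rw [hbZ.2]; exact hle x hx
  rw [hmax.fderiv_eq_zero] at hopf
  simp at hopf

end MaximumPrinciple

section Mirror

open Laplacian

variable {E : Type*} [NormedAddCommGroup E] [InnerProductSpace ℝ E]

open scoped RealInnerProductSpace

/-- Reflection across the hyperplane `⟪x, ν⟫ = c` (for a unit vector `ν`). -/
def mirror (ν : E) (c : ℝ) (x : E) : E := x - (2 * (⟪x, ν⟫ - c)) • ν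

theorem mirror_eq_reflection {ν : E} (hν : ‖ν‖ = 1) (c : ℝ) (x : E) :
    mirror ν c x = (ℝ ∙ ν)ᗮ.reflection x + (2 * c) • ν := by
  rw [Submodule.reflection_orthogonal_apply, Submodule.reflection_singleton_apply, hν, mirror,
    real_inner_comm]
  simp
  module

theorem contDiff_mirror (ν : E) (c : ℝ) : ContDiff ℝ 2 (mirror ν c) := by
  unfold mirror
  exact contDiff_id.sub (((contDiff_const.mul ((contDiff_id.inner ℝ contDiff_const).sub
    contDiff_const))).smul contDiff_const)

theorem mirror_of_inner_eq {ν : E} {c : ℝ} {x : E} (h : ⟪x, ν⟫ = c) : mirror ν c x = x := by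
  simp [mirror, h]

theorem inner_mirror {ν : E} (hν : ‖ν‖ = 1) (c : ℝ) (x : E) :
    ⟪mirror ν c x, ν⟫ = 2 * c - ⟪x, ν⟫ := by
  rw [mirror, inner_sub_left, inner_smul_left, real_inner_self_eq_norm_sq, hν]
  simp; ring

theorem norm_mirror_sub_sq {ν : E} (hν : ‖ν‖ = 1) (c : ℝ) (x z : E) :
    ‖mirror ν c x - z‖ ^ 2 = ‖x - z‖ ^ 2 + 4 * (⟪x, ν⟫ - c) * (⟪z, ν⟫ - c) := by
  rw [mirror, show x - (2 * (⟪x, ν⟫ - c)) • ν - z = (x - z) - (2 * (⟪x, ν⟫ - c)) • ν by abel,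
    norm_sub_sq_real, norm_smul, inner_smul_right, inner_sub_left, hν, mul_one, Real.norm_eq_abs,
    sq_abs]
  ring

theorem norm_mirror_sq {ν : E} (hν : ‖ν‖ = 1) (c : ℝ) (x : E) :
    ‖mirror ν c x‖ ^ 2 = ‖x‖ ^ 2 - 4 * (⟪x, ν⟫ - c) * c := by
  have := norm_mirror_sub_sq hν c x 0
  simp at this
  linarith

theorem ContDiffAt.comp_mirror {u : E → ℝ} {ν : E} {c : ℝ} {x : E}
    (hu : ContDiffAt ℝ 2 u (mirror ν c x)) : ContDiffAt ℝ 2 (fun x => u (mirror ν c x)) x :=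
  hu.comp x (contDiff_mirror ν c).contDiffAt

theorem hasDerivAt_mirror_line (ν : E) (c : ℝ) (x v : E) :
    HasDerivAt (fun t : ℝ => mirror ν c (x + t • v)) (v - (2 * ⟪v, ν⟫) • ν) 0 := by
  have : (fun t : ℝ => mirror ν c (x + t • v)) =
      fun t => mirror ν c x + t • (v - (2 * ⟪v, ν⟫) • ν) := by
    ext t
    simp only [mirror, inner_add_left, inner_smul_left, conj_trivial]
    module
  rw [this]
  exact hasDerivAt_line _ _ 0

theorem hasDerivAt_fderiv_line {u : E → ℝ} {x : E} (hu : DifferentiableAt ℝ u x) (v : E) :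
    HasDerivAt (fun t : ℝ => u (x + t • v)) (fderiv ℝ u x v) 0 := by
  refine HasFDerivAt.comp_hasDerivAt (0 : ℝ) ?_ (hasDerivAt_line x v 0)
  simpa using hu.hasFDerivAt

theorem fderiv_comp_mirror {u : E → ℝ} {ν : E} {c : ℝ} {x : E}
    (hu : ContDiffAt ℝ 2 u (mirror ν c x)) (v : E) :
    fderiv ℝ (fun x => u (mirror ν c x)) x v =
      fderiv ℝ u (mirror ν c x) (v - (2 * ⟪v, ν⟫) • ν) := by
  have h1 := hasDerivAt_fderiv_line (hu.comp_mirror.differentiableAt (by simp)) v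
  refine h1.unique (HasFDerivAt.comp_hasDerivAt (0 : ℝ) ?_ (hasDerivAt_mirror_line ν c x v))
  simpa using (hu.differentiableAt (by simp)).hasFDerivAt

theorem laplacian_comp_mirror [FiniteDimensional ℝ E] {u : E → ℝ} {ν : E} (hν : ‖ν‖ = 1) {c : ℝ}
    {x : E} (hu : ContDiffAt ℝ 2 u (mirror ν c x)) :
    Δ (fun x => u (mirror ν c x)) x = Δ u (mirror ν c x) := by
  simp only [mirror_eq_reflection hν] at hu ⊢
  exact laplacian_comp_isometry _ _ _ hu

theorem hasDerivAt_fderiv_apply_line {w : E → ℝ} {x : E} {t : ℝ} (k v : E)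
    (hw : ContDiffAt ℝ 2 w (x + t • k)) :
    HasDerivAt (fun t : ℝ => fderiv ℝ w (x + t • k) v)
      (fderiv ℝ (fderiv ℝ w) (x + t • k) k v) t := by
  have h : HasDerivAt (fun t : ℝ => fderiv ℝ w (x + t • k))
      (fderiv ℝ (fderiv ℝ w) (x + t • k) k) t :=
    hw.differentiableAt_fderiv.hasFDerivAt.comp_hasDerivAt t (hasDerivAt_line x k t)
  exact (h.clm_apply (hasDerivAt_const t v)).congr_deriv (by simp)

end Mirror

section GradientEstimate

open Laplacian

variable {E : Type*} [NormedAddCommGroup E] [InnerProductSpace ℝ E]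

open scoped RealInnerProductSpace

theorem D2_comp_inner {f f' : ℝ → ℝ} {f'' : ℝ} (y ν x v : E)
    (hf : ContDiff ℝ 2 f) (h1 : ∀ s, HasDerivAt f (f' s) s)
    (h2 : HasDerivAt f' f'' ⟪x - y, ν⟫) :
    D2 (fun x => f ⟪x - y, ν⟫) x v = f'' * ⟪v, ν⟫ ^ 2 := by
  have hu : ContDiff ℝ 2 fun x => f ⟪x - y, ν⟫ :=
    hf.comp ((contDiff_id.sub contDiff_const).inner ℝ contDiff_const)
  rw [D2_eq_deriv_line hu.contDiffAt]
  have hg : ∀ t : ℝ, HasDerivAt (fun t : ℝ => ⟪x - y, ν⟫ + t * ⟪v, ν⟫) ⟪v, ν⟫ t := fun t =>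
    (((hasDerivAt_id' t).mul_const ⟪v, ν⟫).const_add ⟪x - y, ν⟫).congr_deriv (by simp)
  have e0 : (fun t : ℝ => f ⟪x + t • v - y, ν⟫) = fun t => f (⟪x - y, ν⟫ + t * ⟪v, ν⟫) := by
    ext t
    rw [show x + t • v - y = (x - y) + t • v by abel, inner_add_left, inner_smul_left]; simp
  have e1 : deriv (fun t : ℝ => f (⟪x - y, ν⟫ + t * ⟪v, ν⟫)) =
      fun t => f' (⟪x - y, ν⟫ + t * ⟪v, ν⟫) * ⟪v, ν⟫ := by
    ext t
    exact ((h1 _).comp t (hg t)).deriv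
  rw [e0, e1]
  have h2' : HasDerivAt f' f'' (⟪x - y, ν⟫ + 0 * ⟪v, ν⟫) := by simpa using h2
  have h3 : HasDerivAt (fun t : ℝ => f' (⟪x - y, ν⟫ + t * ⟪v, ν⟫) * ⟪v, ν⟫)
      (f'' * ⟪v, ν⟫ * ⟪v, ν⟫) 0 := (h2'.comp 0 (hg 0)).mul_const ⟪v, ν⟫
  rw [h3.deriv]
  ring

variable [FiniteDimensional ℝ E]

theorem laplacian_norm_sub_sq (z x : E) :
    Δ (fun y : E => ‖y - z‖ ^ 2) x = 2 * Module.finrank ℝ E := by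
  have := laplacian_radial (f := fun s => s) (f' := fun _ => 1) z x contDiffAt_id
    (Eventually.of_forall fun s => hasDerivAt_id' s) (hasDerivAt_const _ _)
  simpa using this

theorem laplacian_comp_inner {f f' : ℝ → ℝ} {f'' : ℝ} (y x : E) {ν : E} (hν : ‖ν‖ = 1)
    (hf : ContDiff ℝ 2 f) (h1 : ∀ s, HasDerivAt f (f' s) s)
    (h2 : HasDerivAt f' f'' ⟪x - y, ν⟫) : Δ (fun x => f ⟪x - y, ν⟫) x = f'' := by
  rw [laplacian_eq_sum_D2 (stdOrthonormalBasis ℝ E),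
    Finset.sum_congr rfl fun i _ => D2_comp_inner y ν x _ hf h1 h2, ← Finset.mul_sum,
    (stdOrthonormalBasis ℝ E).sum_sq_inner_right, hν]
  simp

variable (E) in
/-- The constant in the interior gradient estimate on a ball of radius `r`. -/
def gradConst (Λ r : ℝ) : ℝ := (Module.finrank ℝ E + 1) / r + Λ * r

theorem fderiv_le_of_laplacian_eq {w : E → ℝ} {y ν : E} {r A Λ l : ℝ} (hr : 0 < r) (hA : 0 < A)
    (hl0 : 0 ≤ l) (hl : l ≤ Λ) (hC : ∀ x ∈ closedBall y r, ContDiffAt ℝ 2 w x)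
    (hL : ∀ x ∈ closedBall y r, Δ w x = -(l * w x)) (hw : ∀ x ∈ closedBall y r, |w x| ≤ A)
    (hν : ‖ν‖ = 1) : fderiv ℝ w y ν ≤ A * gradConst E Λ r := by
  set n : ℝ := (Module.finrank ℝ E : ℝ) with hn
  have hn0 : 0 ≤ n := by positivity
  set c := 2 * A * n / r ^ 2 + Λ * A + A / r ^ 2 with hc
  have hΛ : 0 ≤ Λ := hl0.trans hl
  have hc0 : 0 ≤ c := by positivity
  set k := 2 * A / r ^ 2 with hk
  have hk0 : 0 ≤ k := by positivity
  set a := ⟪y, ν⟫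
  set S := {x | x ∈ closedBall y r ∧ 0 ≤ ⟪x - y, ν⟫} with hS
  have hinner : Continuous fun x : E => ⟪x - y, ν⟫ :=
    (continuous_id.sub continuous_const).inner continuous_const
  have hScl : IsCompact S :=
    (isCompact_closedBall y r).inter_right (isClosed_le continuous_const hinner)
  have hmb : ∀ x ∈ closedBall y r, mirror ν a x ∈ closedBall y r := fun x hx => by
    rw [mem_closedBall, dist_eq_norm] at hx ⊢
    rw [← sq_le_sq₀ (norm_nonneg _) hr.le, norm_mirror_sub_sq hν]
    simp only [a, sub_self, mul_zero, add_zero]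
    gcongr
  set g : E → ℝ := fun x => w x - w (mirror ν a x) with hg
  set β : E → ℝ := fun x => k * ‖x - y‖ ^ 2 + c * (⟪x - y, ν⟫ * (r - ⟪x - y, ν⟫)) with hβ
  have hgC : ∀ x ∈ closedBall y r, ContDiffAt ℝ 2 g x := fun x hx =>
    (hC x hx).sub (hC _ (hmb x hx)).comp_mirror
  have hpoly : ContDiff ℝ 2 fun t : ℝ => t * (r - t) := by fun_prop
  have hT : ContDiff ℝ 2 fun x : E => ⟪x - y, ν⟫ * (r - ⟪x - y, ν⟫) :=
    hpoly.comp ((contDiff_id.sub contDiff_const).inner ℝ contDiff_const)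
  have hβC : ∀ x, ContDiffAt ℝ 2 β x := fun x =>
    (contDiffAt_const.mul (contDiff_norm_sub_sq y).contDiffAt).add
      (contDiffAt_const.mul hT.contDiffAt)
  have hΔβ : ∀ x, Δ β x = k * (2 * n) + c * (-2) := fun x => by
    rw [hβ, laplacian_add_apply (contDiffAt_const.mul (contDiff_norm_sub_sq y).contDiffAt)
      (contDiffAt_const.mul hT.contDiffAt), laplacian_const_mul _
      (contDiff_norm_sub_sq y).contDiffAt, laplacian_const_mul _ hT.contDiffAt,
      laplacian_norm_sub_sq]
    congr 2
    exact laplacian_comp_inner (f := fun t => t * (r - t)) (f' := fun t => r - 2 * t) y x hν hpoly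
      (fun s => ((hasDerivAt_id' s).mul ((hasDerivAt_id' s).const_sub r)).congr_deriv (by ring))
      ((((hasDerivAt_id' _).const_mul 2).const_sub r).congr_deriv (by ring))
  have key : ∀ x ∈ S, g x - β x ≤ 0 := by
    refine weak_max hScl (fun x hx => ((hgC x hx.1).sub (hβC x)).continuousAt.continuousWithinAt)
      fun x hx hpos => ?_
    have hwx := abs_le.1 (hw x hx.1)
    have hwm := abs_le.1 (hw _ (hmb x hx.1))
    have htr : ⟪x - y, ν⟫ ≤ r := by
      have h1 := real_inner_le_norm (x - y) ν
      have h2 := hx.1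
      rw [mem_closedBall, dist_eq_norm] at h2
      rw [hν] at h1; linarith
    have hT0 : 0 ≤ c * (⟪x - y, ν⟫ * (r - ⟪x - y, ν⟫)) :=
      mul_nonneg hc0 (mul_nonneg hx.2 (by linarith))
    have h1 : 0 < ⟪x - y, ν⟫ := by
      refine lt_of_le_of_ne hx.2 fun h => ?_
      have h3 : ⟪x, ν⟫ = a := by rw [inner_sub_left] at h; simp only [a]; linarith
      have : g x = 0 := by simp only [hg, mirror_of_inner_eq h3, sub_self]
      have : 0 ≤ β x := by simp only [hβ]; positivity
      linarith
    have h2 : ‖x - y‖ < r := by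
      have h2 := hx.1
      rw [mem_closedBall, dist_eq_norm] at h2
      refine lt_of_le_of_ne h2 fun h => ?_
      have h3 : k * ‖x - y‖ ^ 2 = 2 * A := by rw [h, hk]; field_simp
      simp only [hβ, hg, h3] at hpos
      linarith
    refine ⟨?_, (hgC x hx.1).sub (hβC x), ?_⟩
    · have h3 : closedBall y r ∈ 𝓝 x :=
        mem_of_superset (isOpen_ball.mem_nhds (by rwa [mem_ball, dist_eq_norm]))
          ball_subset_closedBall
      filter_upwards [h3, hinner.continuousAt.eventually (lt_mem_nhds h1)] with z hz1 hz2
      exact ⟨hz1, le_of_lt hz2⟩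
    · rw [laplacian_sub_apply (hgC x hx.1) (hβC x), hg,
        laplacian_sub_apply (hC x hx.1) (hC _ (hmb x hx.1)).comp_mirror,
        laplacian_comp_mirror hν (hC _ (hmb x hx.1)), hL x hx.1, hL _ (hmb x hx.1), hΔβ]
      have h4 : k * (2 * n) + c * (-2) = -(2 * Λ * A + 2 * (A / r ^ 2)) := by
        rw [hk, hc]; ring
      have h5 : 0 < A / r ^ 2 := by positivity
      have h6 : l * (w x - w (mirror ν a x)) ≤ l * (2 * A) := by gcongr; linarith
      have h7 : l * (2 * A) ≤ Λ * (2 * A) := by gcongr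
      rw [h4]; linarith
  have hyb : y ∈ closedBall y r := mem_closedBall_self hr.le
  have hmy : mirror ν a y = y := mirror_of_inner_eq rfl
  have hd : HasDerivAt (fun t : ℝ => g (y + t • ν)) (2 * fderiv ℝ w y ν) 0 := by
    have h1 := hasDerivAt_fderiv_line ((hgC y hyb).differentiableAt (by simp)) ν
    refine h1.congr_deriv ?_
    have hcm : ContDiffAt ℝ 2 w (mirror ν a y) := by rw [hmy]; exact hC y hyb
    have h2 := fderiv_fun_sub (𝕜 := ℝ) ((hC y hyb).differentiableAt (by simp))
      (hcm.comp_mirror.differentiableAt (by simp))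
    rw [hg, h2, sub_apply, fderiv_comp_mirror hcm, hmy,
      real_inner_self_eq_norm_sq, hν]
    have : ν - ((2 : ℝ) * 1 ^ 2) • ν = -ν := by module
    rw [this, map_neg]; ring
  have hβd : HasDerivAt (fun t : ℝ => k * t ^ 2 + c * (t * (r - t))) (c * r) 0 :=
    ((((hasDerivAt_pow 2 (0 : ℝ))).const_mul k).add
      (((hasDerivAt_id' (0 : ℝ)).mul ((hasDerivAt_id' (0 : ℝ)).const_sub r)).const_mul
        c)).congr_deriv (by simp)
  have hfin := (hd.sub hβd).nonpos_of_right (by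
    filter_upwards [Ioo_mem_nhdsGT hr] with t ht
    have hin : ⟪t • ν, ν⟫ = t := by
      rw [inner_smul_left, real_inner_self_eq_norm_sq, hν]; simp
    have hno : ‖t • ν‖ = t := by rw [norm_smul, hν, Real.norm_eq_abs, abs_of_pos ht.1, mul_one]
    have := key (y + t • ν) ⟨by simpa [hno] using ht.2.le, by simp [hin, ht.1.le]⟩
    simp only [hβ, add_sub_cancel_left, hin, hno] at this
    simpa [hg, hmy] using this)
  have h8 : c * r = 2 * (A * (n / r + Λ * r / 2 + 1 / (2 * r))) := by
    rw [hc]; field_simp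
  have h9 : n / r + Λ * r / 2 + 1 / (2 * r) ≤ gradConst E Λ r := by
    have : gradConst E Λ r = n / r + Λ * r / 2 + 1 / (2 * r) + (Λ * r / 2 + 1 / (2 * r)) := by
      rw [gradConst, ← hn]; field_simp; ring
    have : 0 ≤ Λ * r / 2 + 1 / (2 * r) := by positivity
    linarith
  have := mul_le_mul_of_nonneg_left h9 hA.le
  linarith

/-- Interior gradient estimate. -/
theorem abs_fderiv_le {w : E → ℝ} {y : E} {r A Λ l : ℝ} (hr : 0 < r) (hA : 0 < A)
    (hl0 : 0 ≤ l) (hl : l ≤ Λ) (hC : ∀ x ∈ closedBall y r, ContDiffAt ℝ 2 w x)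
    (hL : ∀ x ∈ closedBall y r, Δ w x = -(l * w x)) (hw : ∀ x ∈ closedBall y r, |w x| ≤ A)
    (v : E) : |fderiv ℝ w y v| ≤ A * gradConst E Λ r * ‖v‖ := by
  have main : ∀ v, fderiv ℝ w y v ≤ A * gradConst E Λ r * ‖v‖ := fun v => by
    rcases eq_or_ne v 0 with rfl | hv
    · simp
    have hv' : 0 < ‖v‖ := norm_pos_iff.2 hv
    have h := fderiv_le_of_laplacian_eq hr hA hl0 hl hC hL hw
      (ν := ‖v‖⁻¹ • v) (by rw [norm_smul, norm_inv, norm_norm, inv_mul_cancel₀ hv'.ne'])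
    rw [map_smul, smul_eq_mul, inv_mul_le_iff₀ hv'] at h
    linarith
  have h2 := main (-v)
  rw [map_neg, norm_neg] at h2
  exact abs_le.2 ⟨by linarith, main v⟩

end GradientEstimate

section InteriorEstimates

open Laplacian

theorem add_mem_closedBall_of {E : Type*} [NormedAddCommGroup E] {x y h : E} {ρ s : ℝ} (hx : x ∈ closedBall y ρ) (hh : ‖h‖ ≤ s) :
    x + h ∈ closedBall y (ρ + s) := by
  rw [mem_closedBall, dist_eq_norm] at *
  calc ‖x + h - y‖ = ‖(x - y) + h‖ := by congr 1; abel
    _ ≤ ‖x - y‖ + ‖h‖ := norm_add_le _ _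
    _ ≤ ρ + s := add_le_add hx hh

variable {E : Type*} [NormedAddCommGroup E] [InnerProductSpace ℝ E] [FiniteDimensional ℝ E]

/-- `w` is a `C²` solution of `Δw = -l w` near every point of `S`. -/
def Helmholtz (l : ℝ) (S : Set E) (w : E → ℝ) : Prop :=
  ∀ x ∈ S, ContDiffAt ℝ 2 w x ∧ Δ w x = -(l * w x)

theorem Helmholtz.mono {l : ℝ} {S T : Set E} {w : E → ℝ} (h : Helmholtz l T w) (hST : S ⊆ T) :
    Helmholtz l S w := fun x hx => h x (hST hx)

theorem Helmholtz.differentiableAt {l : ℝ} {S : Set E} {w : E → ℝ} (h : Helmholtz l S w) {x : E}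
    (hx : x ∈ S) : DifferentiableAt ℝ w x := (h x hx).1.differentiableAt (by simp)

theorem Helmholtz.continuousOn {l : ℝ} {S : Set E} {w : E → ℝ} (h : Helmholtz l S w) :
    ContinuousOn w S := fun x hx => (h x hx).1.continuousAt.continuousWithinAt

theorem Helmholtz.sub {l : ℝ} {S : Set E} {w v : E → ℝ} (hw : Helmholtz l S w)
    (hv : Helmholtz l S v) : Helmholtz l S fun x => w x - v x := fun x hx =>
  ⟨(hw x hx).1.sub (hv x hx).1, by
    rw [laplacian_sub_apply (hw x hx).1 (hv x hx).1, (hw x hx).2, (hv x hx).2]; ring⟩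

theorem Helmholtz.const_mul {l : ℝ} {S : Set E} {w : E → ℝ} (hw : Helmholtz l S w) (a : ℝ) :
    Helmholtz l S fun x => a * w x := fun x hx =>
  ⟨contDiffAt_const.mul (hw x hx).1, by
    rw [laplacian_const_mul _ (hw x hx).1, (hw x hx).2]; ring⟩

theorem Helmholtz.comp_isometry {l : ℝ} {S T : Set E} {w : E → ℝ} (hw : Helmholtz l T w)
    (A : E ≃ₗᵢ[ℝ] E) (a : E) (hST : ∀ x ∈ S, A x + a ∈ T) :
    Helmholtz l S fun x => w (A x + a) := fun x hx =>
  ⟨(hw _ (hST x hx)).1.comp x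
    (A.toContinuousLinearEquiv.contDiff.add contDiff_const).contDiffAt, by
    rw [laplacian_comp_isometry A a x (hw _ (hST x hx)).1, (hw _ (hST x hx)).2]⟩

theorem Helmholtz.comp_add {l : ℝ} {S T : Set E} {w : E → ℝ} (hw : Helmholtz l T w) (h : E)
    (hST : ∀ x ∈ S, x + h ∈ T) : Helmholtz l S fun x => w (x + h) :=
  hw.comp_isometry (LinearIsometryEquiv.refl ℝ E) h hST

theorem Helmholtz.comp_mirror {l : ℝ} {S T : Set E} {w : E → ℝ} (hw : Helmholtz l T w) {ν : E}
    (hν : ‖ν‖ = 1) (c : ℝ) (hST : ∀ x ∈ S, mirror ν c x ∈ T) :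
    Helmholtz l S fun x => w (mirror ν c x) := fun x hx =>
  ⟨(hw _ (hST x hx)).1.comp_mirror, by
    rw [laplacian_comp_mirror hν (hw _ (hST x hx)).1, (hw _ (hST x hx)).2]⟩

/-- The data for interior estimates: a solution on a ball, bounded by `A`. -/
def BoundedSol (l A : ℝ) (y : E) (ρ : ℝ) (w : E → ℝ) : Prop :=
  Helmholtz l (closedBall y ρ) w ∧ ∀ x ∈ closedBall y ρ, |w x| ≤ A

variable {w : E → ℝ} {y : E} {l Λ r A : ℝ}

theorem BoundedSol.abs_fderiv_le {ρ : ℝ} (h : BoundedSol l A y ρ w) (hr : 0 < r) (hA : 0 ≤ A)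
    (hl0 : 0 ≤ l) (hl : l ≤ Λ) {x : E} (hx : x ∈ closedBall y (ρ - r)) (v : E) :
    |fderiv ℝ w x v| ≤ A * gradConst E Λ r * ‖v‖ := by
  have hsub : closedBall x r ⊆ closedBall y ρ := by
    refine closedBall_subset_closedBall' ?_
    rw [mem_closedBall] at hx; linarith
  have main : ∀ B > A, |fderiv ℝ w x v| ≤ B * gradConst E Λ r * ‖v‖ := fun B hB =>
    _root_.abs_fderiv_le hr (hA.trans_lt hB) hl0 hl (fun z hz => (h.1 z (hsub hz)).1)
      (fun z hz => (h.1 z (hsub hz)).2) (fun z hz => (h.2 z (hsub hz)).trans hB.le) v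
  have hc : ContinuousWithinAt (fun B => B * gradConst E Λ r * ‖v‖) (Ioi A) A := by
    fun_prop
  exact ge_of_tendsto hc.tendsto (eventually_nhdsWithin_of_forall main)

theorem BoundedSol.translate_sub {ρ : ℝ} (h : BoundedSol l A y ρ w) (hr : 0 < r) (hA : 0 ≤ A)
    (hl0 : 0 ≤ l) (hl : l ≤ Λ) {k : E} (hk : ‖k‖ ≤ r) :
    BoundedSol l (A * gradConst E Λ r * ‖k‖) y (ρ - 2 * r) fun x => w (x + k) - w x := by
  have hin : ∀ x ∈ closedBall y (ρ - 2 * r), x + k ∈ closedBall y (ρ - r) := fun x hx => by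
    have := add_mem_closedBall_of hx hk
    rwa [show ρ - 2 * r + r = ρ - r by ring] at this
  have hs1 : closedBall y (ρ - r) ⊆ closedBall y ρ := closedBall_subset_closedBall (by linarith)
  have hs2 : closedBall y (ρ - 2 * r) ⊆ closedBall y (ρ - r) :=
    closedBall_subset_closedBall (by linarith)
  refine ⟨(h.1.comp_add k fun x hx => hs1 (hin x hx)).sub (h.1.mono (hs2.trans hs1)),
    fun x hx => ?_⟩
  have hK : 0 ≤ A * gradConst E Λ r := by
    have : 0 ≤ Λ := hl0.trans hl
    unfold gradConst; positivity
  have := (convex_closedBall y (ρ - r)).norm_image_sub_le_of_norm_fderiv_le (𝕜 := ℝ) (f := w)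
    (C := A * gradConst E Λ r) (fun z hz => h.1.differentiableAt (hs1 hz))
    (fun z hz => ContinuousLinearMap.opNorm_le_bound _ hK fun v =>
      h.abs_fderiv_le hr hA hl0 hl hz v) (hs2 hx) (hin x hx)
  simpa using this

/-- Uniform second and third order estimates at the centre of a ball. -/
theorem BoundedSol.fderiv_sub_le (h : BoundedSol l 1 y (5 * r) w) (hr : 0 < r)
    (hl0 : 0 ≤ l) (hl : l ≤ Λ) {k : E} (hk : ‖k‖ ≤ r) (v : E) :
    |fderiv ℝ w (y + k) v - fderiv ℝ w y v| ≤ gradConst E Λ r ^ 2 * ‖k‖ * ‖v‖ := by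
  have hΛ : 0 ≤ Λ := hl0.trans hl
  have hK : 0 ≤ gradConst E Λ r := by unfold gradConst; positivity
  have h1 := (h.translate_sub hr zero_le_one hl0 hl hk).abs_fderiv_le hr (by positivity) hl0 hl
    (mem_closedBall_self (by linarith)) v
  rw [fderiv_fun_sub, fderiv_comp_add_right, sub_apply] at h1
  · exact h1.trans (le_of_eq (by ring))
  · exact ((h.1.comp_add (S := {y}) k fun x hx => by
      rw [mem_singleton_iff.1 hx]; simp; linarith).differentiableAt rfl)
  · exact h.1.differentiableAt (mem_closedBall_self (by linarith))

theorem BoundedSol.fderiv_sub_sub_le (h : BoundedSol l 1 y (5 * r) w) (hr : 0 < r)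
    (hl0 : 0 ≤ l) (hl : l ≤ Λ) {k m : E} (hk : ‖k‖ ≤ r) (hm : ‖m‖ ≤ r) (v : E) :
    |(fderiv ℝ w (y + m + k) v - fderiv ℝ w (y + m) v) - (fderiv ℝ w (y + k) v - fderiv ℝ w y v)| ≤
      gradConst E Λ r ^ 3 * ‖k‖ * ‖m‖ * ‖v‖ := by
  have hΛ : 0 ≤ Λ := hl0.trans hl
  have hK : 0 ≤ gradConst E Λ r := by unfold gradConst; positivity
  have hd : ∀ a : E, ‖a‖ ≤ 5 * r → DifferentiableAt ℝ w (y + a) := fun a ha =>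
    h.1.differentiableAt (by simpa using ha)
  have hmk : ‖m + k‖ ≤ 5 * r := (norm_add_le _ _).trans (by linarith)
  have h1 := ((h.translate_sub hr zero_le_one hl0 hl hk).translate_sub hr (by positivity) hl0 hl
    hm).abs_fderiv_le hr (by positivity) hl0 hl (mem_closedBall_self (by linarith)) v
  have d1 : DifferentiableAt ℝ (fun x => w (x + m + k)) y := by
    simp only [add_assoc]
    rw [differentiableAt_comp_add_right]; exact hd _ hmk
  have d2 : DifferentiableAt ℝ (fun x => w (x + m)) y := by
    rw [differentiableAt_comp_add_right]; exact hd _ (by linarith)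
  have d3 : DifferentiableAt ℝ (fun x => w (x + k)) y := by
    rw [differentiableAt_comp_add_right]; exact hd _ (by linarith)
  have d4 : DifferentiableAt ℝ w y := by simpa using hd 0 (by simp; linarith)
  have e : HasFDerivAt (fun x => w (x + m + k) - w (x + m) - (w (x + k) - w x)) _ y :=
    (d1.hasFDerivAt.sub d2.hasFDerivAt).sub (d3.hasFDerivAt.sub d4.hasFDerivAt)
  rw [e.fderiv] at h1
  simp only [add_assoc, fderiv_comp_add_right, sub_apply] at h1
  rw [add_assoc]
  exact h1.trans (le_of_eq (by ring))

theorem BoundedSol.abs_D2_le (h : BoundedSol l 1 y (5 * r) w) (hr : 0 < r)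
    (hl0 : 0 ≤ l) (hl : l ≤ Λ) (k v : E) :
    |fderiv ℝ (fderiv ℝ w) y k v| ≤ gradConst E Λ r ^ 2 * ‖k‖ * ‖v‖ := by
  have hc : ContDiffAt ℝ 2 w (y + (0 : ℝ) • k) := by
    simpa using (h.1 y (mem_closedBall_self (by linarith))).1
  have hd := hasDerivAt_fderiv_apply_line k v hc
  have h1 := hd.le_of_lip' (C := gradConst E Λ r ^ 2 * ‖k‖ * ‖v‖) (by positivity) ?_
  · simpa using h1
  · have hcont : ContinuousAt (fun t : ℝ => ‖t • k‖) 0 := by fun_prop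
    filter_upwards [hcont.eventually (gt_mem_nhds (by simpa using hr))] with t ht
    have := h.fderiv_sub_le hr hl0 hl ht.le v
    simp only [zero_smul, add_zero, Real.norm_eq_abs, sub_zero]
    refine this.trans (le_of_eq ?_)
    rw [norm_smul, Real.norm_eq_abs]; ring

theorem BoundedSol.abs_D2_sub_le (h : BoundedSol l 1 y (5 * r) w) (hr : 0 < r)
    (hl0 : 0 ≤ l) (hl : l ≤ Λ) {m : E} (hm : ‖m‖ ≤ r) (k v : E) :
    |fderiv ℝ (fderiv ℝ w) (y + m) k v - fderiv ℝ (fderiv ℝ w) y k v| ≤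
      gradConst E Λ r ^ 3 * ‖k‖ * ‖m‖ * ‖v‖ := by
  have hΛ : 0 ≤ Λ := hl0.trans hl
  have hK : 0 ≤ gradConst E Λ r := by unfold gradConst; positivity
  have hc : ContDiffAt ℝ 2 w (y + (0 : ℝ) • k) := by
    simpa using (h.1 y (mem_closedBall_self (by linarith))).1
  have hc' : ContDiffAt ℝ 2 w (y + m + (0 : ℝ) • k) := by
    simpa using (h.1 (y + m) (by simp; linarith)).1
  have hd := (hasDerivAt_fderiv_apply_line k v hc').sub (hasDerivAt_fderiv_apply_line k v hc)
  have h1 := hd.le_of_lip' (C := gradConst E Λ r ^ 3 * ‖k‖ * ‖m‖ * ‖v‖) (by positivity) ?_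
  · simpa using h1
  · have hcont : ContinuousAt (fun t : ℝ => ‖t • k‖) 0 := by fun_prop
    filter_upwards [hcont.eventually (gt_mem_nhds (by simpa using hr))] with t ht
    have := h.fderiv_sub_sub_le hr hl0 hl ht.le hm v
    simp only [zero_smul, add_zero, Real.norm_eq_abs, sub_zero, Pi.sub_apply]
    rw [show ∀ a b c d : ℝ, a - b - (c - d) = a - c - (b - d) by intros; ring]
    refine this.trans (le_of_eq ?_)
    rw [norm_smul, Real.norm_eq_abs]; ring

theorem BoundedSol.taylor_one (h : BoundedSol l 1 y (5 * r) w) (hr : 0 < r)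
    (hl0 : 0 ≤ l) (hl : l ≤ Λ) {k : E} (hk : ‖k‖ ≤ r) :
    |w (y + k) - w y - fderiv ℝ w y k| ≤ gradConst E Λ r ^ 2 * ‖k‖ ^ 2 := by
  have htk : ∀ t ∈ Icc (0 : ℝ) 1, ‖t • k‖ ≤ ‖k‖ := fun t ht => by
    rw [norm_smul, Real.norm_eq_abs, abs_of_nonneg ht.1]
    exact mul_le_of_le_one_left (norm_nonneg _) ht.2
  have hd : ∀ t ∈ Icc (0 : ℝ) 1, HasDerivAt (fun t : ℝ => w (y + t • k) - t * fderiv ℝ w y k)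
      (fderiv ℝ w (y + t • k) k - fderiv ℝ w y k) t := fun t ht => by
    have h1 : DifferentiableAt ℝ w (y + t • k) := h.1.differentiableAt (by
      simp only [mem_closedBall, dist_self_add_left]; linarith [htk t ht])
    exact ((h1.hasFDerivAt.comp_hasDerivAt t (hasDerivAt_line y k t)).sub
      ((hasDerivAt_id' t).mul_const _)).congr_deriv (by simp)
  have := norm_image_sub_le_of_norm_deriv_le_segment_01' (C := gradConst E Λ r ^ 2 * ‖k‖ ^ 2)
    (fun t ht => (hd t ht).hasDerivWithinAt) fun t ht => by
      have ht' := htk t (Ico_subset_Icc_self ht)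
      refine (h.fderiv_sub_le hr hl0 hl (ht'.trans hk) k).trans ?_
      rw [pow_two ‖k‖, ← mul_assoc]
      gcongr
  simp only [one_smul, one_mul, zero_smul, add_zero, zero_mul, sub_zero, Real.norm_eq_abs] at this
  rwa [show ∀ a b c : ℝ, a - b - c = a - c - b by intros; ring]

theorem BoundedSol.taylor_two (h : BoundedSol l 1 y (5 * r) w) (hr : 0 < r)
    (hl0 : 0 ≤ l) (hl : l ≤ Λ) {k : E} (hk : ‖k‖ ≤ r) (v : E) :
    |fderiv ℝ w (y + k) v - fderiv ℝ w y v - fderiv ℝ (fderiv ℝ w) y k v| ≤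
      gradConst E Λ r ^ 3 * ‖k‖ ^ 2 * ‖v‖ := by
  have hΛ : 0 ≤ Λ := hl0.trans hl
  have hK : 0 ≤ gradConst E Λ r := by unfold gradConst; positivity
  have htk : ∀ t ∈ Icc (0 : ℝ) 1, ‖t • k‖ ≤ ‖k‖ := fun t ht => by
    rw [norm_smul, Real.norm_eq_abs, abs_of_nonneg ht.1]
    exact mul_le_of_le_one_left (norm_nonneg _) ht.2
  have hd : ∀ t ∈ Icc (0 : ℝ) 1, HasDerivAt
      (fun t : ℝ => fderiv ℝ w (y + t • k) v - t * fderiv ℝ (fderiv ℝ w) y k v)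
      (fderiv ℝ (fderiv ℝ w) (y + t • k) k v - fderiv ℝ (fderiv ℝ w) y k v) t := fun t ht => by
    have h1 : ContDiffAt ℝ 2 w (y + t • k) := (h.1 _ (by
      simp only [mem_closedBall, dist_self_add_left]; linarith [htk t ht])).1
    exact ((hasDerivAt_fderiv_apply_line k v h1).sub
      ((hasDerivAt_id' t).mul_const _)).congr_deriv (by simp)
  have := norm_image_sub_le_of_norm_deriv_le_segment_01'
    (C := gradConst E Λ r ^ 3 * ‖k‖ ^ 2 * ‖v‖)
    (fun t ht => (hd t ht).hasDerivWithinAt) fun t ht => by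
      have ht' := htk t (Ico_subset_Icc_self ht)
      refine (h.abs_D2_sub_le hr hl0 hl (ht'.trans hk) k v).trans ?_
      rw [pow_two ‖k‖, ← mul_assoc]
      gcongr
  simp only [one_smul, one_mul, zero_smul, add_zero, zero_mul, sub_zero, Real.norm_eq_abs] at this
  rwa [show ∀ a b c : ℝ, a - b - c = a - c - b by intros; ring]

end InteriorEstimates

section PerforatedBall

open Laplacian

/-- The unit ball with the closed ball `B(P, ε)` removed. -/
def dom {E : Type*} [NormedAddCommGroup E] (P : E) (ε : ℝ) : Set E := ball 0 1 \ closedBall P ε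

theorem mem_dom {E : Type*} [NormedAddCommGroup E] {P x : E} {ε : ℝ} :
    x ∈ dom P ε ↔ ‖x‖ < 1 ∧ ε < ‖x - P‖ := by
  simp [dom, dist_eq_norm]

theorem isOpen_dom {E : Type*} [NormedAddCommGroup E] (P : E) (ε : ℝ) : IsOpen (dom P ε) :=
  isOpen_ball.sdiff isClosed_closedBall

/-- The logarithmic-type barrier near a point, as a function of the squared distance. -/
theorem exists_inner_barrier {n Λ : ℝ} (hn : 2 ≤ n) : ∃ q₀ > 0,
    ∃ f f' f'' : ℝ → ℝ, (∀ q > 0, ContDiffAt ℝ 2 f q ∧ HasDerivAt f (f' q) q ∧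
      HasDerivAt f' (f'' q) q) ∧ (∀ q > 0, q ≤ q₀ → 0 < f q ∧
      4 * q * f'' q + 2 * n * f' q < -(Λ * f q)) ∧ Tendsto f (𝓝[>] 0) atTop := by
  have hlog := Real.tendsto_log_nhdsGT_zero
  have hsq : Tendsto (fun q : ℝ => √q) (𝓝[>] 0) (𝓝 0) := by
    have := (Real.continuous_sqrt.tendsto 0).mono_left (nhdsWithin_le_nhds (s := Ioi (0 : ℝ)))
    simpa using this
  have hls : Tendsto (fun q : ℝ => Λ * (-(Real.log q * √q) - √q * √q)) (𝓝[>] 0) (𝓝 0) := by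
    have h1 := tendsto_log_mul_rpow_nhdsGT_zero (r := 1 / 2) (by norm_num)
    simp only [← Real.sqrt_eq_rpow] at h1
    simpa using ((h1.neg).sub (hsq.mul hsq)).const_mul Λ
  have ev : ∀ᶠ q in 𝓝[>] (0 : ℝ), Real.log q < -1 ∧ √q < 1 ∧
      Λ * (-(Real.log q * √q) - √q * √q) < 1 :=
    (hlog.eventually (eventually_lt_atBot (-1))).and ((hsq.eventually (gt_mem_nhds one_pos)).and
      (hls.eventually (gt_mem_nhds one_pos)))
  obtain ⟨q₀, hq₀, hsub⟩ := mem_nhdsGT_iff_exists_Ioc_subset.1 ev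
  refine ⟨q₀, hq₀, fun q => -Real.log q - √q, fun q => -q⁻¹ - 1 / (2 * √q),
    fun q => (q ^ 2)⁻¹ + 1 / (4 * (q * √q)), fun q hq => ⟨?_, ?_, ?_⟩, fun q hq hq' => ?_, ?_⟩
  · exact ((Real.contDiffAt_log.2 hq.ne').neg).sub (Real.contDiffAt_sqrt hq.ne')
  · exact (Real.hasDerivAt_log hq.ne').neg.sub (Real.hasDerivAt_sqrt hq.ne')
  · have hs : 0 < √q := Real.sqrt_pos.2 hq
    have hss : √q ^ 2 = q := Real.sq_sqrt hq.le
    have h2 := (((Real.hasDerivAt_sqrt hq.ne').const_mul 2).inv (by positivity))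
    refine ((hasDerivAt_inv hq.ne').neg.sub (h2.congr_of_eventuallyEq ?_)).congr_deriv ?_
    · exact Eventually.of_forall fun t => by simp
    · field_simp
      have hsss : √q ^ 3 = √q * q := by rw [pow_succ, hss]; ring
      rw [hss]; ring_nf
      rw [hsss]
  · obtain ⟨h1, h2, h3⟩ := hsub (show q ∈ Ioc 0 q₀ from ⟨hq, hq'⟩)
    refine ⟨by linarith, ?_⟩
    have hs : 0 < √q := Real.sqrt_pos.2 hq
    have hss : √q ^ 2 = q := Real.sq_sqrt hq.le
    have e1 : 4 * q * ((q ^ 2)⁻¹ + 1 / (4 * (q * √q))) + 2 * n * (-q⁻¹ - 1 / (2 * √q)) =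
        (4 - 2 * n) / q + (1 - n) / √q := by field_simp; ring
    have e2 : (4 - 2 * n) / q ≤ 0 := div_nonpos_of_nonpos_of_nonneg (by linarith) hq.le
    have e3 : (1 - n) / √q < -(Λ * (-Real.log q - √q)) := by
      rw [div_lt_iff₀ hs]
      nlinarith
    rw [e1]; linarith
  · have := (tendsto_neg_atBot_atTop.comp hlog).atTop_add hsq.neg
    simpa [sub_eq_add_neg] using! this

variable {E : Type*} [NormedAddCommGroup E] [InnerProductSpace ℝ E] [FiniteDimensional ℝ E]

/-- A nonnegative function, normalized by `u ≤ 1`, solving `Δu = -l u` in the punctured ball and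
extended by zero. -/
structure PosSol (P : E) (ε l : ℝ) (u : E → ℝ) : Prop where
  eps_nonneg : 0 ≤ ε
  eigen_pos : 0 < l
  helm : Helmholtz l (dom P ε) u
  pos : ∀ x ∈ dom P ε, 0 < u x
  zero : ∀ x, x ∉ dom P ε → u x = 0
  le_one : ∀ x, u x ≤ 1
  cont : ContinuousOn u {P}ᶜ

variable {P : E} {ε l Λ : ℝ} {u : E → ℝ}

theorem PosSol.nonneg (h : PosSol P ε l u) (x : E) : 0 ≤ u x := by
  by_cases hx : x ∈ dom P ε
  · exact (h.pos x hx).le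
  · rw [h.zero x hx]

theorem PosSol.mem_of_pos (h : PosSol P ε l u) {x : E} (hx : 0 < u x) : x ∈ dom P ε := by
  by_contra hx'
  exact hx.ne' (h.zero x hx')

theorem PosSol.continuous (h : PosSol P ε l u) (hε : 0 < ε) : Continuous u := by
  rw [continuous_iff_continuousAt]
  intro x
  by_cases hx : x = P
  · refine ContinuousAt.congr (f := fun _ => (0 : ℝ)) continuousAt_const ?_
    rw [hx]
    filter_upwards [closedBall_mem_nhds P hε] with y hy
    rw [h.zero y fun hy' => hy'.2 hy]
  · exact h.cont.continuousAt (isOpen_compl_singleton.mem_nhds hx)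

/-- The sweeping principle: a solution which is nonpositive on the relevant part of the boundary is
dominated by a multiple of `u`, and either this multiple is `0` or it touches the solution. -/
def Sweeps (P : E) (ε l : ℝ) (u : E → ℝ) : Prop :=
  ∀ (Q G : Set E) (w : E → ℝ) (M : ℝ), IsClosed Q →
    IsOpen G → G ⊆ Q → G ⊆ dom P ε → ContinuousOn w (Q \ {P}) → (∀ x ∈ Q, w x ≤ M) →
    Helmholtz l G w → (∀ x ∈ Q, x ≠ P → x ∉ G → w x ≤ 0) →
    ∃ t ≥ 0, (∀ x ∈ Q, x ≠ P → w x ≤ t * u x) ∧ (t = 0 ∨ ∃ x ∈ G, w x = t * u x)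

theorem exists_sweeps (hn : 2 ≤ Module.finrank ℝ E) (hP : ‖P‖ < 1) (Λ : ℝ) : ∃ ρ > 0,
    ∀ ε l u, PosSol P ε l u → ε < ρ → l ≤ Λ → Sweeps P ε l u := by
  set n : ℝ := (Module.finrank ℝ E : ℝ) with hnn
  have hn' : 2 ≤ n := by rw [hnn]; exact_mod_cast hn
  obtain ⟨q₀, hq₀, f, f', f'', hf, hfq, hft⟩ := exists_inner_barrier (Λ := Λ) hn'
  set Λ' := max Λ 1 with hΛ'
  have hΛ1 : 1 ≤ Λ' := le_max_right _ _
  set z₀ := 1 / (2 + n + Λ') with hz₀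
  have hz₀0 : 0 < z₀ := by positivity
  have hz₀e : z₀ * (2 + n + Λ') = 1 := by rw [hz₀]; field_simp
  obtain ⟨R, hR1, hRP, hR0, hRz⟩ : ∃ R < 1, ‖P‖ < R ∧ 0 < R ∧ 1 - z₀ ≤ R ^ 2 := by
    have hz1 : z₀ < 1 := by nlinarith
    refine ⟨max (√(1 - z₀)) ((1 + ‖P‖) / 2), max_lt ?_ (by linarith), ?_, ?_, ?_⟩
    · rw [Real.sqrt_lt' one_pos]; linarith
    · exact lt_max_of_lt_right (by linarith)
    · exact lt_max_of_lt_right (by linarith [norm_nonneg P])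
    · calc 1 - z₀ = √(1 - z₀) ^ 2 := (Real.sq_sqrt (by linarith)).symm
        _ ≤ _ := by gcongr; exact le_max_left _ _
  set ρ := min (√q₀) ((R - ‖P‖) / 2) with hρ
  have hρ0 : 0 < ρ := lt_min (Real.sqrt_pos.2 hq₀) (by linarith)
  have hρR : ρ < R - ‖P‖ := (min_le_right _ _).trans_lt (by linarith)
  have hρq : ρ ^ 2 ≤ q₀ := by
    calc ρ ^ 2 ≤ √q₀ ^ 2 := by gcongr; exact min_le_left _ _
      _ = q₀ := Real.sq_sqrt hq₀.le
  refine ⟨ρ, hρ0, fun ε l u hu hερ hlΛ Q G w M hQ hG hGQ hGd hw hM hwG hw0 => ?_⟩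
  have hl0 := hu.eigen_pos
  have htri : ∀ x : E, ‖x‖ ≤ ‖x - P‖ + ‖P‖ := fun x => by
    simpa using norm_add_le (x - P) P
  set K := {x ∈ Q | ‖x‖ ≤ R ∧ ρ ≤ ‖x - P‖} with hK
  have hKP : ∀ x ∈ K, x ≠ P := fun x hx h => by
    have := hx.2.2; rw [h] at this; simp at this; linarith
  have hKd : K ⊆ dom P ε := fun x hx =>
    mem_dom.2 ⟨hx.2.1.trans_lt hR1, hερ.trans_le hx.2.2⟩
  have hKc : IsCompact K := by
    refine (isCompact_closedBall (0 : E) R).of_isClosed_subset ?_ fun x hx => by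
      simpa using hx.2.1
    exact hQ.inter ((isClosed_le continuous_norm continuous_const).inter
      (isClosed_le continuous_const (continuous_id.sub continuous_const).norm))
  have hGP : ∀ x ∈ G, x ≠ P := fun x hx h => by
    have := (mem_dom.1 (hGd hx)).2; rw [h] at this; simp at this; linarith [hu.eps_nonneg]
  have hwpos : ∀ x ∈ Q, x ≠ P → 0 < w x → x ∈ G := fun x hx hxP hwx => by
    by_contra hxG
    exact absurd (hw0 x hx hxP hxG) (not_le.2 hwx)
  obtain ⟨t, ht0, htK, htouch⟩ : ∃ t ≥ 0, (∀ x ∈ K, w x ≤ t * u x) ∧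
      (t = 0 ∨ ∃ x ∈ G, w x = t * u x) := by
    by_cases hall : ∀ x ∈ K, w x ≤ 0
    · exact ⟨0, le_rfl, by simpa using hall, Or.inl rfl⟩
    push Not at hall
    obtain ⟨x₁, hx₁, hwx₁⟩ := hall
    have hwK : ContinuousOn w K := hw.mono fun x hx => ⟨hx.1, hKP x hx⟩
    have huK : ContinuousOn u K := hu.helm.continuousOn.mono hKd
    obtain ⟨x₀, hx₀, hmax⟩ := hKc.exists_isMaxOn ⟨x₁, hx₁⟩
      (hwK.div huK fun x hx => (hu.pos x (hKd hx)).ne')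
    have hu0 := hu.pos x₀ (hKd hx₀)
    have hle : ∀ x ∈ K, w x ≤ w x₀ / u x₀ * u x := fun x hx => by
      have := hmax hx
      simp only [mem_ofPred_eq, Pi.div_apply] at this
      rwa [div_le_iff₀ (hu.pos x (hKd hx))] at this
    have hpos : 0 < w x₀ / u x₀ := by
      have h1 := hle x₁ hx₁
      have h2 := hu.pos x₁ (hKd hx₁)
      by_contra! hneg
      nlinarith
    have hw₀ : w x₀ = w x₀ / u x₀ * u x₀ := by field_simp
    exact ⟨_, hpos.le, hle, Or.inr ⟨x₀, hwpos x₀ hx₀.1 (hKP x₀ hx₀)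
      (by rw [hw₀]; positivity), hw₀⟩⟩
  refine ⟨t, ht0, ?_, htouch⟩
  set y : E → ℝ := fun x => w x - t * u x with hy
  have hyw : ∀ x, y x ≤ w x := fun x => by
    have := mul_nonneg ht0 (hu.nonneg x); simp only [hy]; linarith
  have hyG : Helmholtz l G y := hwG.sub ((hu.helm.mono hGd).const_mul t)
  have hyc : ContinuousOn y (Q \ {P}) :=
    hw.sub (continuousOn_const.mul (hu.cont.mono fun x hx => hx.2))
  have hyK : ∀ x ∈ K, y x ≤ 0 := fun x hx => by have := htK x hx; simp only [hy]; linarith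
  have houter : ∀ x ∈ Q, R ≤ ‖x‖ → ‖x‖ ≤ 1 → y x ≤ 0 := by
    set β := Λ' / 2 with hβ
    set g : ℝ → ℝ := fun q => 1 - β * (1 - q) ^ 2 with hg
    set b : E → ℝ := fun x => g (‖x - 0‖ ^ 2) with hb
    have hgC : ContDiff ℝ 2 g := by fun_prop
    have hbC : ContDiff ℝ 2 b := hgC.comp (contDiff_norm_sub_sq 0)
    set S := {x ∈ Q | R ≤ ‖x - 0‖ ∧ ‖x - 0‖ ≤ 1} with hS
    have hSP : S ⊆ Q \ {P} := fun x hx => ⟨hx.1, fun h => by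
      have := hx.2.1; rw [mem_singleton_iff.1 h, sub_zero] at this; linarith⟩
    have hz : ∀ x ∈ S, 0 ≤ 1 - ‖x - 0‖ ^ 2 ∧ 1 - ‖x - 0‖ ^ 2 ≤ z₀ := fun x hx => by
      have h1 : R ^ 2 ≤ ‖x - 0‖ ^ 2 := by have := hx.2.1; gcongr
      have h2 : ‖x - 0‖ ^ 2 ≤ 1 ^ 2 := by have := hx.2.2; gcongr
      constructor <;> linarith
    have hb0 : ∀ x ∈ S, 0 < b x := fun x hx => by
      obtain ⟨h1, h2⟩ := hz x hx
      have : β * (1 - ‖x - 0‖ ^ 2) ^ 2 ≤ β * z₀ ^ 2 := by gcongr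
      have h3 : β * z₀ ^ 2 < 1 := by
        have : Λ' * z₀ ≤ 1 := by nlinarith
        have : z₀ ≤ 1 := by nlinarith
        rw [hβ]; nlinarith
      simp only [hb, hg]; linarith
    have main := le_barrier (S := S) (y := y) (b := b) (m := 0) (l := l)
      ((isCompact_shell 0 R 1).inter_left hQ) le_rfl (hyc.mono hSP) hbC.continuous.continuousOn hb0
      fun x hx hyx => by
        rw [zero_mul] at hyx
        have hxG := hwpos x hx.1 (hSP hx).2 (hyx.trans_le (hyw x))
        have hx1 := (mem_dom.1 (hGd hxG)).1
        have hxR : R < ‖x‖ := by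
          have h1 := hx.2.1
          rw [sub_zero] at h1
          refine lt_of_le_of_ne h1 fun h => ?_
          exact absurd (hyK x ⟨hx.1, h.ge, by linarith [htri x]⟩) (not_le.2 hyx)
        refine ⟨?_, (hyG x hxG).1, hbC.contDiffAt, (hyG x hxG).2.ge, ?_⟩
        · exact inter_mem (mem_of_superset (hG.mem_nhds hxG) hGQ)
            (mem_nhds_of_norm_sub_mem_Ioo (by simpa using hxR) (by simpa using hx1))
        · have hΔ := laplacian_radial (f := g) (f' := fun q => 2 * β * (1 - q)) (f'' := -2 * β)
            0 x hgC.contDiffAt (Eventually.of_forall fun s =>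
              ((((((hasDerivAt_id' s).const_sub 1).pow 2).const_mul β).const_sub
                1)).congr_deriv (by simp; ring))
            ((((hasDerivAt_id' _).const_sub 1).const_mul (2 * β)).congr_deriv (by ring))
          rw [hb, hΔ]
          obtain ⟨h1, h2⟩ := hz x hx
          have hbx : b x ≤ 1 := by
            have : 0 ≤ β * (1 - ‖x - 0‖ ^ 2) ^ 2 := by positivity
            simp only [hb, hg]; linarith
          have hlb : l * b x ≤ Λ' := by
            have := hlΛ.trans (le_max_left Λ 1)
            calc l * b x ≤ Λ' * 1 := by gcongr; exact (hb0 x hx).le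
              _ = Λ' := mul_one _
          have h4 : (8 + 4 * n) * (1 - ‖x - 0‖ ^ 2) ≤ 4 := by nlinarith
          have h5 : β * ((8 + 4 * n) * (1 - ‖x - 0‖ ^ 2)) ≤ β * 4 := by gcongr
          have h6 : l * g (‖x - 0‖ ^ 2) ≤ Λ' := hlb
          rw [← hnn]
          linarith
    intro x hx h1 h2
    simpa using main x ⟨hx, by simpa using h1, by simpa using h2⟩
  have hinner : ∀ x ∈ Q, x ≠ P → ‖x - P‖ ≤ ρ → y x ≤ 0 := by
    intro x₁ hx₁ hx₁P hx₁ρ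
    have hd : 0 < ‖x₁ - P‖ := norm_pos_iff.2 (sub_ne_zero.2 hx₁P)
    set b : E → ℝ := fun x => f (‖x - P‖ ^ 2) with hb
    suffices ∀ m > 0, y x₁ ≤ m * b x₁ by
      have hc : Tendsto (fun m => m * b x₁) (𝓝[>] 0) (𝓝 0) := by
        have : Continuous fun m => m * b x₁ := by fun_prop
        simpa using (this.tendsto 0).mono_left (nhdsWithin_le_nhds (s := Ioi (0 : ℝ)))
      exact ge_of_tendsto hc (eventually_nhdsWithin_of_forall this)
    intro m hm
    obtain ⟨r, hr0, hrd, hrM⟩ : ∃ r > 0, r < ‖x₁ - P‖ ∧ M ≤ m * f (r ^ 2) := by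
      have h1 : Tendsto (fun r : ℝ => r ^ 2) (𝓝[>] 0) (𝓝[>] 0) := by
        refine tendsto_nhdsWithin_iff.2 ⟨?_, eventually_nhdsWithin_of_forall fun r hr => ?_⟩
        · have : Continuous fun r : ℝ => r ^ 2 := by fun_prop
          simpa using (this.tendsto 0).mono_left (nhdsWithin_le_nhds (s := Ioi (0 : ℝ)))
        · exact pow_pos (mem_Ioi.1 hr) 2
      have h2 := ((hft.comp h1).const_mul_atTop hm).eventually (eventually_ge_atTop M)
      obtain ⟨r, h3, h4, h5⟩ := ((h2.and (Ioo_mem_nhdsGT hd)).exists)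
      exact ⟨r, h4, h5, h3⟩
    set S := {x ∈ Q | r ≤ ‖x - P‖ ∧ ‖x - P‖ ≤ ρ} with hS
    have hSP : S ⊆ Q \ {P} := fun x hx => ⟨hx.1, fun h => by
      have := hx.2.1; rw [mem_singleton_iff.1 h, sub_self, norm_zero] at this; linarith⟩
    have hq : ∀ x ∈ S, 0 < ‖x - P‖ ^ 2 ∧ ‖x - P‖ ^ 2 ≤ q₀ := fun x hx => by
      have h1 : 0 < ‖x - P‖ := hr0.trans_le hx.2.1
      exact ⟨by positivity, le_trans (by have := hx.2.2; gcongr) hρq⟩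
    have hbC : ∀ x ∈ S, ContDiffAt ℝ 2 b x := fun x hx =>
      (hf _ (hq x hx).1).1.comp x (contDiff_norm_sub_sq P).contDiffAt
    have hb0 : ∀ x ∈ S, 0 < b x := fun x hx => (hfq _ (hq x hx).1 (hq x hx).2).1
    refine le_barrier (S := S) (l := l) ((isCompact_shell P r ρ).inter_left hQ) hm.le
      (hyc.mono hSP) (fun x hx => (hbC x hx).continuousAt.continuousWithinAt) hb0
      (fun x hx hyx => ?_) x₁ ⟨hx₁, hrd.le, hx₁ρ⟩
    have hbx := hb0 x hx
    have hyx0 : 0 < y x := (by positivity : 0 < m * b x).trans hyx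
    have hxG := hwpos x hx.1 (hSP hx).2 (hyx0.trans_le (hyw x))
    have hr' : r < ‖x - P‖ := by
      refine lt_of_le_of_ne hx.2.1 fun h => ?_
      have : y x ≤ m * b x := by
        simp only [hb, ← h]
        exact ((hyw x).trans (hM x hx.1)).trans hrM
      linarith
    have hρ' : ‖x - P‖ < ρ := by
      refine lt_of_le_of_ne hx.2.2 fun h => ?_
      exact absurd (hyK x ⟨hx.1, by linarith [htri x], h.ge⟩) (not_le.2 hyx0)
    refine ⟨inter_mem (mem_of_superset (hG.mem_nhds hxG) hGQ)
      (mem_nhds_of_norm_sub_mem_Ioo hr' hρ'), (hyG x hxG).1, hbC x hx, (hyG x hxG).2.ge, ?_⟩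
    have hq' := (hq x hx).1
    rw [hb, laplacian_radial P x (hf _ hq').1 ((lt_mem_nhds hq').mono fun s hs => (hf s hs).2.1)
      (hf _ hq').2.2]
    have h1 := (hfq _ hq' (hq x hx).2).2
    have h2 : l * b x ≤ Λ * b x := by gcongr
    have h3 : l * f (‖x - P‖ ^ 2) ≤ Λ * f (‖x - P‖ ^ 2) := h2
    rw [← hnn]; linarith
  intro x hx hxP
  rcases lt_or_ge 1 ‖x‖ with h1 | h1
  · have hxG : x ∉ G := fun h => by linarith [(mem_dom.1 (hGd h)).1]
    exact (hw0 x hx hxP hxG).trans (mul_nonneg ht0 (hu.nonneg x))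
  have : y x ≤ 0 := by
    rcases le_total R ‖x‖ with h2 | h2
    · exact houter x hx h2 h1
    rcases le_total ρ ‖x - P‖ with h3 | h3
    · exact hyK x ⟨hx, h2, h3⟩
    · exact hinner x hx hxP h3
  simp only [hy] at this
  linarith

end PerforatedBall

section Connected

variable {E : Type*} [NormedAddCommGroup E] [NormedSpace ℝ E]

theorem isPreconnected_annulus (h : 1 < Module.rank ℝ E) (p : E) {a b : ℝ} (ha : 0 ≤ a) :
    IsPreconnected {x | a < ‖x - p‖ ∧ ‖x - p‖ < b} := by
  have h1 : IsPreconnected (Ioo a b ×ˢ sphere (0 : E) 1) :=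
    isPreconnected_Ioo.prod (isPreconnected_sphere h 0 1)
  have h2 := h1.image (fun q : ℝ × E => p + q.1 • q.2) (by fun_prop)
  convert h2 using 1
  ext x
  constructor
  · rintro ⟨h3, h4⟩
    have h5 : 0 < ‖x - p‖ := ha.trans_lt h3
    refine ⟨(‖x - p‖, ‖x - p‖⁻¹ • (x - p)), ⟨⟨h3, h4⟩, ?_⟩, ?_⟩
    · simp [norm_smul, h5.ne']
    · simp [smul_smul, h5.ne']
  · rintro ⟨⟨s, v⟩, ⟨h3, h4⟩, rfl⟩
    have h5 : ‖v‖ = 1 := by simpa using h4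
    have h6 : ‖s‖ = s := Real.norm_of_nonneg (ha.trans h3.1.le)
    simpa [norm_smul, h5, h6] using h3

theorem IsPreconnected.diff_singleton (h : 1 < Module.rank ℝ E) {C : Set E} (hC : IsPreconnected C)
    (hCo : IsOpen C) (p : E) : IsPreconnected (C \ {p}) := by
  by_cases hp : p ∈ C
  swap
  · rwa [sdiff_singleton_eq_self hp]
  obtain ⟨r, hr, hrC⟩ := Metric.isOpen_iff.1 hCo p hp
  have hB : ∀ x, x ∈ {x | 0 < ‖x - p‖ ∧ ‖x - p‖ < r} ↔ x ∈ ball p r ∧ x ≠ p := fun x => by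
    simp [dist_eq_norm, sub_eq_zero, and_comm]
  have key : ∀ u v : Set E, IsOpen u → IsOpen v → C \ {p} ⊆ u ∪ v → (C \ {p} ∩ v).Nonempty →
      {x | 0 < ‖x - p‖ ∧ ‖x - p‖ < r} ⊆ u → (C \ {p} ∩ (u ∩ v)).Nonempty := by
    intro u v hu hv huv ⟨b, hbC, hbv⟩ hBu
    obtain ⟨x, hx, hxu, hxv, hxp⟩ := hC (u ∪ ball p r) (v \ {p}) (hu.union isOpen_ball)
      (hv.sdiff isClosed_singleton) (fun x hx => by
        by_cases hxp : x = p
        · exact Or.inl (Or.inr (by rw [hxp]; exact mem_ball_self hr))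
        · rcases huv ⟨hx, hxp⟩ with h1 | h1
          · exact Or.inl (Or.inl h1)
          · exact Or.inr ⟨h1, hxp⟩)
      ⟨p, hp, Or.inr (mem_ball_self hr)⟩ ⟨b, hbC.1, hbv, hbC.2⟩
    refine ⟨x, ⟨hx, hxp⟩, ?_, hxv⟩
    rcases hxu with h1 | h1
    · exact h1
    · exact hBu ((hB x).2 ⟨h1, hxp⟩)
  intro u v hu hv huv hnu hnv
  by_contra hemp
  have hsub : {x | 0 < ‖x - p‖ ∧ ‖x - p‖ < r} ⊆ C \ {p} := fun x hx =>
    ⟨hrC ((hB x).1 hx).1, ((hB x).1 hx).2⟩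
  have hpre := isPreconnected_annulus h p (b := r) le_rfl
  by_cases hne : ({x | 0 < ‖x - p‖ ∧ ‖x - p‖ < r} ∩ u).Nonempty
  · refine hemp (key u v hu hv huv hnv fun x hx => ?_)
    by_contra hxu
    obtain ⟨y, hy, hy'⟩ := hpre u v hu hv (hsub.trans huv) hne
      ⟨x, hx, (huv (hsub hx)).resolve_left hxu⟩
    exact hemp ⟨y, hsub hy, hy'⟩
  · have := key v u hv hu (by rwa [union_comm]) hnu fun x hx =>
      (huv (hsub hx)).resolve_left fun hxu => hne ⟨x, hx, hxu⟩
    exact hemp (by rwa [inter_comm u v])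

end Connected

section Bounds

theorem exists_unit {E : Type*} [NormedAddCommGroup E] [NormedSpace ℝ E] [Nontrivial E] (P : E) :
    ∃ e : E, ‖e‖ = 1 ∧ P = ‖P‖ • e := by
  by_cases hP : P = 0
  · obtain ⟨e, he⟩ := exists_norm_eq E zero_le_one
    exact ⟨e, he, by simp [hP]⟩
  · have := norm_ne_zero_iff.2 hP
    exact ⟨‖P‖⁻¹ • P, by simp [norm_smul, this], by simp [smul_smul, this]⟩

open Laplacian

variable {E : Type*} [NormedAddCommGroup E] [InnerProductSpace ℝ E] [FiniteDimensional ℝ E]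
variable {P : E} {ε l : ℝ} {u : E → ℝ}

theorem PosSol.eigen_le_of_closedBall_subset (h : PosSol P ε l u) {z : E} {R : ℝ} (hR : 0 < R)
    (hz : closedBall z R ⊆ dom P ε) :
    32 * R ^ 2 * l ≤ (4 * Module.finrank ℝ E + 8) ^ 2 := by
  set n : ℝ := (Module.finrank ℝ E : ℝ) with hn
  set f : ℝ → ℝ := fun q => (R ^ 2 - q) ^ 2 with hf
  set b : E → ℝ := fun x => f (‖x - z‖ ^ 2) with hb
  have hfC : ContDiff ℝ 2 f := by fun_prop
  have hbC : ContDiff ℝ 2 b := hfC.comp (contDiff_norm_sub_sq z)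
  obtain ⟨x₀, hx₀, hmax⟩ := (isCompact_closedBall z R).exists_isMaxOn
    ⟨z, mem_closedBall_self hR.le⟩
    (hbC.continuous.continuousOn.div (h.helm.mono hz).continuousOn fun x hx => (h.pos x (hz hx)).ne')
  have hu0 := h.pos x₀ (hz hx₀)
  have hle : ∀ x ∈ closedBall z R, b x ≤ b x₀ / u x₀ * u x := fun x hx => by
    have := hmax hx
    simp only [mem_ofPred_eq, Pi.div_apply] at this
    rwa [div_le_iff₀ (h.pos x (hz hx))] at this
  have hbx₀ : 0 < b x₀ := by
    have h1 := hle z (mem_closedBall_self hR.le)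
    have h2 : 0 < b z := by simp [hb, hf]; positivity
    have h3 := h.pos z (hz (mem_closedBall_self hR.le))
    have h4 : 0 < b x₀ / u x₀ := by
      by_contra! hneg
      nlinarith
    exact (div_pos_iff_of_pos_right hu0).1 h4
  have hx₀R : ‖x₀ - z‖ < R := by
    rw [mem_closedBall, dist_eq_norm] at hx₀
    refine lt_of_le_of_ne hx₀ fun h1 => hbx₀.ne' ?_
    simp [hb, hf, h1]
  have hmem : closedBall z R ∈ 𝓝 x₀ := closedBall_mem_nhds_of_mem (by simpa [dist_eq_norm])
  set m := b x₀ / u x₀ with hm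
  have hmu : m * u x₀ = b x₀ := by rw [hm]; field_simp
  have huC := (h.helm x₀ (hz hx₀)).1
  have hmin : IsLocalMax (fun x => b x - m * u x) x₀ := by
    filter_upwards [hmem] with x hx
    have := hle x hx
    linarith
  have hL := hmin.laplacian_nonpos (hbC.contDiffAt.sub (contDiffAt_const.mul huC))
  rw [laplacian_sub_apply hbC.contDiffAt (contDiffAt_const.mul huC), laplacian_const_mul _ huC,
    (h.helm x₀ (hz hx₀)).2, hb, laplacian_radial (f := f) (f' := fun q => -2 * (R ^ 2 - q))
      (f'' := 2) z x₀ hfC.contDiffAt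
      (Eventually.of_forall fun s =>
        (((hasDerivAt_id' s).const_sub (R ^ 2)).pow 2).congr_deriv (by simp))
      ((((hasDerivAt_id' _).const_sub (R ^ 2)).const_mul (-2)).congr_deriv (by ring)), ← hn] at hL
  set s := R ^ 2 - ‖x₀ - z‖ ^ 2 with hs
  have hbs : b x₀ = s ^ 2 := rfl
  have h1 : l * s ^ 2 - (4 * n + 8) * s + 8 * R ^ 2 ≤ 0 := by
    have : m * -(l * u x₀) = -(l * s ^ 2) := by rw [← hbs, ← hmu]; ring
    rw [this, show ‖x₀ - z‖ ^ 2 = R ^ 2 - s by rw [hs]; ring] at hL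
    linarith
  have hl := h.eigen_pos
  nlinarith [sq_nonneg (2 * l * s - (4 * n + 8)), mul_le_mul_of_nonneg_left h1 hl.le]

theorem PosSol.eigen_le [Nontrivial E] (h : PosSol P ε l u) (hε : ε < 1 / 4) :
    l ≤ 8 * (Module.finrank ℝ E + 2) ^ 2 := by
  obtain ⟨e, he, hPe⟩ := exists_unit P
  have h1 := h.eigen_le_of_closedBall_subset (z := -(1 / 2 : ℝ) • e) (R := 1 / 4) (by norm_num) ?_
  · nlinarith
  intro x hx
  rw [mem_closedBall, dist_eq_norm] at hx
  have hz : ‖-(1 / 2 : ℝ) • e‖ = 1 / 2 := by rw [norm_smul, he]; norm_num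
  have hzP : ‖-(1 / 2 : ℝ) • e - P‖ = 1 / 2 + ‖P‖ := by
    rw [hPe, ← sub_smul, norm_smul, he, norm_smul, he, Real.norm_of_nonpos]
    · simp [add_comm]
    · linarith [norm_nonneg P]
  rw [mem_dom]
  constructor
  · have := norm_add_le (x - -(1 / 2 : ℝ) • e) (-(1 / 2 : ℝ) • e)
    rw [sub_add_cancel] at this
    linarith
  · have := norm_sub_le_norm_sub_add_norm_sub (-(1 / 2 : ℝ) • e) x P
    rw [norm_sub_rev (-(1 / 2 : ℝ) • e) x] at this
    linarith [norm_nonneg P]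

theorem PosSol.le_parabola (h : PosSol P ε l u) (hε : 0 < ε) {C : ℝ}
    (hC : l < 2 * Module.finrank ℝ E * C) {x : E} (hx : ‖x‖ ≤ 1) : u x ≤ C * (1 - ‖x‖ ^ 2) := by
  have hl := h.eigen_pos
  have hC0 : 0 < C := by
    by_contra! hC'
    have : 2 * (Module.finrank ℝ E : ℝ) * C ≤ 0 :=
      mul_nonpos_of_nonneg_of_nonpos (by positivity) hC'
    linarith
  set g : E → ℝ := fun y => C * ‖y - 0‖ ^ 2 with hg
  have hgC : ContDiff ℝ 2 g := contDiff_const.mul (contDiff_norm_sub_sq 0)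
  have main := weak_max (S := closedBall (0 : E) 1) (F := fun y => u y - (C - g y))
    (isCompact_closedBall 0 1)
    ((h.continuous hε).sub (continuous_const.sub hgC.continuous)).continuousOn fun y hy hpos => by
      have hgy : g y ≤ C := by
        have : ‖y‖ ≤ 1 := by simpa using hy
        have : ‖y - 0‖ ^ 2 ≤ 1 := by rw [sub_zero]; exact pow_le_one₀ (norm_nonneg _) this
        simp only [hg]; nlinarith
      have hyd := h.mem_of_pos (x := y) (by linarith)
      have huC := h.helm y hyd
      have hcg : ContDiffAt ℝ 2 (fun y => C - g y) y := contDiffAt_const.sub hgC.contDiffAt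
      have hΔg : Δ (fun y => C - g y) y = -(2 * Module.finrank ℝ E * C) := by
        rw [laplacian_sub_apply contDiffAt_const hgC.contDiffAt, hg,
          laplacian_const_mul _ (contDiff_norm_sub_sq 0).contDiffAt, laplacian_norm_sub_sq]
        simp
        ring
      refine ⟨closedBall_mem_nhds_of_mem (by simpa using (mem_dom.1 hyd).1), huC.1.sub hcg, ?_⟩
      rw [laplacian_sub_apply huC.1 hcg, huC.2, hΔg]
      have : l * u y ≤ l * 1 := by gcongr; exact h.le_one y
      linarith
  have := main x (by simpa using hx)
  simp only [hg, sub_zero] at this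
  linarith

theorem PosSol.one_le_eigen (h : PosSol P ε l u) (hε : 0 < ε) (hn : 2 ≤ Module.finrank ℝ E)
    {x : E} (hx : u x = 1) : 1 ≤ l := by
  by_contra! hl
  have hn' : (2 : ℝ) ≤ Module.finrank ℝ E := by exact_mod_cast hn
  have h1 := (mem_dom.1 (h.mem_of_pos (x := x) (by linarith))).1
  have h2 := h.le_parabola hε (C := 1 / 2) (by linarith) h1.le
  nlinarith [sq_nonneg ‖x‖]

end Bounds

section Reflection

open Laplacian

open scoped RealInnerProductSpace

variable {E : Type*} [NormedAddCommGroup E] [InnerProductSpace ℝ E]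

theorem norm_mirror_le {ν : E} (hν : ‖ν‖ = 1) {c : ℝ} (hc : 0 ≤ c) {x : E} (hx : c ≤ ⟪x, ν⟫) :
    ‖mirror ν c x‖ ≤ ‖x‖ := by
  refine (sq_le_sq₀ (norm_nonneg _) (norm_nonneg _)).1 ?_
  rw [norm_mirror_sq hν]
  nlinarith

theorem norm_mirror_zero {ν : E} (hν : ‖ν‖ = 1) (x : E) : ‖mirror ν 0 x‖ = ‖x‖ := by
  refine (sq_eq_sq₀ (norm_nonneg _) (norm_nonneg _)).1 ?_
  rw [norm_mirror_sq hν]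
  simp

theorem norm_mirror_sub_lt {ν : E} (hν : ‖ν‖ = 1) {c : ℝ} {x P : E} (hx : c < ⟪x, ν⟫)
    (hP : c < ⟪P, ν⟫) : ‖x - P‖ < ‖mirror ν c x - P‖ := by
  refine (sq_lt_sq₀ (norm_nonneg _) (norm_nonneg _)).1 ?_
  rw [norm_mirror_sub_sq hν]
  nlinarith

theorem isOpen_inner_gt (ν : E) (c : ℝ) : IsOpen {x : E | c < ⟪x, ν⟫} :=
  isOpen_lt continuous_const (by fun_prop)

theorem convex_cap (ν : E) (c : ℝ) : Convex ℝ (ball (0 : E) 1 ∩ {x | c < ⟪x, ν⟫}) := by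
  refine (convex_ball 0 1).inter ?_
  have : {x : E | c < ⟪x, ν⟫} = {x | c < innerSL ℝ ν x} := by
    ext x; simp [real_inner_comm]
  rw [this]
  exact convex_halfSpace_gt (innerSL ℝ ν).isLinear c

variable [FiniteDimensional ℝ E] {P : E} {ε l c : ℝ} {u : E → ℝ} {ν : E}

/-- Comparison of a positive solution with its reflection in a hyperplane. -/
theorem PosSol.lt_mirror (h : PosSol P ε l u) (hs : Sweeps P ε l u) (hε : 0 < ε) (hν : ‖ν‖ = 1)
    (hc : 0 ≤ c) (hσ : ∀ x, ‖x‖ < 1 → c < ⟪x, ν⟫ → ε ≤ ‖x - P‖ → ε < ‖mirror ν c x - P‖)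
    {z : E} (hz : z ∈ closure (ball (0 : E) 1 ∩ {x | c < ⟪x, ν⟫})) (hz0 : u z = 0)
    (hz1 : 0 < u (mirror ν c z)) {x : E} (hx : x ∈ dom P ε) (hxc : c < ⟪x, ν⟫) :
    u x < u (mirror ν c x) := by
  have huc := h.continuous hε
  have hl := h.eigen_pos
  set G : Set E := dom P ε ∩ {x | c < ⟪x, ν⟫} with hG
  set w : E → ℝ := fun x => u x - u (mirror ν c x) with hw
  have hwc : Continuous w := huc.sub (huc.comp (contDiff_mirror ν c).continuous)
  have hGo : IsOpen G := (isOpen_dom P ε).inter (isOpen_inner_gt ν c)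
  have hGσ : ∀ x ∈ G, mirror ν c x ∈ dom P ε := fun x hx => by
    have h1 := mem_dom.1 hx.1
    exact mem_dom.2 ⟨(norm_mirror_le hν hc hx.2.le).trans_lt h1.1, hσ x h1.1 hx.2 h1.2.le⟩
  have hwG : Helmholtz l G w := (h.helm.mono inter_subset_left).sub (h.helm.comp_mirror hν c hGσ)
  obtain ⟨t, ht, hle, htouch⟩ := hs {x | c ≤ ⟪x, ν⟫} G w 1
    (isClosed_le continuous_const (by fun_prop)) hGo (fun x hx => (show c < ⟪x, ν⟫ from hx.2).le) inter_subset_left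
    hwc.continuousOn (fun x _ => by
      have := h.le_one x; have := h.nonneg (mirror ν c x); simp only [hw]; linarith) hwG
    fun x hx _ hxG => by
      rcases (show c ≤ ⟪x, ν⟫ from hx).eq_or_lt with h1 | h1
      · simp only [hw, mirror_of_inner_eq h1.symm, sub_self, le_refl]
      · have : u x = 0 := h.zero x fun h2 => hxG ⟨h2, h1⟩
        have := h.nonneg (mirror ν c x); simp only [hw]; linarith
  set y : E → ℝ := fun x => w x - t * u x with hy
  have hyc : Continuous y := hwc.sub (continuous_const.mul huc)
  have hyG : Helmholtz l G y := hwG.sub ((h.helm.mono inter_subset_left).const_mul t)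
  have hPd : ∀ x, ‖x - P‖ ≤ ε → u x = 0 := fun x hx =>
    h.zero x fun hd => not_lt.2 hx (mem_dom.1 hd).2
  have hy0 : ∀ x ∈ G, y x ≤ 0 := fun x hx => by
    have hxP : x ≠ P := fun h1 => by
      have := (mem_dom.1 hx.1).2; rw [h1, sub_self, norm_zero] at this; linarith
    have := hle x (show c < ⟪x, ν⟫ from hx.2).le hxP
    simp only [hy]; linarith
  have hyL : ∀ x ∈ G, 0 ≤ Δ y x := fun x hx => by
    rw [(hyG x hx).2]
    have := mul_nonpos_of_nonneg_of_nonpos hl.le (hy0 x hx)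
    linarith
  have hZ := isOpen_zeros hGo (fun x hx => (hyG x hx).1) hyL hy0
  have hneg : ∀ x ∈ G, y x < 0 := by
    intro x hx
    by_contra! hx0
    have hpre := (convex_cap ν c).isPreconnected
    obtain ⟨x', hx'1, hx'2⟩ := mem_closure_iff.1 hz {x | y x < 0}
      (isOpen_lt hyc continuous_const) (by
        simp only [mem_ofPred_eq, hy, hw, hz0]; linarith)
    obtain ⟨x'', _, ⟨h1, h2⟩, h3⟩ := hpre {x ∈ G | y x = 0} ({x | y x < 0} ∪ ball P ε) hZ
      ((isOpen_lt hyc continuous_const).union isOpen_ball) (fun v hv => by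
        have hv1 : ‖v‖ < 1 := by simpa using hv.1
        rcases lt_trichotomy ‖v - P‖ ε with h1 | h1 | h1
        · exact Or.inr (Or.inr (by simpa [dist_eq_norm]))
        · refine Or.inr (Or.inl ?_)
          have h2 : 0 < u (mirror ν c v) := h.pos _ (mem_dom.2
            ⟨(norm_mirror_le hν hc (le_of_lt hv.2)).trans_lt hv1, hσ v hv1 hv.2 h1.ge⟩)
          simp only [mem_ofPred_eq, hy, hw, hPd v h1.le]
          linarith
        · have hvG : v ∈ G := ⟨mem_dom.2 ⟨hv1, h1⟩, hv.2⟩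
          rcases (hy0 v hvG).eq_or_lt with h2 | h2
          · exact Or.inl ⟨hvG, h2⟩
          · exact Or.inr (Or.inl h2))
      ⟨x, ⟨by simpa using (mem_dom.1 hx.1).1, hx.2⟩, hx, le_antisymm (hy0 x hx) hx0⟩
      ⟨x', hx'2, Or.inl hx'1⟩
    rcases h3 with h3 | h3
    · exact (ne_of_lt h3) h2
    · rw [mem_ball, dist_eq_norm] at h3
      exact absurd (mem_dom.1 h1.1).2 (not_lt.2 h3.le)
  have ht0 : t = 0 := by
    rcases htouch with h1 | ⟨v, hv, h1⟩
    · exact h1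
    · have := hneg v hv
      simp only [hy] at this
      linarith
  have := hneg x ⟨hx, hxc⟩
  simp only [hy, hw, ht0] at this
  linarith

theorem PosSol.fderiv_neg_of_lt_mirror (h : PosSol P ε l u) (hν : ‖ν‖ = 1)
    (hlt : ∀ x ∈ dom P ε, c < ⟪x, ν⟫ → mirror ν c x ∈ dom P ε ∧ u x < u (mirror ν c x))
    {x : E} (hx : x ∈ dom P ε) (hxc : ⟪x, ν⟫ = c) : fderiv ℝ u x ν < 0 := by
  set G : Set E := dom P ε ∩ {x | c < ⟪x, ν⟫} with hG
  set y : E → ℝ := fun x => u x - u (mirror ν c x) with hy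
  have hσx := mirror_of_inner_eq hxc
  have hux : ContDiffAt ℝ 2 u (mirror ν c x) := by rw [hσx]; exact (h.helm x hx).1
  have hyG : Helmholtz l G y := (h.helm.mono inter_subset_left).sub
    (h.helm.comp_mirror hν c fun x hx => (hlt x hx.1 hx.2).1)
  have hdu : DifferentiableAt ℝ (fun x => u (mirror ν c x)) x :=
    hux.comp_mirror.differentiableAt (by simp)
  have hd : fderiv ℝ y x ν = 2 * fderiv ℝ u x ν := by
    have h1 : fderiv ℝ y x = fderiv ℝ u x - fderiv ℝ (fun x => u (mirror ν c x)) x :=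
      fderiv_sub (h.helm.differentiableAt hx) hdu
    have h2 : ν - (2 * ⟪ν, ν⟫) • ν = -ν := by
      rw [real_inner_self_eq_norm_sq, hν]; module
    rw [h1, sub_apply, fderiv_comp_mirror hux, hσx, h2, map_neg]
    ring
  obtain ⟨r, hr, hrd⟩ := Metric.isOpen_iff.1 (isOpen_dom P ε) x hx
  set s := r / 4 with hs
  have hs0 : 0 < s := by positivity
  have hzx : ‖x - (x + s • ν)‖ = s := by
    rw [sub_add_cancel_left, norm_neg, norm_smul, hν, Real.norm_of_nonneg hs0.le, mul_one]
  have hcb : closedBall (x + s • ν) s ⊆ dom P ε := fun v hv => hrd <| by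
    rw [mem_closedBall] at hv
    have h1 : dist (x + s • ν) x = s := by rw [dist_comm, dist_eq_norm, hzx]
    have := dist_triangle v (x + s • ν) x
    rw [mem_ball]; linarith
  have hin : ∀ v, |⟪v, ν⟫ - (c + s)| ≤ ‖v - (x + s • ν)‖ := fun v => by
    have h1 : ⟪v - (x + s • ν), ν⟫ = ⟪v, ν⟫ - (c + s) := by
      rw [inner_sub_left, inner_add_left, real_inner_smul_left, real_inner_self_eq_norm_sq, hν, hxc]
      ring
    rw [← h1]
    simpa [hν] using abs_real_inner_le_norm (v - (x + s • ν)) ν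
  have hbG : ball (x + s • ν) s ⊆ G := fun v hv => by
    refine ⟨hcb (ball_subset_closedBall hv), ?_⟩
    rw [mem_ball, dist_eq_norm] at hv
    have := (abs_le.1 ((hin v).trans hv.le)).1
    have := (abs_lt.1 ((hin v).trans_lt hv)).1
    show c < ⟪v, ν⟫
    linarith
  have hyneg : ∀ v ∈ G, y v < 0 := fun v hv => by
    have := (hlt v hv.1 hv.2).2; simp only [hy]; linarith
  have hcase : ∀ v ∈ closedBall (x + s • ν) s, v ∈ G ∨ ⟪v, ν⟫ = c := fun v hv => by
    have hv' := hv
    rw [mem_closedBall, dist_eq_norm] at hv'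
    have := (abs_le.1 ((hin v).trans hv')).1
    rcases (show c ≤ ⟪v, ν⟫ by linarith).eq_or_lt with h1 | h1
    · exact Or.inr h1.symm
    · exact Or.inl ⟨hcb hv, h1⟩
  have hhopf := hopf (y := y) (z := x + s • ν) (b := x) hs0 hzx (fun v hv => (hyG v (hbG hv)).1)
    (fun v hv => by
      rw [(hyG v (hbG hv)).2]
      have := mul_neg_of_pos_of_neg h.eigen_pos (hyneg v (hbG hv))
      linarith)
    (fun v hv => hyneg v (hbG hv))
    (fun v hv => by
      rcases hcase v hv with h1 | h1
      · exact (hyneg v h1).le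
      · simp only [hy, mirror_of_inner_eq h1, sub_self, le_refl])
    (fun v hv => by
      rcases hcase v hv with h1 | h1
      · exact (hyG v h1).1.continuousAt.continuousWithinAt
      · have h2 := h.helm v (hcb hv)
        have h3 : ContDiffAt ℝ 2 u (mirror ν c v) := by rw [mirror_of_inner_eq h1]; exact h2.1
        exact (h2.1.sub h3.comp_mirror).continuousAt.continuousWithinAt)
    (by simp only [hy, hσx, sub_self]) ((h.helm.differentiableAt hx).sub hdu)
  rw [add_sub_cancel_left, map_smul, hd, smul_eq_mul] at hhopf
  nlinarith

end Reflection

section Symmetry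

open Laplacian

open scoped RealInnerProductSpace

variable {E : Type*} [NormedAddCommGroup E] [InnerProductSpace ℝ E]

theorem exists_mirror_eq {x y : E} (hxy : ‖x‖ = ‖y‖) (hne : x ≠ y) :
    ∃ ν : E, ‖ν‖ = 1 ∧ mirror ν 0 x = y := by
  have h0 : ‖x - y‖ ≠ 0 := norm_ne_zero_iff.2 (sub_ne_zero.2 hne)
  refine ⟨‖x - y‖⁻¹ • (x - y), by simp [norm_smul, h0], ?_⟩
  have h1 : ‖x - y‖ ^ 2 = 2 * ⟪x, x - y⟫ := by
    rw [norm_sub_sq_real, inner_sub_right, real_inner_self_eq_norm_sq, hxy]; ring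
  have h2 : 2 * (⟪x, ‖x - y‖⁻¹ • (x - y)⟫ - 0) * ‖x - y‖⁻¹ = 1 := by
    rw [real_inner_smul_right, sub_zero]
    field_simp
    linarith
  rw [mirror, smul_smul, h2, one_smul, sub_sub_cancel]

theorem fderiv_mirror_eq_zero {u : E → ℝ} {ν x : E} (hν : ‖ν‖ = 1) {c : ℝ}
    (hu : ContDiffAt ℝ 2 u (mirror ν c x)) (h : fderiv ℝ (fun x => u (mirror ν c x)) x = 0) :
    fderiv ℝ u (mirror ν c x) = 0 := by
  ext v
  have h1 := fderiv_comp_mirror hu (v - (2 * ⟪v, ν⟫) • ν)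
  have h2 : ⟪v - (2 * ⟪v, ν⟫) • ν, ν⟫ = -⟪v, ν⟫ := by
    rw [inner_sub_left, real_inner_smul_left, real_inner_self_eq_norm_sq, hν]; ring
  rw [h, h2] at h1
  simpa using h1.symm

variable [FiniteDimensional ℝ E] {P : E} {ε l : ℝ} {u : E → ℝ} {ν : E}

/-- Around a concentric hole, a positive solution is proportional to its reflections. -/
theorem PosSol.exists_mirror_eq_mul (h : PosSol (0 : E) ε l u) (hs : Sweeps 0 ε l u) (hε : 0 < ε)
    (hn : 1 < Module.rank ℝ E) (hν : ‖ν‖ = 1) (hne : (dom (0 : E) ε).Nonempty) :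
    ∃ t : ℝ, ∀ x ∈ dom 0 ε, u (mirror ν 0 x) = t * u x := by
  have huc := h.continuous hε
  have hσ : ∀ x, x ∈ dom (0 : E) ε ↔ mirror ν 0 x ∈ dom 0 ε := fun x => by
    simp only [mem_dom, sub_zero, norm_mirror_zero hν]
  have hwH : Helmholtz l (dom (0 : E) ε) fun x => u (mirror ν 0 x) :=
    h.helm.comp_mirror hν 0 fun x hx => (hσ x).1 hx
  have hwc : Continuous fun x => u (mirror ν 0 x) := huc.comp (contDiff_mirror ν 0).continuous
  obtain ⟨t, ht, hle, htouch⟩ := hs univ (dom 0 ε) (fun x => u (mirror ν 0 x)) 1 isClosed_univ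
    (isOpen_dom 0 ε) (subset_univ _) subset_rfl hwc.continuousOn (fun x _ => h.le_one _) hwH
    fun x _ _ hx => (h.zero _ fun h1 => hx ((hσ x).2 h1)).le
  have hxP : ∀ x ∈ dom (0 : E) ε, x ≠ 0 := fun x hx h1 => by
    have := (mem_dom.1 hx).2; rw [h1, sub_self, norm_zero] at this; linarith
  obtain ⟨x₀, hx₀, hx₀t⟩ : ∃ x ∈ dom (0 : E) ε, u (mirror ν 0 x) = t * u x := by
    rcases htouch with h1 | h1
    · obtain ⟨x, hx⟩ := hne
      have h2 := hle x trivial (hxP x hx)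
      have h3 := h.pos _ ((hσ x).1 hx)
      rw [h1] at h2; linarith
    · exact h1
  refine ⟨t, fun x hx => ?_⟩
  set y : E → ℝ := fun x => u (mirror ν 0 x) - t * u x with hy
  have hyG : Helmholtz l (dom 0 ε) y := hwH.sub (h.helm.const_mul t)
  have hy0 : ∀ x ∈ dom (0 : E) ε, y x ≤ 0 := fun x hx => by
    have := hle x trivial (hxP x hx); simp only [hy]; linarith
  have hZ := isOpen_zeros (isOpen_dom 0 ε) (fun x hx => (hyG x hx).1) (fun x hx => by
    rw [(hyG x hx).2]
    have := mul_nonpos_of_nonneg_of_nonpos h.eigen_pos.le (hy0 x hx)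
    linarith) hy0
  have hyc : Continuous y := hwc.sub (continuous_const.mul huc)
  have hpre : IsPreconnected (dom (0 : E) ε) := by
    convert isPreconnected_annulus hn 0 (b := 1) hε.le using 1
    ext x
    simp only [mem_dom, sub_zero, mem_ofPred_eq, and_comm]
  suffices y x = 0 by simp only [hy] at this; linarith
  by_contra hyx
  obtain ⟨x', hx', h1, h2⟩ := hpre {x ∈ dom (0 : E) ε | y x = 0} {x | y x < 0} hZ
    (isOpen_lt hyc continuous_const) (fun v hv => (hy0 v hv).eq_or_lt.imp (⟨hv, ·⟩) id)
    ⟨x₀, hx₀, hx₀, by simp only [hy, hx₀t, sub_self]⟩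
    ⟨x, hx, lt_of_le_of_ne (hy0 x hx) hyx⟩
  exact (ne_of_lt h2) h1.2

theorem PosSol.infinite_critical (h : PosSol (0 : E) ε l u) (hs : Sweeps 0 ε l u) (hε : 0 < ε)
    (hn : 1 < Module.rank ℝ E) {x₀ : E} (hx₀ : u x₀ = 1) :
    {x ∈ dom (0 : E) ε | fderiv ℝ u x = 0}.Infinite := by
  have hx₀d : x₀ ∈ dom 0 ε := h.mem_of_pos (by linarith)
  have hcrit : fderiv ℝ u x₀ = 0 :=
    IsLocalMax.fderiv_eq_zero (Eventually.of_forall fun x => by rw [hx₀]; exact h.le_one x)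
  have hsub : sphere (0 : E) ‖x₀‖ ⊆ {x ∈ dom (0 : E) ε | fderiv ℝ u x = 0} := by
    intro y hy
    have hy' : ‖x₀‖ = ‖y‖ := by simpa using (mem_sphere.1 hy).symm
    by_cases hxy : x₀ = y
    · rw [← hxy]; exact ⟨hx₀d, hcrit⟩
    obtain ⟨ν, hν, hνy⟩ := exists_mirror_eq hy' hxy
    obtain ⟨t, ht⟩ := h.exists_mirror_eq_mul hs hε hn hν ⟨x₀, hx₀d⟩
    have hyd : y ∈ dom 0 ε := by
      rw [mem_dom, sub_zero] at *; rwa [← hy']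
    refine ⟨hyd, ?_⟩
    rw [← hνy]
    refine fderiv_mirror_eq_zero hν (by rw [hνy]; exact (h.helm y hyd).1) ?_
    have h1 : (fun x => u (mirror ν 0 x)) =ᶠ[𝓝 x₀] fun x => t * u x := by
      filter_upwards [(isOpen_dom 0 ε).mem_nhds hx₀d] with x hx using ht x hx
    rw [h1.fderiv_eq, fderiv_const_mul (h.helm.differentiableAt hx₀d), hcrit, smul_zero]
  refine Infinite.mono hsub ((isPreconnected_sphere hn 0 _).infinite_of_nontrivial ?_)
  have hx₀0 : x₀ ≠ 0 := fun h1 => by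
    have := (mem_dom.1 hx₀d).2; rw [h1, sub_self, norm_zero] at this; linarith
  refine ⟨x₀, by simp, -x₀, by simp, fun h1 => hx₀0 ?_⟩
  have h2 : (2 : ℝ) • x₀ = 0 := by rw [two_smul]; exact add_eq_zero_iff_eq_neg.2 h1
  exact (smul_eq_zero.1 h2).resolve_left two_ne_zero

/-- In the punctured ball, a positive solution is larger on the side of the puncture. -/
theorem PosSol.mirror_le (h : PosSol P 0 l u) (hs : Sweeps P 0 l u)
    (hn : 1 < Module.rank ℝ E) (hν : ‖ν‖ = 1) (hP : 0 < ⟪P, ν⟫) {x : E} (hx : x ∈ dom P 0)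
    (hxν : 0 < ⟪x, ν⟫) : u (mirror ν 0 x) ≤ u x := by
  set G : Set E := dom P 0 ∩ {x | 0 < ⟪x, ν⟫} with hG
  set w : E → ℝ := fun x => u (mirror ν 0 x) - u x with hw
  have hσ : ∀ x, 0 ≤ ⟪x, ν⟫ → mirror ν 0 x ≠ P := fun x hx h1 => by
    have := inner_mirror hν 0 x
    rw [h1] at this; linarith
  have hGo : IsOpen G := (isOpen_dom P 0).inter (isOpen_inner_gt ν 0)
  have hGσ : ∀ x ∈ G, mirror ν 0 x ∈ dom P 0 := fun x hx => by
    refine mem_dom.2 ⟨?_, norm_pos_iff.2 (sub_ne_zero.2 (hσ x (show 0 < ⟪x, ν⟫ from hx.2).le))⟩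
    rw [norm_mirror_zero hν]
    exact (mem_dom.1 hx.1).1
  have hwG : Helmholtz l G w := (h.helm.comp_mirror hν 0 hGσ).sub (h.helm.mono inter_subset_left)
  have hwc : ContinuousOn w ({x | 0 ≤ ⟪x, ν⟫} \ {P}) :=
    (h.cont.comp (contDiff_mirror ν 0).continuous.continuousOn fun x hx => hσ x hx.1).sub
      (h.cont.mono fun x hx => hx.2)
  obtain ⟨t, ht, hle, htouch⟩ := hs {x | 0 ≤ ⟪x, ν⟫} G w 1
    (isClosed_le continuous_const (by fun_prop)) hGo
    (fun x hx => (show 0 < ⟪x, ν⟫ from hx.2).le) inter_subset_left hwc (fun x _ => by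
      have := h.le_one (mirror ν 0 x); have := h.nonneg x; simp only [hw]; linarith) hwG
    fun x hx hxP hxG => by
      rcases (show 0 ≤ ⟪x, ν⟫ from hx).eq_or_lt with h1 | h1
      · simp only [hw, mirror_of_inner_eq h1.symm, sub_self, le_refl]
      · have h2 : 1 ≤ ‖x‖ := by
          by_contra! h2
          exact hxG ⟨mem_dom.2 ⟨h2, norm_pos_iff.2 (sub_ne_zero.2 hxP)⟩, h1⟩
        have h3 : u (mirror ν 0 x) = 0 := h.zero _ fun h3 => by
          have := (mem_dom.1 h3).1
          rw [norm_mirror_zero hν] at this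
          linarith
        have := h.nonneg x
        simp only [hw]; linarith
  set y : E → ℝ := fun x => w x - t * u x with hy
  have hGP : ∀ x ∈ G, x ≠ P := fun x hx =>
    sub_ne_zero.1 (norm_pos_iff.1 (mem_dom.1 hx.1).2)
  have hy0 : ∀ x ∈ G, y x ≤ 0 := fun x hx => by
    have := hle x (show 0 < ⟪x, ν⟫ from hx.2).le (hGP x hx)
    simp only [hy]; linarith
  have hyG : Helmholtz l G y := hwG.sub ((h.helm.mono inter_subset_left).const_mul t)
  rcases ht.eq_or_lt with ht0 | ht0
  · have := hy0 x ⟨hx, hxν⟩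
    simp only [hy, hw, ← ht0] at this
    linarith
  obtain ⟨x₀, hx₀, hx₀t⟩ := htouch.resolve_left ht0.ne'
  have hP0 : P ≠ 0 := fun h1 => by simp [h1] at hP
  have h0d : (0 : E) ∈ dom P 0 := mem_dom.2 ⟨by simp, by simpa using hP0⟩
  have hσ0 : mirror ν 0 (0 : E) = 0 := mirror_of_inner_eq (by simp)
  have hyc0 : ContinuousAt y 0 := by
    have h1 : ContinuousAt u 0 := (h.helm 0 h0d).1.continuousAt
    have h2 : ContinuousAt (fun x => u (mirror ν 0 x)) 0 := by
      refine ContinuousAt.comp (g := u) ?_ (contDiff_mirror ν 0).continuous.continuousAt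
      rwa [hσ0]
    exact (h2.sub h1).sub (continuousAt_const.mul h1)
  have hy00 : y 0 < 0 := by
    simp only [hy, hw, hσ0]
    have := mul_pos ht0 (h.pos 0 h0d)
    linarith
  have hline : Tendsto (fun s : ℝ => s • ν) (𝓝[>] 0) (𝓝 0) := by
    have : Continuous fun s : ℝ => s • ν := by fun_prop
    simpa using (this.tendsto 0).mono_left (nhdsWithin_le_nhds (s := Ioi (0 : ℝ)))
  obtain ⟨s, ⟨h1, h2⟩, h3⟩ := ((hline.eventually
    ((hyc0.eventually (gt_mem_nhds hy00)).and ((isOpen_dom P 0).mem_nhds h0d))).and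
      self_mem_nhdsWithin).exists
  have h4 : s • ν ∈ G := ⟨h2, by
    simp only [mem_ofPred_eq, real_inner_smul_left, real_inner_self_eq_norm_sq, hν]
    simpa using h3⟩
  have hpre : IsPreconnected G := by
    convert (convex_cap ν 0).isPreconnected.diff_singleton hn
      (isOpen_ball.inter (isOpen_inner_gt ν 0)) P using 1
    ext x
    simp only [hG, dom, closedBall_zero]
    simp only [mem_inter_iff, Set.mem_sdiff, and_right_comm]
  have hZ := isOpen_zeros hGo (fun x hx => (hyG x hx).1) (fun x hx => by
    rw [(hyG x hx).2]
    have := mul_nonpos_of_nonneg_of_nonpos h.eigen_pos.le (hy0 x hx)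
    linarith) hy0
  have hN : IsOpen {x ∈ G | y x < 0} := hyG.continuousOn.isOpen_inter_preimage hGo isOpen_Iio
  obtain ⟨x', hx', h5, h6⟩ := hpre {x ∈ G | y x = 0} {x ∈ G | y x < 0} hZ hN
    (fun v hv => (hy0 v hv).eq_or_lt.imp (⟨hv, ·⟩) (⟨hv, ·⟩))
    ⟨x₀, hx₀, hx₀, by simp only [hy, hx₀t, sub_self]⟩ ⟨s • ν, h4, h4, h1⟩
  exact absurd h5.2 h6.2.ne

end Symmetry

section CriticalPoints

open Laplacian

open scoped RealInnerProductSpace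

theorem exists_critical_convex {g : ℝ → ℝ} {a b : ℝ} (hab : a < b)
    (hg : ∀ s ∈ Icc a b, ContinuousAt g s) (ha : deriv g a = 0) (hb : deriv g b = 0) :
    ∃ m ∈ Icc a b, deriv g m = 0 ∧ 0 ≤ deriv (deriv g) m := by
  by_contra! hneg
  have hlm : ∀ s ∈ Icc a b, deriv g s = 0 → IsLocalMax g s := fun s hs h =>
    isLocalMax_of_deriv_deriv_neg (hneg s hs h) h (hg s hs)
  obtain ⟨m, hm, hmin⟩ := isCompact_Icc.exists_isMinOn (nonempty_Icc.2 hab.le)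
    fun s hs => (hg s hs).continuousWithinAt
  have hmid : ∀ m ∈ Ioo a b, ¬ IsMinOn g (Icc a b) m := fun m hm h => by
    have h1 := h.isLocalMin (Icc_mem_nhds hm.1 hm.2)
    have hm' := Ioo_subset_Icc_self hm
    exact absurd (h1.deriv_deriv_nonneg (hg m hm')) (not_le.2 (hneg m hm' h1.deriv_eq_zero))
  have hval : ∀ x ∈ Icc a b, g x ≤ g m → IsMinOn g (Icc a b) x := fun x _ h s hs =>
    h.trans (hmin hs)
  rcases hm.1.eq_or_lt with h1 | h1
  · have h2 := (hlm a ⟨le_rfl, hab.le⟩ ha).filter_mono (nhdsWithin_le_nhds (s := Ioi a))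
    obtain ⟨x, hx1, hx2⟩ := (Filter.Eventually.and h2 (Ioo_mem_nhdsGT hab)).exists
    exact hmid x hx2 (hval x (Ioo_subset_Icc_self hx2) (by rw [← h1]; exact hx1))
  rcases hm.2.eq_or_lt with h2 | h2
  · have h3 := (hlm b ⟨hab.le, le_rfl⟩ hb).filter_mono (nhdsWithin_le_nhds (s := Iio b))
    obtain ⟨x, hx1, hx2⟩ := (Filter.Eventually.and h3 (Ioo_mem_nhdsLT hab)).exists
    exact hmid x hx2 (hval x (Ioo_subset_Icc_self hx2) (by rw [h2]; exact hx1))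
  · exact hmid m ⟨h1, h2⟩ hmin

variable {E : Type*} [NormedAddCommGroup E] [InnerProductSpace ℝ E]

theorem deriv_ray {u : E → ℝ} {e : E} {s : ℝ} (hu : ContDiffAt ℝ 2 u (s • e)) :
    deriv (fun t : ℝ => u (t • e)) s = fderiv ℝ u (s • e) e ∧
      deriv (deriv fun t : ℝ => u (t • e)) s = D2 u (s • e) e := by
  have h1 : (fun t : ℝ => u (s • e + t • e)) = fun t => (fun t : ℝ => u (t • e)) (s + t) := by
    ext t; rw [← add_smul]
  have h2 : (deriv fun t : ℝ => u (s • e + t • e)) =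
      fun t => deriv (fun t : ℝ => u (t • e)) (s + t) := by
    ext t; rw [h1, deriv_comp_const_add (f := fun t : ℝ => u (t • e))]
  have h3 := (hasDerivAt_deriv_line hu e).deriv
  have h4 := (hasDerivAt_fderiv_line (hu.differentiableAt (by simp)) e).deriv
  rw [h2, deriv_comp_const_add, add_zero] at h3
  rw [h1, deriv_comp_const_add (f := fun t : ℝ => u (t • e)), add_zero] at h4
  exact ⟨h4, h3⟩

theorem hasDerivAt_circle (e f : E) (s t : ℝ) :
    HasDerivAt (fun t : ℝ => (s * Real.cos t) • e + (s * Real.sin t) • f)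
      ((-(s * Real.sin t)) • e + (s * Real.cos t) • f) t := by
  have h1 := ((Real.hasDerivAt_cos t).const_mul s).smul_const e
  have h2 := ((Real.hasDerivAt_sin t).const_mul s).smul_const f
  simpa using! h1.add h2

theorem hasDerivAt_circle' (e f : E) (s : ℝ) :
    HasDerivAt (fun t : ℝ => (-(s * Real.sin t)) • e + (s * Real.cos t) • f) ((-s) • e) 0 := by
  have h1 := ((Real.hasDerivAt_sin 0).const_mul s).neg.smul_const e
  have h2 := ((Real.hasDerivAt_cos 0).const_mul s).smul_const f
  simpa using! h1.add h2

theorem norm_circle {e f : E} (he : ‖e‖ = 1) (hf : ‖f‖ = 1) (hef : ⟪f, e⟫ = 0) (s t : ℝ) :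
    ‖(s * Real.cos t) • e + (s * Real.sin t) • f‖ = ‖s • e‖ := by
  refine (sq_eq_sq₀ (norm_nonneg _) (norm_nonneg _)).1 ?_
  rw [norm_add_sq_real, real_inner_smul_left, real_inner_smul_right, real_inner_comm, hef,
    norm_smul, norm_smul, norm_smul, he, hf]
  simp only [Real.norm_eq_abs, mul_one, sq_abs]
  have := Real.sin_sq_add_cos_sq t
  linear_combination s ^ 2 * this

theorem inner_circle {e f : E} (he : ‖e‖ = 1) (hef : ⟪f, e⟫ = 0) (s t : ℝ) :
    ⟪e, (s * Real.cos t) • e + (s * Real.sin t) • f⟫ = s * Real.cos t := by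
  rw [inner_add_right, real_inner_smul_right, real_inner_smul_right, real_inner_comm f, hef,
    real_inner_self_eq_norm_sq, he]
  ring

theorem exists_mirror_of_inner_lt {P x y : E} (hxy : ‖x‖ = ‖y‖) (hlt : ⟪P, y⟫ < ⟪P, x⟫) :
    ∃ ν : E, ‖ν‖ = 1 ∧ mirror ν 0 x = y ∧ 0 < ⟪P, ν⟫ ∧ 0 < ⟪x, ν⟫ := by
  have hne : x ≠ y := fun h => by rw [h] at hlt; exact lt_irrefl _ hlt
  obtain ⟨ν, hν, rfl⟩ := exists_mirror_eq hxy hne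
  have h1 : 0 < ⟪x, ν⟫ * ⟪P, ν⟫ := by
    rw [mirror, inner_sub_right, real_inner_smul_right] at hlt
    linarith
  rcases pos_and_pos_or_neg_and_neg_of_mul_pos h1 with ⟨h2, h3⟩ | ⟨h2, h3⟩
  · exact ⟨ν, hν, rfl, h3, h2⟩
  · refine ⟨-ν, by simpa using hν, ?_, by simpa using h3, by simpa using h2⟩
    simp [mirror]

variable [FiniteDimensional ℝ E]

theorem D2_le_laplacian {u : E → ℝ} {x e : E} (he : ‖e‖ = 1)
    (h : ∀ f, ‖f‖ = 1 → ⟪f, e⟫ = 0 → 0 ≤ D2 u x f) : D2 u x e ≤ Δ u x := by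
  have hn : 0 < Module.finrank ℝ E :=
    Module.finrank_pos_iff_exists_ne_zero.2 ⟨e, fun h => by simp [h] at he⟩
  set i₀ : Fin (Module.finrank ℝ E) := ⟨0, hn⟩
  obtain ⟨b, hb⟩ := Orthonormal.exists_orthonormalBasis_extension_of_card_eq (𝕜 := ℝ)
    (v := fun _ : Fin (Module.finrank ℝ E) => e) (s := {i₀}) (by simp) (by
      refine ⟨fun _ => he, fun i j hij => absurd (Subsingleton.elim i j) hij⟩)
  have hb0 : b i₀ = e := hb i₀ rfl
  rw [laplacian_eq_sum_D2 b, ← hb0]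
  rw [← Finset.add_sum_erase _ _ (Finset.mem_univ i₀), le_add_iff_nonneg_right]
  refine Finset.sum_nonneg fun i hi => h _ (b.norm_eq_one i) ?_
  rw [← hb0]
  exact b.orthonormal.2 (Finset.ne_of_mem_erase hi)

variable {P e : E} {ε l p c : ℝ} {u : E → ℝ} {ν : E}

theorem PosSol.lt_mirror_of_lt_inner (h : PosSol P ε l u) (hs : Sweeps P ε l u) (hε : 0 < ε)
    (hPε : ‖P‖ + ε < 1) (hν : ‖ν‖ = 1) (hc : 0 ≤ c) (hcP : c < ⟪P, ν⟫) {x : E}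
    (hx : x ∈ dom P ε) (hxc : c < ⟪x, ν⟫) :
    mirror ν c x ∈ dom P ε ∧ u x < u (mirror ν c x) := by
  have hσ : ∀ x, ‖x‖ < 1 → c < ⟪x, ν⟫ → ε ≤ ‖x - P‖ → ε < ‖mirror ν c x - P‖ :=
    fun x _ h1 h2 => h2.trans_lt (norm_mirror_sub_lt hν h1 hcP)
  have hεν : ‖ε • ν‖ = ε := by rw [norm_smul, hν, mul_one, Real.norm_of_nonneg hε.le]
  have hz1 : ‖P + ε • ν‖ < 1 := (norm_add_le _ _).trans_lt (by rwa [hεν])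
  have hz2 : c < ⟪P + ε • ν, ν⟫ := by
    rw [inner_add_left, real_inner_smul_left, real_inner_self_eq_norm_sq, hν]; linarith
  have hz3 : ‖P + ε • ν - P‖ = ε := by rw [add_sub_cancel_left, hεν]
  have hd : ∀ x, ‖x‖ < 1 → c < ⟪x, ν⟫ → ε ≤ ‖x - P‖ → mirror ν c x ∈ dom P ε := fun x h1 h2 h3 =>
    mem_dom.2 ⟨(norm_mirror_le hν hc h2.le).trans_lt h1, hσ x h1 h2 h3⟩
  refine ⟨hd x (mem_dom.1 hx).1 hxc (mem_dom.1 hx).2.le,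
    h.lt_mirror hs hε hν hc hσ (z := P + ε • ν) (subset_closure ⟨by simpa using hz1, hz2⟩)
      (h.zero _ fun h1 => ?_) (h.pos _ (hd _ hz1 hz2 hz3.ge)) hx hxc⟩
  have := (mem_dom.1 h1).2
  rw [hz3] at this
  exact lt_irrefl _ this

theorem PosSol.fderiv_neg (h : PosSol P ε l u) (hs : Sweeps P ε l u) (hε : 0 < ε)
    (hPε : ‖P‖ + ε < 1) (hν : ‖ν‖ = 1) (hc : 0 ≤ c) (hcP : c < ⟪P, ν⟫) {x : E}
    (hx : x ∈ dom P ε) (hxc : ⟪x, ν⟫ = c) : fderiv ℝ u x ν < 0 :=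
  h.fderiv_neg_of_lt_mirror hν
    (fun _ hx hxc => h.lt_mirror_of_lt_inner hs hε hPε hν hc hcP hx hxc) hx hxc

theorem PosSol.lt_of_inner_lt (h : PosSol P ε l u) (hs : Sweeps P ε l u) (hε : 0 < ε)
    (hPε : ‖P‖ + ε < 1) {x y : E} (hxy : ‖x‖ = ‖y‖) (hlt : ⟪P, y⟫ < ⟪P, x⟫) (hx : x ∈ dom P ε) :
    u x < u y := by
  obtain ⟨ν, hν, rfl, h1, h2⟩ := exists_mirror_of_inner_lt hxy hlt
  exact (h.lt_mirror_of_lt_inner hs hε hPε hν le_rfl h1 hx h2).2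

end CriticalPoints

section CriticalCount

open Laplacian

open scoped RealInnerProductSpace

section Circle

variable {E : Type*} [NormedAddCommGroup E] [InnerProductSpace ℝ E] {u : E → ℝ} {e f : E} {s : ℝ}

theorem fderiv_circle_eq_zero (hu : ContDiffAt ℝ 2 u (s • e)) (hs : s ≠ 0)
    (h : IsLocalExtr (fun t => u ((s * Real.cos t) • e + (s * Real.sin t) • f)) 0) :
    fderiv ℝ u (s • e) f = 0 := by
  have h1 := deriv_curve hu (hasDerivAt_circle e f s) (by simp)
  rw [h.deriv_eq_zero] at h1
  simpa [hs] using h1.symm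

theorem D2_circle_nonneg (hu : ContDiffAt ℝ 2 u (s • e)) (hs : s ≠ 0)
    (hcrit : fderiv ℝ u (s • e) e = 0)
    (h : IsLocalMin (fun t => u ((s * Real.cos t) • e + (s * Real.sin t) • f)) 0) :
    0 ≤ D2 u (s • e) f := by
  have h1 := IsLocalMin.D2_curve_nonneg hu (hasDerivAt_circle e f s) (hasDerivAt_circle' e f s)
    (by simp) h
  have h2 : D2 u (s • e) ((-(s * Real.sin 0)) • e + (s * Real.cos 0) • f) =
      s ^ 2 * D2 u (s • e) f := by
    simp [D2]; ring
  rw [h2, map_smul, hcrit, smul_zero, add_zero] at h1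
  exact nonneg_of_mul_nonneg_right h1 (by positivity)

theorem fderiv_eq_zero_of_orthogonal {x : E} (he : ‖e‖ = 1) (h0 : fderiv ℝ u x e = 0)
    (h : ∀ f, ‖f‖ = 1 → ⟪f, e⟫ = 0 → fderiv ℝ u x f = 0) : fderiv ℝ u x = 0 := by
  ext v
  set w := v - ⟪v, e⟫ • e with hw
  have hwe : ⟪w, e⟫ = 0 := by
    rw [hw, inner_sub_left, real_inner_smul_left, real_inner_self_eq_norm_sq, he]; ring
  have hv : v = ⟪v, e⟫ • e + w := by rw [hw]; abel
  have hfw : fderiv ℝ u x w = 0 := by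
    by_cases h1 : w = 0
    · rw [h1, map_zero]
    · have h2 := h (‖w‖⁻¹ • w) (norm_smul_inv_norm (𝕜 := ℝ) h1)
        (by rw [real_inner_smul_left, hwe, mul_zero])
      rw [map_smul, smul_eq_zero] at h2
      exact h2.resolve_left (by simpa using h1)
  rw [hv, map_add, map_smul, h0, hfw]
  simp

theorem mem_dom_axis {P : E} {ε p : ℝ} (he : ‖e‖ = 1) (hP : P = p • e) :
    s • e ∈ dom P ε ↔ |s| < 1 ∧ ε < |s - p| := by
  rw [mem_dom, hP, ← sub_smul, norm_smul, norm_smul, he, mul_one, mul_one, Real.norm_eq_abs,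
    Real.norm_eq_abs]

end Circle

variable {E : Type*} [NormedAddCommGroup E] [InnerProductSpace ℝ E] [FiniteDimensional ℝ E]
  {P e : E} {ε l p : ℝ} {u : E → ℝ}

theorem PosSol.isMinOn_circle (h : PosSol P ε l u) (hs : Sweeps P ε l u) (hε : 0 < ε)
    (hPε : ‖P‖ + ε < 1) (he : ‖e‖ = 1) (hp : 0 < p) (hP : P = p • e) {f : E} (hf : ‖f‖ = 1)
    (hfe : ⟪f, e⟫ = 0) {s : ℝ} (hs0 : 0 < s) (hx : s • e ∈ dom P ε) (t : ℝ) :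
    u (s • e) ≤ u ((s * Real.cos t) • e + (s * Real.sin t) • f) := by
  rcases (Real.cos_le_one t).eq_or_lt with h1 | h1
  · have h2 : Real.sin t = 0 := by
      have := Real.sin_sq_add_cos_sq t
      rw [h1] at this
      exact pow_eq_zero_iff two_ne_zero |>.1 (by linarith)
    simp [h1, h2]
  · refine (h.lt_of_inner_lt hs hε hPε (norm_circle he hf hfe s t).symm ?_ hx).le
    rw [hP, real_inner_smul_left, inner_circle he hfe, real_inner_smul_left, real_inner_smul_right,
      real_inner_self_eq_norm_sq, he]
    have := mul_pos hp hs0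
    nlinarith

theorem PosSol.isMaxOn_circle (h : PosSol P ε l u) (hs : Sweeps P ε l u) (hε : 0 < ε)
    (hPε : ‖P‖ + ε < 1) (he : ‖e‖ = 1) (hp : 0 < p) (hP : P = p • e) {f : E} (hf : ‖f‖ = 1)
    (hfe : ⟪f, e⟫ = 0) {s : ℝ} (hs0 : s < 0) (t : ℝ) :
    u ((s * Real.cos t) • e + (s * Real.sin t) • f) ≤ u (s • e) := by
  by_cases hx : (s * Real.cos t) • e + (s * Real.sin t) • f ∈ dom P ε
  swap
  · rw [h.zero _ hx]; exact h.nonneg _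
  rcases (Real.cos_le_one t).eq_or_lt with h1 | h1
  · have h2 : Real.sin t = 0 := by
      have := Real.sin_sq_add_cos_sq t
      rw [h1] at this
      exact pow_eq_zero_iff two_ne_zero |>.1 (by linarith)
    simp [h1, h2]
  · refine (h.lt_of_inner_lt hs hε hPε (norm_circle he hf hfe s t) ?_ hx).le
    rw [hP, real_inner_smul_left, real_inner_smul_left, inner_circle he hfe, real_inner_smul_right,
      real_inner_self_eq_norm_sq, he]
    have := mul_pos hp (neg_pos.2 hs0)
    nlinarith

theorem PosSol.fderiv_axis (h : PosSol P ε l u) (hs : Sweeps P ε l u) (hε : 0 < ε)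
    (hPε : ‖P‖ + ε < 1) (he : ‖e‖ = 1) (hp : 0 < p) (hP : P = p • e) {s : ℝ} (hs0 : s ≠ 0)
    (hx : s • e ∈ dom P ε) (h0 : fderiv ℝ u (s • e) e = 0) : fderiv ℝ u (s • e) = 0 := by
  refine fderiv_eq_zero_of_orthogonal he h0 fun f hf hfe => ?_
  refine fderiv_circle_eq_zero (h.helm _ hx).1 hs0 ?_
  rcases hs0.lt_or_gt with h1 | h1
  · refine Or.inr (Eventually.of_forall fun t => ?_)
    simpa using h.isMaxOn_circle hs hε hPε he hp hP hf hfe h1 t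
  · refine Or.inl (Eventually.of_forall fun t => ?_)
    simpa using h.isMinOn_circle hs hε hPε he hp hP hf hfe h1 hx t

theorem PosSol.D2_axis_neg (h : PosSol P ε l u) (hs : Sweeps P ε l u) (hε : 0 < ε)
    (hPε : ‖P‖ + ε < 1) (he : ‖e‖ = 1) (hp : 0 < p) (hP : P = p • e) {s : ℝ} (hs0 : 0 < s)
    (hx : s • e ∈ dom P ε) (h0 : fderiv ℝ u (s • e) e = 0) : D2 u (s • e) e < 0 := by
  refine (D2_le_laplacian he fun f hf hfe => ?_).trans_lt ?_
  · refine D2_circle_nonneg (h.helm _ hx).1 hs0.ne' h0 (Eventually.of_forall fun t => ?_)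
    simpa using h.isMinOn_circle hs hε hPε he hp hP hf hfe hs0 hx t
  · rw [(h.helm _ hx).2]
    have := mul_pos h.eigen_pos (h.pos _ hx)
    linarith

theorem PosSol.axis_of_critical (h : PosSol P ε l u) (hs : Sweeps P ε l u) (hε : 0 < ε)
    (hPε : ‖P‖ + ε < 1) (he : ‖e‖ = 1) (hp : 0 < p) (hP : P = p • e) {x : E}
    (hx : x ∈ dom P ε) (h0 : fderiv ℝ u x = 0) : ∃ s : ℝ, x = s • e := by
  by_contra! hne
  have hx0 : x ≠ 0 := by simpa using hne 0
  set w := P - (⟪P, x⟫ / ‖x‖ ^ 2) • x with hw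
  have hn0 : ‖x‖ ≠ 0 := norm_ne_zero_iff.2 hx0
  have hwx : ⟪x, w⟫ = 0 := by
    rw [hw, inner_sub_right, real_inner_smul_right, real_inner_self_eq_norm_sq, real_inner_comm]
    field_simp; ring
  have hw0 : w ≠ 0 := fun h1 => by
    have h2 : P = (⟪P, x⟫ / ‖x‖ ^ 2) • x := sub_eq_zero.1 h1
    have h3 : ⟪P, x⟫ / ‖x‖ ^ 2 ≠ 0 := fun h3 => by
      rw [h3, zero_smul, hP, smul_eq_zero] at h2
      rcases h2 with h2 | h2
      · exact hp.ne' h2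
      · rw [h2, norm_zero] at he; exact zero_ne_one he
    refine hne ((⟪P, x⟫ / ‖x‖ ^ 2)⁻¹ * p) ?_
    rw [mul_smul, ← hP, eq_inv_smul_iff₀ h3]
    exact h2.symm
  have hPw : ⟪P, w⟫ = ‖w‖ ^ 2 := by
    have : P = w + (⟪P, x⟫ / ‖x‖ ^ 2) • x := by rw [hw]; abel
    rw [this, inner_add_left, real_inner_smul_left, hwx, real_inner_self_eq_norm_sq]; ring
  have hwn : 0 < ‖w‖ := norm_pos_iff.2 hw0
  have := h.fderiv_neg hs hε hPε (ν := ‖w‖⁻¹ • w) (c := 0) (norm_smul_inv_norm (𝕜 := ℝ) hw0) le_rfl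
    (by rw [real_inner_smul_right, hPw]; positivity) hx
    (by rw [real_inner_smul_right, hwx, mul_zero])
  rw [h0] at this
  exact lt_irrefl _ this

theorem PosSol.fderiv_axis_neg (h : PosSol P ε l u) (hs : Sweeps P ε l u) (hε : 0 < ε)
    (hPε : ‖P‖ + ε < 1) (he : ‖e‖ = 1) (hP : P = p • e) {s : ℝ} (hs0 : 0 ≤ s)
    (hsp : s < p) (hx : s • e ∈ dom P ε) : fderiv ℝ u (s • e) e < 0 := by
  refine h.fderiv_neg hs hε hPε he hs0 ?_ hx ?_
  · rwa [hP, real_inner_smul_left, real_inner_self_eq_norm_sq, he, one_pow, mul_one]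
  · rw [real_inner_smul_left, real_inner_self_eq_norm_sq, he, one_pow, mul_one]

theorem PosSol.fderiv_cap (h : PosSol P ε l u) (hs : Sweeps P ε l u) (hε : 0 < ε) (hεp : ε < p)
    (he : ‖e‖ = 1) (hP : P = p • e) {a : ℝ} (ha : 1 / 2 ≤ a) (ha1 : a < 1) :
    fderiv ℝ u ((-a) • e) (-e) < 0 := by
  have he' : ‖-e‖ = 1 := by rwa [norm_neg]
  have hee : ⟪e, e⟫ = 1 := by rw [real_inner_self_eq_norm_sq, he, one_pow]
  have hp1 : 0 < p := hε.trans hεp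
  have hσ : ∀ x, ‖x‖ < 1 → a < ⟪x, -e⟫ → ε ≤ ‖x - P‖ → ε < ‖mirror (-e) a x - P‖ := by
    intro x hx hxa _
    have h1 : |⟪x, -e⟫| ≤ ‖x‖ * ‖-e‖ := abs_real_inner_le_norm _ _
    rw [he', mul_one] at h1
    have h2 := (abs_le.1 h1).2
    have h3 : |⟪mirror (-e) a x - P, e⟫| ≤ ‖mirror (-e) a x - P‖ * ‖e‖ := abs_real_inner_le_norm _ _
    have h4 := inner_mirror he' a x
    rw [he, mul_one, inner_sub_left, hP, real_inner_smul_left, hee] at h3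
    simp only [inner_neg_right] at h4 hxa h2
    rw [hP]
    have h5 := neg_le_of_abs_le h3
    linarith
  have hea : (-a) • e ∈ dom P ε := by
    rw [mem_dom_axis he hP, abs_neg, abs_of_pos (by linarith), abs_of_neg (by linarith)]
    exact ⟨ha1, by linarith⟩
  have hcl : -e ∈ closure (ball 0 1 ∩ {x : E | a < ⟪x, -e⟫}) := by
    have h1 : Tendsto (fun t : ℝ => t • (-e)) (𝓝[<] 1) (𝓝 (-e)) := by
      have : Tendsto (fun t : ℝ => t • (-e)) (𝓝 1) (𝓝 ((1 : ℝ) • (-e))) :=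
        (continuous_id.smul continuous_const).tendsto 1
      rw [one_smul] at this
      exact this.mono_left nhdsWithin_le_nhds
    refine mem_closure_of_tendsto h1 ?_
    filter_upwards [Ioo_mem_nhdsLT ha1] with t ht
    refine ⟨?_, ?_⟩
    · rw [mem_ball_zero_iff, norm_smul, he', mul_one, Real.norm_eq_abs, abs_of_pos (by linarith [ht.1])]
      exact ht.2
    · show a < ⟪t • (-e), -e⟫
      rw [real_inner_smul_left, real_inner_self_eq_norm_sq, he', one_pow, mul_one]
      exact ht.1
  have hmz : mirror (-e) a (-e) = (1 - 2 * a) • e := by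
    rw [mirror, real_inner_self_eq_norm_sq, he', one_pow]
    module
  refine h.fderiv_neg_of_lt_mirror (c := a) he' (fun x hx hxa => ⟨mem_dom.2 ⟨?_, ?_⟩, ?_⟩) hea ?_
  · exact (norm_mirror_le he' (by linarith) hxa.le).trans_lt (mem_dom.1 hx).1
  · exact hσ x (mem_dom.1 hx).1 hxa (mem_dom.1 hx).2.le
  · refine h.lt_mirror hs hε he' (by linarith) hσ hcl ?_ ?_ hx hxa
    · refine h.zero _ fun h1 => ?_
      have := (mem_dom.1 h1).1
      rw [he'] at this
      exact lt_irrefl _ this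
    · rw [hmz]
      refine h.pos _ ((mem_dom_axis he hP).2 ⟨?_, ?_⟩)
      · rw [abs_lt]; constructor <;> linarith
      · rw [abs_of_neg (by linarith)]; linarith
  · rw [inner_neg_right, real_inner_smul_left, hee]; ring

theorem PosSol.ncard_critical (h : PosSol P ε l u) (hs : Sweeps P ε l u) (hε : 0 < ε)
    (hPε : ‖P‖ + ε < 1) (he : ‖e‖ = 1) (hεp : ε < p) (hP : P = p • e)
    (hleft : ∀ a ∈ Ioo (0 : ℝ) 1, fderiv ℝ u ((-a) • e) = 0 → D2 u ((-a) • e) e < 0) :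
    {x ∈ dom P ε | fderiv ℝ u x = 0}.ncard = 2 := by
  have hp : 0 < p := hε.trans hεp
  have hP1 : p + ε < 1 := by
    rwa [hP, norm_smul, he, mul_one, Real.norm_of_nonneg hp.le] at hPε
  have hmem : ∀ s : ℝ, s • e ∈ dom P ε ↔ s ∈ Ioo (-1) (p - ε) ∪ Ioo (p + ε) 1 := by
    intro s
    rw [mem_dom_axis he hP, abs_lt, lt_abs]
    constructor
    · rintro ⟨h1, h2 | h2⟩
      · exact Or.inr ⟨by linarith, h1.2⟩
      · exact Or.inl ⟨h1.1, by linarith⟩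
    · rintro (h1 | h1)
      · exact ⟨⟨h1.1, by linarith [h1.2]⟩, Or.inr (by linarith [h1.2])⟩
      · exact ⟨⟨by linarith [h1.1], h1.2⟩, Or.inl (by linarith [h1.1])⟩
  set g : ℝ → ℝ := fun s => u (s • e) with hg
  have hgc : Continuous g := (h.continuous hε).comp (continuous_id.smul continuous_const)
  have hg0 : ∀ s, s • e ∉ dom P ε → g s = 0 := fun s hs => h.zero _ hs
  have hrolle : ∀ a b, a < b → Ioo a b ⊆ Ioo (-1) (p - ε) ∪ Ioo (p + ε) 1 →
      a ∉ Ioo (-1) (p - ε) ∪ Ioo (p + ε) 1 → b ∉ Ioo (-1) (p - ε) ∪ Ioo (p + ε) 1 →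
      ∃ s ∈ Ioo a b, fderiv ℝ u (s • e) e = 0 := by
    intro a b hab hsub ha hb
    obtain ⟨s, hs1, hs2⟩ := exists_deriv_eq_zero hab hgc.continuousOn
      ((hg0 a (mt (hmem a).1 ha)).trans (hg0 b (mt (hmem b).1 hb)).symm)
    have := (h.helm _ ((hmem s).2 (hsub hs1))).1
    exact ⟨s, hs1, by rw [← (deriv_ray this).1]; exact hs2⟩
  have huniq : ∀ a b, Icc a b ⊆ Ioo (-1) (p - ε) ∪ Ioo (p + ε) 1 → a < b →
      fderiv ℝ u (a • e) = 0 → fderiv ℝ u (b • e) = 0 →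
      ∃ m ∈ Icc a b, fderiv ℝ u (m • e) e = 0 ∧ 0 ≤ D2 u (m • e) e := by
    intro a b hsub hab ha hb
    have hd : ∀ s ∈ Icc a b, _ := fun s hs => deriv_ray (h.helm _ ((hmem s).2 (hsub hs))).1
    obtain ⟨m, hm, h1, h2⟩ := exists_critical_convex hab (fun s _ => hgc.continuousAt)
      (by rw [(hd a ⟨le_rfl, hab.le⟩).1, ha]; rfl) (by rw [(hd b ⟨hab.le, le_rfl⟩).1, hb]; rfl)
    exact ⟨m, hm, (hd m hm).1 ▸ h1, (hd m hm).2 ▸ h2⟩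
  obtain ⟨s₁, hs₁, h1⟩ := hrolle (-1) (p - ε) (by linarith) subset_union_left
    (by rintro (⟨_, _⟩ | ⟨_, _⟩) <;> linarith) (by rintro (⟨_, _⟩ | ⟨_, _⟩) <;> linarith)
  obtain ⟨s₂, hs₂, h2⟩ := hrolle (p + ε) 1 (by linarith) subset_union_right
    (by rintro (⟨_, _⟩ | ⟨_, _⟩) <;> linarith) (by rintro (⟨_, _⟩ | ⟨_, _⟩) <;> linarith)
  have hnegof : ∀ s ∈ Ioo (-1) (p - ε), fderiv ℝ u (s • e) e = 0 → s < 0 := by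
    intro s hs' h3
    by_contra! h4
    have := h.fderiv_axis_neg hs hε hPε he hP h4 (by linarith [hs'.2]) ((hmem s).2 (Or.inl hs'))
    exact this.ne h3
  have hs₁0 := hnegof s₁ hs₁ h1
  have hs₂0 : 0 < s₂ := by linarith [hs₂.1]
  have hd₁ := (hmem s₁).2 (Or.inl hs₁)
  have hd₂ := (hmem s₂).2 (Or.inr hs₂)
  have hc₁ := h.fderiv_axis hs hε hPε he hp hP hs₁0.ne hd₁ h1
  have hc₂ := h.fderiv_axis hs hε hPε he hp hP hs₂0.ne' hd₂ h2
  have hne : s₁ • e ≠ s₂ • e := fun h3 => by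
    have h4 : e ≠ 0 := norm_ne_zero_iff.1 (by rw [he]; exact one_ne_zero)
    have := smul_left_injective ℝ h4 h3
    linarith
  have hnoL : ∀ a b, Icc a b ⊆ Ioo (-1) (p - ε) → a < b →
      fderiv ℝ u (a • e) = 0 → fderiv ℝ u (b • e) = 0 → False := by
    intro a b hsub hab ha hb
    obtain ⟨m, hm, h3, h4⟩ := huniq a b (hsub.trans subset_union_left) hab ha hb
    have hm0 := hnegof m (hsub hm) h3
    have h5 := h.fderiv_axis hs hε hPε he hp hP hm0.ne ((hmem m).2 (Or.inl (hsub hm))) h3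
    have h6 := hleft (-m) ⟨by linarith, by linarith [(hsub hm).1]⟩
    rw [neg_neg] at h6
    exact absurd (h6 h5) (not_lt.2 h4)
  have hnoR : ∀ a b, Icc a b ⊆ Ioo (p + ε) 1 → a < b →
      fderiv ℝ u (a • e) = 0 → fderiv ℝ u (b • e) = 0 → False := by
    intro a b hsub hab ha hb
    obtain ⟨m, hm, h3, h4⟩ := huniq a b (hsub.trans subset_union_right) hab ha hb
    have := h.D2_axis_neg hs hε hPε he hp hP (s := m) (by linarith [(hsub hm).1])
      ((hmem m).2 (Or.inr (hsub hm))) h3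
    exact absurd this (not_lt.2 h4)
  rw [Set.ncard_eq_two]
  refine ⟨s₁ • e, s₂ • e, hne, Set.ext fun x => ⟨fun ⟨hx, h3⟩ => ?_, ?_⟩⟩
  · obtain ⟨s, rfl⟩ := h.axis_of_critical hs hε hPε he hp hP hx h3
    rcases (hmem s).1 hx with h4 | h4
    · left
      rcases lt_trichotomy s s₁ with h5 | h5 | h5
      · exact (hnoL s s₁ (Set.Icc_subset_Ioo h4.1 hs₁.2) h5 h3 hc₁).elim
      · rw [h5]
      · exact (hnoL s₁ s (Set.Icc_subset_Ioo hs₁.1 h4.2) h5 hc₁ h3).elim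
    · right
      rcases lt_trichotomy s s₂ with h5 | h5 | h5
      · exact (hnoR s s₂ (Set.Icc_subset_Ioo h4.1 hs₂.2) h5 h3 hc₂).elim
      · rw [h5]; rfl
      · exact (hnoR s₂ s (Set.Icc_subset_Ioo hs₂.1 h4.2) h5 hc₂ h3).elim
  · rintro (rfl | rfl)
    · exact ⟨hd₁, hc₁⟩
    · exact ⟨hd₂, hc₂⟩

end CriticalCount

section Ultralimit

open Laplacian

theorem Ultrafilter.exists_tendsto_of_mem_compact {ι X : Type*} [TopologicalSpace X]
    (𝒰 : Ultrafilter ι) {f : ι → X} {K : Set X} (hK : IsCompact K) (h : ∀ᶠ i in 𝒰, f i ∈ K) :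
    ∃ y ∈ K, Tendsto f 𝒰 (𝓝 y) := by
  obtain ⟨y, hy, h1⟩ := hK.ultrafilter_le_nhds (𝒰.map f) (tendsto_principal.2 h)
  exact ⟨y, hy, h1⟩

theorem Ultrafilter.exists_tendsto_of_norm_le {ι F : Type*} [NormedAddCommGroup F] [ProperSpace F]
    (𝒰 : Ultrafilter ι) {f : ι → F} {C : ℝ} (h : ∀ᶠ i in 𝒰, ‖f i‖ ≤ C) :
    ∃ y, Tendsto f 𝒰 (𝓝 y) := by
  obtain ⟨y, -, hy⟩ := 𝒰.exists_tendsto_of_mem_compact (isCompact_closedBall (0 : F) C)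
    (f := f) (by simpa using h)
  exact ⟨y, hy⟩

theorem tendsto_of_tendsto_of_lip {ι E F : Type*} [NormedAddCommGroup E] [NormedAddCommGroup F]
    {𝓕 : Filter ι} {f : ι → E → F} {x : E} {y : ι → E} {a : F} {r C : ℝ} (hr : 0 < r)
    (hx : Tendsto (fun i => f i x) 𝓕 (𝓝 a)) (hy : Tendsto y 𝓕 (𝓝 x))
    (h : ∀ᶠ i in 𝓕, ∀ k, ‖k‖ ≤ r → ‖f i (x + k) - f i x‖ ≤ C * ‖k‖) :
    Tendsto (fun i => f i (y i)) 𝓕 (𝓝 a) := by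
  have h1 : Tendsto (fun i => ‖y i - x‖) 𝓕 (𝓝 0) := tendsto_iff_norm_sub_tendsto_zero.1 hy
  have h2 : Tendsto (fun i => f i (y i) - f i x) 𝓕 (𝓝 0) := by
    refine squeeze_zero_norm' ?_ (by simpa using h1.const_mul C)
    filter_upwards [h, h1.eventually (ge_mem_nhds hr)] with i h3 h4
    simpa using h3 (y i - x) h4
  simpa using h2.add hx

theorem hasFDerivAt_of_quadratic {E F : Type*} [NormedAddCommGroup E] [NormedSpace ℝ E]
    [NormedAddCommGroup F] [NormedSpace ℝ F] {f : E → F} {f' : E →L[ℝ] F} {x : E} {C r : ℝ}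
    (hr : 0 < r) (h : ∀ k, ‖k‖ ≤ r → ‖f (x + k) - f x - f' k‖ ≤ C * ‖k‖ ^ 2) :
    HasFDerivAt f f' x := by
  rw [hasFDerivAt_iff_isLittleO_nhds_zero]
  have h1 : (fun k => f (x + k) - f x - f' k) =O[𝓝 0] fun k : E => ‖k‖ ^ 2 := by
    refine Asymptotics.IsBigO.of_bound C ?_
    filter_upwards [closedBall_mem_nhds (0 : E) hr] with k hk
    simpa using h k (by simpa using hk)
  refine h1.trans_isLittleO ?_
  have := (Asymptotics.isLittleO_norm_pow_id (E' := E) one_lt_two)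
  exact this

theorem continuousAt_of_lip {E F : Type*} [NormedAddCommGroup E] [NormedAddCommGroup F] {f : E → F}
    {x : E} {C r : ℝ} (hr : 0 < r) (h : ∀ k, ‖k‖ ≤ r → ‖f (x + k) - f x‖ ≤ C * ‖k‖) :
    ContinuousAt f x :=
  tendsto_of_tendsto_of_lip (f := fun _ => f) (y := id) hr tendsto_const_nhds tendsto_id
    (Eventually.of_forall fun _ => h)

variable {E : Type*} [NormedAddCommGroup E] [InnerProductSpace ℝ E] [FiniteDimensional ℝ E]

theorem BoundedSol.norm_estimates {w : E → ℝ} {y : E} {l Λ r : ℝ}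
    (h : BoundedSol l 1 y (5 * r) w) (hr : 0 < r) (hl0 : 0 ≤ l) (hl : l ≤ Λ) :
    ‖fderiv ℝ w y‖ ≤ gradConst E Λ r ∧ ‖fderiv ℝ (fderiv ℝ w) y‖ ≤ gradConst E Λ r ^ 2 ∧
    ∀ k, ‖k‖ ≤ r → ‖w (y + k) - w y - fderiv ℝ w y k‖ ≤ gradConst E Λ r ^ 2 * ‖k‖ ^ 2 ∧
      ‖fderiv ℝ w (y + k) - fderiv ℝ w y‖ ≤ gradConst E Λ r ^ 2 * ‖k‖ ∧
      ‖fderiv ℝ w (y + k) - fderiv ℝ w y - fderiv ℝ (fderiv ℝ w) y k‖ ≤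
        gradConst E Λ r ^ 3 * ‖k‖ ^ 2 ∧
      ‖fderiv ℝ (fderiv ℝ w) (y + k) - fderiv ℝ (fderiv ℝ w) y‖ ≤ gradConst E Λ r ^ 3 * ‖k‖ := by
  have hΛ : 0 ≤ Λ := hl0.trans hl
  have hK : 0 ≤ gradConst E Λ r := by unfold gradConst; positivity
  refine ⟨ContinuousLinearMap.opNorm_le_bound _ hK fun v => ?_,
    ContinuousLinearMap.opNorm_le_bound₂ _ (by positivity) fun k v => ?_, fun k hk => ⟨?_, ?_, ?_, ?_⟩⟩
  · simpa using h.abs_fderiv_le hr zero_le_one hl0 hl (mem_closedBall_self (by linarith)) v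
  · exact h.abs_D2_le hr hl0 hl k v
  · exact h.taylor_one hr hl0 hl hk
  · exact ContinuousLinearMap.opNorm_le_bound _ (by positivity) fun v =>
      h.fderiv_sub_le hr hl0 hl hk v
  · exact ContinuousLinearMap.opNorm_le_bound _ (by positivity) fun v =>
      h.taylor_two hr hl0 hl hk v
  · refine ContinuousLinearMap.opNorm_le_bound₂ _ (by positivity) fun j v => ?_
    have := h.abs_D2_sub_le hr hl0 hl hk j v
    rw [mul_right_comm (gradConst E Λ r ^ 3)] at this
    exact this

theorem exists_ultralimit {ι : Type*} (𝒰 : Ultrafilter ι) {l : ι → ℝ} {u : ι → E → ℝ} {l₀ Λ : ℝ}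
    (hl : Tendsto l 𝒰 (𝓝 l₀)) (hlΛ : ∀ i, 0 ≤ l i ∧ l i ≤ Λ) {D : Set E} (hD : IsOpen D)
    (hu : ∀ i x, |u i x| ≤ 1)
    (h : ∀ x ∈ D, ∃ r > 0, ∀ᶠ i in 𝒰, Helmholtz (l i) (closedBall x (5 * r)) (u i)) :
    ∃ u₀ : E → ℝ, (∀ x, Tendsto (fun i => u i x) 𝒰 (𝓝 (u₀ x))) ∧ Helmholtz l₀ D u₀ ∧
      ∀ x ∈ D, ∀ y : ι → E, Tendsto y 𝒰 (𝓝 x) → Tendsto (fun i => u i (y i)) 𝒰 (𝓝 (u₀ x)) ∧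
        Tendsto (fun i => fderiv ℝ (u i) (y i)) 𝒰 (𝓝 (fderiv ℝ u₀ x)) ∧
        Tendsto (fun i => fderiv ℝ (fderiv ℝ (u i)) (y i)) 𝒰 (𝓝 (fderiv ℝ (fderiv ℝ u₀) x)) := by
  have key : ∀ x ∈ D, ∃ r > 0, ∃ K : ℝ, 0 ≤ K ∧ closedBall x r ⊆ D ∧
      ∀ᶠ i in 𝒰, Helmholtz (l i) {x} (u i) ∧
        ‖fderiv ℝ (u i) x‖ ≤ K ∧ ‖fderiv ℝ (fderiv ℝ (u i)) x‖ ≤ K ^ 2 ∧ ∀ k, ‖k‖ ≤ r →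
        ‖u i (x + k) - u i x - fderiv ℝ (u i) x k‖ ≤ K ^ 2 * ‖k‖ ^ 2 ∧
        ‖fderiv ℝ (u i) (x + k) - fderiv ℝ (u i) x‖ ≤ K ^ 2 * ‖k‖ ∧
        ‖fderiv ℝ (u i) (x + k) - fderiv ℝ (u i) x - fderiv ℝ (fderiv ℝ (u i)) x k‖ ≤
          K ^ 3 * ‖k‖ ^ 2 ∧
        ‖fderiv ℝ (fderiv ℝ (u i)) (x + k) - fderiv ℝ (fderiv ℝ (u i)) x‖ ≤ K ^ 3 * ‖k‖ := by
    intro x hx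
    obtain ⟨r, hr, h1⟩ := h x hx
    obtain ⟨R, hR, hRD⟩ := Metric.nhds_basis_closedBall.mem_iff.1 (hD.mem_nhds hx)
    have hΛ : ∃ i, 0 ≤ l i := h1.exists.imp fun i _ => (hlΛ i).1
    have hΛ0 : 0 ≤ Λ := by obtain ⟨i, -⟩ := hΛ; exact (hlΛ i).1.trans (hlΛ i).2
    refine ⟨min r R, lt_min hr hR, gradConst E Λ r, by unfold gradConst; positivity,
      (closedBall_subset_closedBall (min_le_right _ _)).trans hRD, ?_⟩
    filter_upwards [h1] with i hi
    obtain ⟨e1, e2, e3⟩ := BoundedSol.norm_estimates ⟨hi, fun x _ => hu i x⟩ hr (hlΛ i).1 (hlΛ i).2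
    exact ⟨hi.mono (by simpa using (by positivity : 0 ≤ 5 * r)), e1, e2,
      fun k hk => e3 k (hk.trans (min_le_left _ _))⟩
  have hu0 : ∀ x, ∃ a, Tendsto (fun i => u i x) 𝒰 (𝓝 a) := fun x =>
    𝒰.exists_tendsto_of_norm_le (Eventually.of_forall fun i => hu i x)
  have hp0 : ∀ x, ∃ a, x ∈ D → Tendsto (fun i => fderiv ℝ (u i) x) 𝒰 (𝓝 a) := fun x => by
    by_cases hx : x ∈ D
    · obtain ⟨r, -, K, -, -, h1⟩ := key x hx
      obtain ⟨a, ha⟩ := 𝒰.exists_tendsto_of_norm_le (h1.mono fun i hi => hi.2.1)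
      exact ⟨a, fun _ => ha⟩
    · exact ⟨0, fun h => absurd h hx⟩
  have hH0 : ∀ x, ∃ a, x ∈ D → Tendsto (fun i => fderiv ℝ (fderiv ℝ (u i)) x) 𝒰 (𝓝 a) :=
      fun x => by
    by_cases hx : x ∈ D
    · obtain ⟨r, -, K, -, -, h1⟩ := key x hx
      obtain ⟨a, ha⟩ := 𝒰.exists_tendsto_of_norm_le (F := E →L[ℝ] E →L[ℝ] ℝ)
        (f := fun i => fderiv ℝ (fderiv ℝ (u i)) x) (h1.mono fun i hi => hi.2.2.1)
      exact ⟨a, fun _ => ha⟩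
    · exact ⟨0, fun h => absurd h hx⟩
  choose u₀ hu₀ using hu0
  choose p hp using hp0
  choose H hH using hH0
  have hin : ∀ {x k : E} {r : ℝ}, closedBall x r ⊆ D → ‖k‖ ≤ r → x + k ∈ D := fun h hk =>
    h (by simpa using hk)
  have hd1 : ∀ x ∈ D, HasFDerivAt u₀ (p x) x := fun x hx => by
    obtain ⟨r, hr, K, -, -, h1⟩ := key x hx
    refine hasFDerivAt_of_quadratic (C := K ^ 2) hr fun k hk => ?_
    have hpk : Tendsto (fun i => fderiv ℝ (u i) x k) 𝒰 (𝓝 (p x k)) :=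
      ((ContinuousLinearMap.apply ℝ ℝ k).continuous.tendsto _).comp (hp x hx)
    exact le_of_tendsto (((hu₀ (x + k)).sub (hu₀ x)).sub hpk).norm
      (h1.mono fun i hi => (hi.2.2.2 k hk).1)
  have hd2 : ∀ x ∈ D, HasFDerivAt p (H x) x := fun x hx => by
    obtain ⟨r, hr, K, -, hrD, h1⟩ := key x hx
    refine hasFDerivAt_of_quadratic (C := K ^ 3) hr fun k hk => ?_
    have hpk : Tendsto (fun i => fderiv ℝ (fderiv ℝ (u i)) x k) 𝒰 (𝓝 (H x k)) :=
      ((ContinuousLinearMap.apply ℝ (E →L[ℝ] ℝ) k).continuous.tendsto _).comp (hH x hx)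
    exact le_of_tendsto (((hp (x + k) (hin hrD hk)).sub (hp x hx)).sub hpk).norm
      (h1.mono fun i hi => (hi.2.2.2 k hk).2.2.1)
  have hd3 : ∀ x ∈ D, ContinuousAt H x := fun x hx => by
    obtain ⟨r, hr, K, -, hrD, h1⟩ := key x hx
    refine continuousAt_of_lip (F := E →L[ℝ] E →L[ℝ] ℝ) (f := H) (C := K ^ 3) hr fun k hk => ?_
    have h2 := Tendsto.norm (E := E →L[ℝ] E →L[ℝ] ℝ) ((hH (x + k) (hin hrD hk)).sub (hH x hx))
    exact le_of_tendsto h2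
      (h1.mono fun i hi => (hi.2.2.2 k hk).2.2.2)
  have hf1 : ∀ x ∈ D, fderiv ℝ u₀ x = p x := fun x hx => (hd1 x hx).fderiv
  have hf2 : ∀ x ∈ D, fderiv ℝ (fderiv ℝ u₀) x = H x := fun x hx => by
    rw [(Filter.eventuallyEq_of_mem (hD.mem_nhds hx) hf1).fderiv_eq]
    exact (hd2 x hx).fderiv
  have hC2 : ContDiffOn ℝ 2 u₀ D := by
    have h2 : ContDiffOn ℝ 1 p D := by
      rw [show (1 : WithTop ℕ∞) = 0 + 1 by simp, contDiffOn_succ_iff_fderiv_of_isOpen hD]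
      refine ⟨fun x hx => (hd2 x hx).differentiableAt.differentiableWithinAt, by simp, ?_⟩
      rw [contDiffOn_zero]
      intro x hx
      refine (hd3 x hx).continuousWithinAt.congr (fun y hy => (hd2 y hy).fderiv) (hd2 x hx).fderiv
    rw [show (2 : WithTop ℕ∞) = 1 + 1 by norm_num, contDiffOn_succ_iff_fderiv_of_isOpen hD]
    exact ⟨fun x hx => (hd1 x hx).differentiableAt.differentiableWithinAt, by simp, h2.congr hf1⟩
  refine ⟨u₀, hu₀, fun x hx => ⟨(hC2 x hx).contDiffAt (hD.mem_nhds hx), ?_⟩, fun x hx y hy => ?_⟩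
  · obtain ⟨r, hr, K, -, hrD, h1⟩ := key x hx
    have hlim : Tendsto (fun i => Δ (u i) x) 𝒰 (𝓝 (Δ u₀ x)) := by
      simp only [laplacian_eq_sum_D2 (stdOrthonormalBasis ℝ E)]
      refine tendsto_finsetSum _ fun j _ => ?_
      have := ((ContinuousLinearMap.apply ℝ (E →L[ℝ] ℝ) (stdOrthonormalBasis ℝ E j)).continuous.tendsto
        _).comp (hH x hx)
      have := ((ContinuousLinearMap.apply ℝ ℝ (stdOrthonormalBasis ℝ E j)).continuous.tendsto
        _).comp this
      simp only [D2]
      rw [hf2 x hx]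
      exact this
    refine tendsto_nhds_unique hlim (((hl.mul (hu₀ x)).neg).congr' ?_)
    exact h1.mono fun i hi => ((hi.1 x rfl).2).symm
  · obtain ⟨r, hr, K, hK, hrD, h1⟩ := key x hx
    rw [hf1 x hx, hf2 x hx]
    refine ⟨tendsto_of_tendsto_of_lip (C := K ^ 2 * r + K) hr (hu₀ x) hy ?_,
      tendsto_of_tendsto_of_lip (f := fun i => fderiv ℝ (u i)) hr (hp x hx) hy
        (h1.mono fun i hi k hk => (hi.2.2.2 k hk).2.1),
      tendsto_of_tendsto_of_lip (f := fun i => fderiv ℝ (fderiv ℝ (u i))) hr (hH x hx) hy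
        (h1.mono fun i hi k hk => (hi.2.2.2 k hk).2.2.2)⟩
    refine h1.mono fun i hi k hk => ?_
    have e1 := (hi.2.2.2 k hk).1
    have e2 : ‖fderiv ℝ (u i) x k‖ ≤ K * ‖k‖ :=
      (ContinuousLinearMap.le_opNorm _ _).trans (by gcongr; exact hi.2.1)
    calc ‖u i (x + k) - u i x‖ = ‖(u i (x + k) - u i x - fderiv ℝ (u i) x k) + fderiv ℝ (u i) x k‖ := by
          congr 1; ring
      _ ≤ K ^ 2 * ‖k‖ ^ 2 + K * ‖k‖ := (norm_add_le _ _).trans (add_le_add e1 e2)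
      _ ≤ (K ^ 2 * r + K) * ‖k‖ := by
          have := mul_le_mul_of_nonneg_left hk (mul_nonneg (sq_nonneg K) (norm_nonneg k))
          nlinarith

end Ultralimit

section SmallHole

open Laplacian

open scoped RealInnerProductSpace

theorem closedBall_subset_dom {E : Type*} [NormedAddCommGroup E] {P x : E} (hx : x ∈ dom P 0) : ∃ r > 0, ∃ δ > 0, ∀ ε < δ,
    closedBall x (5 * r) ⊆ dom P ε := by
  obtain ⟨h1, h2⟩ := mem_dom.1 hx
  set δ := min (1 - ‖x‖) ‖x - P‖ with hδ
  have hδ0 : 0 < δ := lt_min (by linarith) h2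
  have hδ1 : δ ≤ 1 - ‖x‖ := min_le_left _ _
  have hδ2 : δ ≤ ‖x - P‖ := min_le_right _ _
  refine ⟨δ / 20, by positivity, δ / 2, by positivity, fun ε hε y hy => ?_⟩
  rw [mem_closedBall, dist_eq_norm] at hy
  rw [mem_dom]
  have h3 : ‖y‖ ≤ ‖y - x‖ + ‖x‖ := by simpa using norm_add_le (y - x) x
  have h4 : ‖x - P‖ ≤ ‖y - P‖ + ‖y - x‖ := by
    have := norm_sub_le (y - P) (y - x)
    rwa [show y - P - (y - x) = x - P by abel] at this
  constructor <;> linarith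

variable {E : Type*} [NormedAddCommGroup E] [InnerProductSpace ℝ E]

theorem D2_le_of_line_le {u : E → ℝ} {x : E} (hu : ContDiffAt ℝ 2 u x) (v w : E)
    (h0 : fderiv ℝ u x = 0) (h : ∀ᶠ t in 𝓝[>] (0 : ℝ), u (x + t • v) ≤ u (x + t • w)) :
    D2 u x v ≤ D2 u x w := by
  set g : ℝ → ℝ := fun t => u (x + t • w) - u (x + t • v) with hg
  have hd := fun v => eventually_deriv_curve hu (hasDerivAt_line x v) (by simp)
  have hd' : ∀ᶠ t in 𝓝 (0 : ℝ), HasDerivAt g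
      (deriv (fun t => u (x + t • w)) t - deriv (fun t => u (x + t • v)) t) t := by
    filter_upwards [hd w, hd v] with t h1 h2
    rw [h1.deriv, h2.deriv]
    exact h1.sub h2
  have h2 : HasDerivAt (deriv g) (D2 u x w - D2 u x v) 0 :=
    ((hasDerivAt_deriv_line hu w).sub (hasDerivAt_deriv_line hu v)).congr_of_eventuallyEq
      (hd'.mono fun t ht => ht.deriv)
  have hg0 : g 0 = 0 := by simp [hg]
  have hg1 : deriv g 0 = 0 := by
    rw [hd'.self_of_nhds.deriv, (hd w).self_of_nhds.deriv, (hd v).self_of_nhds.deriv]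
    simp [h0]
  by_contra! hneg
  have hmax := isLocalMax_of_deriv_deriv_neg (by rw [h2.deriv]; linarith) hg1
    hd'.self_of_nhds.continuousAt
  have hzero : ∀ᶠ t in 𝓝[>] (0 : ℝ), g t = 0 := by
    filter_upwards [h, hmax.filter_mono nhdsWithin_le_nhds] with t h3 h4
    exact le_antisymm (h4.trans hg0.le) (sub_nonneg.2 h3)
  have hder : ∀ᶠ t in 𝓝[>] (0 : ℝ), deriv g t = 0 := by
    have := eventually_eventually_nhdsWithin.2 hzero
    filter_upwards [this, self_mem_nhdsWithin] with t h3 h4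
    rw [IsOpen.nhdsWithin_eq isOpen_Ioi h4] at h3
    have h5 : g =ᶠ[𝓝 t] fun _ => 0 := h3
    rw [h5.deriv_eq]; simp
  have := h2.neg.nonpos_of_right (hder.mono fun t ht => by simp [ht, hg1])
  linarith

variable [FiniteDimensional ℝ E] {P e : E} {l p : ℝ} {u : E → ℝ}

theorem PosSol.le_of_inner_lt (h : PosSol P 0 l u) (hs : Sweeps P 0 l u)
    (hn : 1 < Module.rank ℝ E) {x y : E} (hxy : ‖x‖ = ‖y‖) (hlt : ⟪P, y⟫ < ⟪P, x⟫)
    (hx : x ∈ dom P 0) : u y ≤ u x := by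
  obtain ⟨ν, hν, rfl, h1, h2⟩ := exists_mirror_of_inner_lt hxy hlt
  exact h.mirror_le hs hn hν h1 hx h2

theorem PosSol.D2_neg_of_puncture (h : PosSol P 0 l u) (hs : Sweeps P 0 l u)
    (hn : 1 < Module.rank ℝ E) (he : ‖e‖ = 1) (hp : 0 < p) (hP : P = p • e) {a : ℝ} (ha : 0 ≤ a)
    (ha1 : a < 1) (h0 : fderiv ℝ u ((-a) • e) = 0) : D2 u ((-a) • e) e < 0 := by
  have hee : ⟪e, e⟫ = 1 := by rw [real_inner_self_eq_norm_sq, he, one_pow]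
  have hmem : (-a) • e ∈ dom P 0 := by
    rw [mem_dom_axis he hP, abs_neg, abs_of_nonneg ha, abs_pos]
    exact ⟨ha1, by linarith⟩
  have hC := (h.helm _ hmem).1
  have hlap : Δ u ((-a) • e) < 0 := by
    rw [(h.helm _ hmem).2]
    have := mul_pos h.eigen_pos (h.pos _ hmem)
    linarith
  by_contra! hneg
  refine absurd (hneg.trans (D2_le_laplacian he fun f hf hfe => ?_)) (not_le.2 hlap)
  rcases ha.eq_or_lt with h1 | h1
  · subst h1
    have hline := D2_le_of_line_le hC (-e) (-f) h0 ?_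
    · simp only [D2, map_neg, neg_apply, neg_neg] at hline ⊢
      exact hneg.trans hline
    · have hc : Continuous fun t : ℝ => (-0 : ℝ) • e + t • (-f) := by fun_prop
      have hev := (hc.continuousAt (x := (0 : ℝ))).eventually
        ((isOpen_dom P 0).mem_nhds (by simpa using hmem))
      filter_upwards [hev.filter_mono nhdsWithin_le_nhds, self_mem_nhdsWithin] with t h2 h3
      refine h.le_of_inner_lt hs hn ?_ ?_ h2
      · simp [norm_smul, he, hf]
      · have h4 : ⟪e, f⟫ = 0 := by rw [real_inner_comm]; exact hfe
        simp only [hP, neg_zero, zero_smul, zero_add, smul_neg, inner_neg_right,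
          real_inner_smul_left, real_inner_smul_right, hee, h4]
        have := mul_pos hp (show 0 < t from h3)
        linarith
  · refine D2_circle_nonneg hC (by linarith) (by rw [h0]; rfl) ?_
    have hc : Continuous fun t : ℝ => (-a * Real.cos t) • e + (-a * Real.sin t) • f := by fun_prop
    have hev := (hc.continuousAt (x := (0 : ℝ))).eventually
      ((isOpen_dom P 0).mem_nhds (by simpa using hmem))
    filter_upwards [hev] with t h2
    have h5 : u ((-a) • e) ≤ u ((-a * Real.cos t) • e + (-a * Real.sin t) • f) := by
      rcases (Real.cos_le_one t).eq_or_lt with h3 | h3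
      · have h4 : Real.sin t = 0 := by
          have := Real.sin_sq_add_cos_sq t
          rw [h3] at this
          exact pow_eq_zero_iff two_ne_zero |>.1 (by linarith)
        simp [h3, h4]
      · refine h.le_of_inner_lt hs hn (norm_circle he hf hfe _ t) ?_ h2
        rw [hP, real_inner_smul_left, real_inner_smul_left, inner_circle he hfe,
          real_inner_smul_right, hee]
        have := mul_pos hp h1
        nlinarith
    simpa using h5

theorem exists_posSol_ultralimit (hn : 2 ≤ Module.finrank ℝ E) (𝒰 : Ultrafilter ℕ)
    {ε l : ℕ → ℝ} {u : ℕ → E → ℝ} {x : ℕ → E} {c : ℝ} (hε : Tendsto ε 𝒰 (𝓝 0))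
    (hε0 : ∀ i, 0 < ε i) (hε1 : ∀ i, ε i < 1 / 4) (h : ∀ i, PosSol P (ε i) (l i) (u i))
    (hx : ∀ i, u i (x i) = 1) (hc : 0 < c) (hxc : ∀ i, c ≤ ‖x i - P‖) :
    ∃ l₀ ≤ 8 * ((Module.finrank ℝ E : ℝ) + 2) ^ 2, ∃ u₀ : E → ℝ, PosSol P 0 l₀ u₀ ∧
      ∀ x ∈ dom P 0, ∀ y : ℕ → E, Tendsto y 𝒰 (𝓝 x) →
        Tendsto (fun i => fderiv ℝ (u i) (y i)) 𝒰 (𝓝 (fderiv ℝ u₀ x)) ∧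
        Tendsto (fun i => fderiv ℝ (fderiv ℝ (u i)) (y i)) 𝒰 (𝓝 (fderiv ℝ (fderiv ℝ u₀) x)) := by
  have hnt : Nontrivial E := Module.nontrivial_of_finrank_pos (R := ℝ) (by omega)
  have hrank : 1 < Module.rank ℝ E := by
    rw [← Module.finrank_eq_rank]; exact_mod_cast hn
  set Λ : ℝ := 8 * ((Module.finrank ℝ E : ℝ) + 2) ^ 2 with hΛ
  have hn' : (2 : ℝ) ≤ Module.finrank ℝ E := by exact_mod_cast hn
  have hΛ0 : 0 < Λ := by positivity
  have hlΛ : ∀ i, l i ≤ Λ := fun i => (h i).eigen_le (hε1 i)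
  obtain ⟨l₀, ⟨hl1, hlΛ₀⟩, hl⟩ := 𝒰.exists_tendsto_of_mem_compact (isCompact_Icc (a := 1) (b := Λ))
    (f := l) (Eventually.of_forall fun i => ⟨(h i).one_le_eigen (hε0 i) hn (hx i), hlΛ i⟩)
  have hu1 : ∀ i x, |u i x| ≤ 1 := fun i x =>
    abs_le.2 ⟨by linarith [(h i).nonneg x], (h i).le_one x⟩
  obtain ⟨u₀, hu₀, hH, hlim⟩ := exists_ultralimit 𝒰 hl (Λ := Λ)
    (fun i => ⟨(h i).eigen_pos.le, hlΛ i⟩) (isOpen_dom P 0) hu1 fun x hx => by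
      obtain ⟨r, hr, δ, hδ, h1⟩ := closedBall_subset_dom hx
      exact ⟨r, hr, (hε.eventually (gt_mem_nhds hδ)).mono fun i hi => (h i).helm.mono (h1 _ hi)⟩
  have hzero : ∀ x, x ∉ dom P 0 → u₀ x = 0 := fun x hx => by
    refine tendsto_nhds_unique (hu₀ x) (tendsto_const_nhds.congr fun i => ?_)
    refine ((h i).zero x fun h1 => hx ?_).symm
    exact mem_dom.2 ⟨(mem_dom.1 h1).1, (hε0 i).trans (mem_dom.1 h1).2⟩
  have hnonneg : ∀ x, 0 ≤ u₀ x := fun x =>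
    ge_of_tendsto' (hu₀ x) fun i => (h i).nonneg x
  have hpar : ∀ i x, ‖x‖ ≤ 1 → u i x ≤ Λ * (1 - ‖x‖ ^ 2) := fun i x hx =>
    (h i).le_parabola (hε0 i) (by nlinarith [hlΛ i]) hx
  have hpar₀ : ∀ x, u₀ x ≤ Λ * |1 - ‖x‖ ^ 2| := fun x => by
    rcases le_or_gt ‖x‖ 1 with h1 | h1
    · refine (le_of_tendsto' (hu₀ x) fun i => hpar i x h1).trans ?_
      gcongr; exact le_abs_self _
    · rw [hzero x fun h2 => absurd (mem_dom.1 h2).1 (not_lt.2 h1.le)]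
      positivity
  obtain ⟨x₀, hx₀, hxlim⟩ := 𝒰.exists_tendsto_of_mem_compact (isCompact_closedBall (0 : E) 1)
    (f := x) (Eventually.of_forall fun i => by
      simpa using (mem_dom.1 ((h i).mem_of_pos (x := x i) (by rw [hx i]; exact one_pos))).1.le)
  have hx₀d : x₀ ∈ dom P 0 := by
    have h1 : 1 ≤ Λ * (1 - ‖x₀‖ ^ 2) := by
      refine ge_of_tendsto' (((hxlim.norm.pow 2).const_sub 1).const_mul Λ) fun i => ?_
      have := hpar i (x i) (mem_dom.1 ((h i).mem_of_pos (x := x i) (by rw [hx i]; exact one_pos))).1.le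
      rwa [hx i] at this
    refine mem_dom.2 ⟨?_, hc.trans_le (ge_of_tendsto' (hxlim.sub_const P).norm hxc)⟩
    have h2 : 0 < 1 - ‖x₀‖ ^ 2 := pos_of_mul_pos_right (by linarith) hΛ0.le
    nlinarith [norm_nonneg x₀]
  have hux₀ : u₀ x₀ = 1 := by
    refine tendsto_nhds_unique (hlim x₀ hx₀d x hxlim).1 (tendsto_const_nhds.congr fun i => ?_)
    exact (hx i).symm
  have hpos : ∀ x ∈ dom P 0, 0 < u₀ x := by
    have hconn : IsPreconnected (dom P 0) := by
      rw [dom, closedBall_zero]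
      exact IsPreconnected.diff_singleton hrank (convex_ball 0 1).isPreconnected isOpen_ball P
    have hZ : IsOpen {x ∈ dom P 0 | -u₀ x = 0} := by
      refine isOpen_zeros (isOpen_dom P 0) (fun x hx => (hH x hx).1.neg) (fun x hx => ?_)
        fun x _ => neg_nonpos.2 (hnonneg x)
      have := laplacian_const_mul (-1) (hH x hx).1
      simp only [neg_mul, one_mul] at this
      rw [this, (hH x hx).2, neg_neg]
      exact mul_nonneg (by linarith) (hnonneg x)
    have hNZ : IsOpen {x ∈ dom P 0 | u₀ x ≠ 0} :=
      hH.continuousOn.isOpen_inter_preimage (isOpen_dom P 0) isOpen_compl_singleton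
    intro z hz
    by_contra! hz'
    obtain ⟨y, -, ⟨-, h1⟩, -, h2⟩ := hconn _ _ hZ hNZ (fun y hy => by
        by_cases h1 : u₀ y = 0
        · exact Or.inl ⟨hy, by simpa using h1⟩
        · exact Or.inr ⟨hy, h1⟩)
      ⟨z, hz, hz, by simpa using le_antisymm hz' (hnonneg z)⟩
      ⟨x₀, hx₀d, hx₀d, by rw [hux₀]; exact one_ne_zero⟩
    exact h2 (by simpa using h1)
  refine ⟨l₀, hlΛ₀, u₀, ⟨le_rfl, by linarith, hH, hpos, hzero, fun x => ?_, fun x hx => ?_⟩,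
    fun x hx y hy => (hlim x hx y hy).2⟩
  · exact le_of_tendsto' (hu₀ x) fun i => (h i).le_one x
  · refine ContinuousAt.continuousWithinAt ?_
    rcases lt_trichotomy ‖x‖ 1 with h1 | h1 | h1
    · exact (hH x (mem_dom.2 ⟨h1, norm_pos_iff.2 (sub_ne_zero.2 hx)⟩)).1.continuousAt
    · have h2 : u₀ x = 0 := hzero x fun h2 => absurd (mem_dom.1 h2).1 (not_lt.2 h1.ge)
      rw [ContinuousAt, h2]
      refine squeeze_zero hnonneg hpar₀ ?_
      have h3 : Continuous fun y : E => Λ * |1 - ‖y‖ ^ 2| := by fun_prop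
      simpa [h1] using h3.tendsto x
    · refine ContinuousAt.congr (f := fun _ => (0 : ℝ)) continuousAt_const ?_
      filter_upwards [continuous_norm.continuousAt.eventually (lt_mem_nhds h1)] with y hy
      exact (hzero y fun h2 => absurd (mem_dom.1 h2).1 (not_lt.2 hy.le)).symm

theorem PosSol.inner_nonpos_of_eq_one {ε : ℝ} (h : PosSol P ε l u) (hs : Sweeps P ε l u)
    (hε : 0 < ε) (hPε : ‖P‖ + ε < 1) (he : ‖e‖ = 1) (hPe : 0 < ⟪P, e⟫) {x : E} (hx : u x = 1) :
    ⟪x, e⟫ ≤ 0 := by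
  by_contra! h1
  have h2 := (h.lt_mirror_of_lt_inner hs hε hPε he le_rfl hPe
    (h.mem_of_pos (x := x) (by rw [hx]; exact one_pos)) h1).2
  rw [hx] at h2
  exact absurd (h.le_one _) (not_le.2 h2)

theorem exists_D2_neg (hn : 2 ≤ Module.finrank ℝ E) (he : ‖e‖ = 1) (hp : 0 < p) (hp1 : p < 1)
    (hP : P = p • e) : ∃ ρ > 0, ∀ ε l u, PosSol P ε l u → 0 < ε → ε < ρ → (∃ x, u x = 1) →
    ∀ a ∈ Ioo (0 : ℝ) 1, fderiv ℝ u ((-a) • e) = 0 → D2 u ((-a) • e) e < 0 := by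
  have hnt : Nontrivial E := Module.nontrivial_of_finrank_pos (R := ℝ) (by omega)
  have hrank : 1 < Module.rank ℝ E := by
    rw [← Module.finrank_eq_rank]; exact_mod_cast hn
  have hPp : ‖P‖ = p := by rw [hP, norm_smul, he, mul_one, Real.norm_of_nonneg hp.le]
  have hPe : ⟪P, e⟫ = p := by
    rw [hP, real_inner_smul_left, real_inner_self_eq_norm_sq, he, one_pow, mul_one]
  obtain ⟨ρ, hρ, hsw⟩ := exists_sweeps hn (by rwa [hPp])
    (8 * ((Module.finrank ℝ E : ℝ) + 2) ^ 2)
  set δ : ℝ := min (min ρ (1 / 4)) (min p (1 - p)) with hδ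
  have hδ0 : 0 < δ := lt_min (lt_min hρ (by norm_num)) (lt_min hp (by linarith))
  by_contra! hcon
  have hseq : ∀ i : ℕ, ∃ ε l u x a, PosSol P ε l u ∧ 0 < ε ∧ ε < δ / (i + 1) ∧ u x = 1 ∧
      a ∈ Ioo (0 : ℝ) 1 ∧ fderiv ℝ u ((-a) • e) = 0 ∧ 0 ≤ D2 u ((-a) • e) e := fun i => by
    obtain ⟨ε, l, u, h1, h2, h3, ⟨x, hx⟩, a, h4⟩ := hcon (δ / (i + 1)) (by positivity)
    exact ⟨ε, l, u, x, a, h1, h2, h3, hx, h4⟩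
  choose ε l u x a h hε0 hεδ hx ha ha0 ha2 using hseq
  have hεlt : ∀ i, ε i < δ := fun i => (hεδ i).trans_le (div_le_self hδ0.le (by simp))
  have hε1 : ∀ i, ε i < ρ := fun i =>
    (hεlt i).trans_le ((min_le_left _ _).trans (min_le_left _ _))
  have hε2 : ∀ i, ε i < 1 / 4 := fun i =>
    (hεlt i).trans_le ((min_le_left _ _).trans (min_le_right _ _))
  have hε3 : ∀ i, ε i < p := fun i =>
    (hεlt i).trans_le ((min_le_right _ _).trans (min_le_left _ _))
  have hε4 : ∀ i, ‖P‖ + ε i < 1 := fun i => by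
    have := (hεlt i).trans_le ((min_le_right _ _).trans (min_le_right _ _))
    rw [hPp]; linarith
  have hs : ∀ i, Sweeps P (ε i) (l i) (u i) := fun i =>
    hsw _ _ _ (h i) (hε1 i) ((h i).eigen_le (hε2 i))
  set 𝒰 := hyperfilter ℕ with h𝒰
  have hεlim : Tendsto ε 𝒰 (𝓝 0) := by
    refine Tendsto.mono_left ?_ Nat.hyperfilter_le_atTop
    refine squeeze_zero (fun i => (hε0 i).le) (fun i => (hεδ i).le) ?_
    have := (tendsto_one_div_add_atTop_nhds_zero_nat (𝕜 := ℝ)).const_mul δ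
    simpa [div_eq_mul_inv] using this
  have hxc : ∀ i, p ≤ ‖x i - P‖ := fun i => by
    have h1 := (h i).inner_nonpos_of_eq_one (hs i) (hε0 i) (hε4 i) he (by rwa [hPe]) (hx i)
    have h2 : |⟪x i - P, e⟫| ≤ ‖x i - P‖ * ‖e‖ := abs_real_inner_le_norm _ _
    rw [he, mul_one, inner_sub_left, hPe] at h2
    linarith [neg_le_of_abs_le h2]
  obtain ⟨l₀, hl₀, u₀, h₀, hlim⟩ := exists_posSol_ultralimit hn 𝒰 hεlim hε0 hε2 h hx hp hxc
  have ha1 : ∀ i, a i ∈ Icc (0 : ℝ) (1 / 2) := fun i => by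
    refine ⟨(ha i).1.le, ?_⟩
    by_contra! h1
    have := (h i).fderiv_cap (hs i) (hε0 i) (hε3 i) he hP h1.le (ha i).2
    rw [ha0 i] at this
    exact lt_irrefl _ this
  obtain ⟨a₀, ⟨ha₀, ha₀'⟩, halim⟩ := 𝒰.exists_tendsto_of_mem_compact isCompact_Icc
    (Eventually.of_forall ha1)
  have hmem : (-a₀) • e ∈ dom P 0 := by
    rw [mem_dom_axis he hP, abs_neg, abs_of_nonneg ha₀, abs_pos]
    exact ⟨by linarith, by linarith⟩
  obtain ⟨h1, h2⟩ := hlim _ hmem (fun i => (-a i) • e) (halim.neg.smul_const e)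
  have h3 : fderiv ℝ u₀ ((-a₀) • e) = 0 :=
    tendsto_nhds_unique h1 (tendsto_const_nhds.congr fun i => (ha0 i).symm)
  have h4 := h₀.D2_neg_of_puncture (hsw _ _ _ h₀ hρ hl₀) hrank he hp hP ha₀ (by linarith) h3
  have h5 := ((ContinuousLinearMap.apply ℝ (E →L[ℝ] ℝ) e).continuous.tendsto _).comp h2
  have h6 := ((ContinuousLinearMap.apply ℝ ℝ e).continuous.tendsto _).comp h5
  exact absurd (ge_of_tendsto' h6 ha2) (not_le.2 h4)

end SmallHole

section EuclideanEigenfunctions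

open Laplacian

variable {N : ℕ} {P : EN N} {ε μ : ℝ} {φ : EN N → ℝ}

theorem lap_eq_laplacian {u : EN N → ℝ} {x : EN N} (hu : ContDiffAt ℝ 2 u x) :
    lap u x = Δ u x := by
  rw [laplacian_eq_sum_D2 (EuclideanSpace.basisFun (Fin N) ℝ)]
  refine Finset.sum_congr rfl fun i _ => ?_
  rw [EuclideanSpace.basisFun_apply, pd2, D2]
  have h := (hu.differentiableAt_fderiv.hasFDerivAt.clm_apply
    (hasFDerivAt_const (EuclideanSpace.single i (1 : ℝ)) x)).fderiv
  change fderiv ℝ (fun y => fderiv ℝ u y (EuclideanSpace.single i 1)) x _ = _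
  rw [h]
  simp

theorem gradient_eq_zero_iff {E : Type*} [NormedAddCommGroup E] [InnerProductSpace ℝ E]
    [CompleteSpace E] {u : E → ℝ} {x : E} : gradient u x = 0 ↔ fderiv ℝ u x = 0 := by
  simp [gradient]

/-- A positive eigenfunction, divided by its maximum and extended by zero. -/
theorem IsFirstEigenfunction.exists_posSol (h : IsFirstEigenfunction (dom P ε) μ φ) (hε : 0 < ε) :
    ∃ u, PosSol P ε μ u ∧ (∃ x, u x = 1) ∧
      {x ∈ dom P ε | gradient φ x = 0} = {x ∈ dom P ε | fderiv ℝ u x = 0} := by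
  obtain ⟨⟨hC, hlap, hcont, hzero, y, hy, -⟩, hμ, hpos, -⟩ := h
  have hcpt : IsCompact (closure (dom P ε)) :=
    (isBounded_ball.subset sdiff_subset).isCompact_closure
  obtain ⟨z, hz, hmax⟩ := hcpt.exists_isMaxOn ⟨y, subset_closure hy⟩ hcont
  have hM : 0 < φ z := (hpos y hy).trans_le (hmax (subset_closure hy))
  have hzd : z ∈ dom P ε := by
    by_contra hzd
    exact hM.ne' (hzero z ((isOpen_dom P ε).frontier_eq ▸ ⟨hz, hzd⟩))
  have hd : ∀ x ∈ dom P ε, ContDiffAt ℝ 2 φ x := fun x hx =>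
    hC.contDiffAt ((isOpen_dom P ε).mem_nhds hx)
  have hH : Helmholtz μ (dom P ε) fun x => (φ z)⁻¹ * φ x :=
    Helmholtz.const_mul (fun x hx => ⟨hd x hx, by rw [← lap_eq_laplacian (hd x hx), hlap x hx]⟩) _
  set u := indicator (dom P ε) fun x => (φ z)⁻¹ * φ x with hu
  have hev : ∀ x ∈ dom P ε, u =ᶠ[𝓝 x] fun x => (φ z)⁻¹ * φ x := fun x hx => by
    filter_upwards [(isOpen_dom P ε).mem_nhds hx] with w hw
    exact indicator_of_mem hw _
  refine ⟨u, ⟨hε.le, hμ, fun x hx => ⟨(hH x hx).1.congr_of_eventuallyEq (hev x hx), ?_⟩,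
    fun x hx => ?_, fun x hx => indicator_of_notMem hx _, fun x => ?_, ?_⟩, ⟨z, ?_⟩, ?_⟩
  · rw [(InnerProductSpace.laplacian_congr_nhds (hev x hx)).self_of_nhds, (hH x hx).2,
      (hev x hx).self_of_nhds]
  · rw [hu, indicator_of_mem hx]
    exact mul_pos (inv_pos.2 hM) (hpos x hx)
  · refine indicator_le' (fun x hx => ?_) (fun _ _ => zero_le_one) x
    rw [inv_mul_le_one₀ hM]
    exact hmax (subset_closure hx)
  · exact (continuous_indicator (fun x hx => by rw [hzero x hx, mul_zero])
      (hcont.const_mul _)).continuousOn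
  · rw [hu, indicator_of_mem hzd, inv_mul_cancel₀ hM.ne']
  · ext x
    refine and_congr_right fun hx => ?_
    rw [gradient_eq_zero_iff, (hev x hx).fderiv_eq,
      fderiv_const_mul ((hd x hx).differentiableAt (by simp))]
    simp [hM.ne']

end EuclideanEigenfunctions

/-- Corollary 1.7 of the paper.  Let `φ ε` be the first Dirichlet eigenfunction
of `-Δ` on `B(0,1) \ B(P,ε)`.  For small `ε`: if `P = 0` the set of critical points of `φ ε`
is infinite; if `P ≠ 0` it has exactly two elements. -/
theorem stmt3
    {N : ℕ} (hN : 2 ≤ N) (P : EN N) (hP : P ∈ ball (0:EN N) 1)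
    (ε₀ : ℝ) (hε₀ : 0 < ε₀) (φ : ℝ → EN N → ℝ) (lam : ℝ → ℝ)
    (hφ : ∀ ε ∈ Ioo (0:ℝ) ε₀,
      IsFirstEigenfunction (ball (0:EN N) 1 \ closedBall P ε) (lam ε) (φ ε)) :
    ∀ᶠ ε in 𝓝[>] (0:ℝ),
      (P = 0 → {x ∈ ball (0:EN N) 1 \ closedBall P ε | gradient (φ ε) x = 0}.Infinite) ∧
      (P ≠ 0 → {x ∈ ball (0:EN N) 1 \ closedBall P ε | gradient (φ ε) x = 0}.ncard = 2) := by
  have hfin : 2 ≤ Module.finrank ℝ (EN N) := by rwa [finrank_euclideanSpace_fin]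
  have hrank : 1 < Module.rank ℝ (EN N) := by
    rw [← Module.finrank_eq_rank]; exact_mod_cast hfin
  have hnt : Nontrivial (EN N) := Module.nontrivial_of_finrank_pos (R := ℝ) (by omega)
  rw [mem_ball_zero_iff] at hP
  obtain ⟨ρ, hρ, hsw⟩ := exists_sweeps hfin hP (8 * ((Module.finrank ℝ (EN N) : ℝ) + 2) ^ 2)
  have hsol : ∀ᶠ ε in 𝓝[>] (0 : ℝ), 0 < ε ∧ ∃ u, PosSol P ε (lam ε) u ∧ Sweeps P ε (lam ε) u ∧
      (∃ x, u x = 1) ∧ {x ∈ ball (0 : EN N) 1 \ closedBall P ε | gradient (φ ε) x = 0} =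
        {x ∈ dom P ε | fderiv ℝ u x = 0} := by
    filter_upwards [Ioo_mem_nhdsGT (lt_min hε₀ (lt_min hρ (by norm_num : (0 : ℝ) < 1 / 4)))]
      with ε hε
    simp only [mem_Ioo, lt_min_iff] at hε
    obtain ⟨h0, h1, h2, h3⟩ := hε
    obtain ⟨u, hu, hx, hcrit⟩ := IsFirstEigenfunction.exists_posSol (hφ ε ⟨h0, h1⟩) h0
    exact ⟨h0, u, hu, hsw _ _ _ hu h2 (hu.eigen_le h3), hx, hcrit⟩
  rcases eq_or_ne P 0 with rfl | hP0
  · filter_upwards [hsol] with ε ⟨h0, u, hu, hs, ⟨x, hx⟩, hcrit⟩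
    exact ⟨fun _ => hcrit ▸ hu.infinite_critical hs h0 hrank hx, fun h => absurd rfl h⟩
  · obtain ⟨e, he, hPe⟩ := exists_unit P
    obtain ⟨δ, hδ, hneg⟩ := exists_D2_neg hfin he (norm_pos_iff.2 hP0) hP hPe
    filter_upwards [hsol, Ioo_mem_nhdsGT (lt_min hδ (lt_min (norm_pos_iff.2 hP0) (sub_pos.2 hP)))]
      with ε ⟨h0, u, hu, hs, hx, hcrit⟩ hε
    simp only [mem_Ioo, lt_min_iff] at hε
    obtain ⟨-, h1, h2, h3⟩ := hε
    refine ⟨fun h => absurd h hP0, fun _ => hcrit ▸ ?_⟩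
    exact hu.ncard_critical hs h0 (by linarith) he h2 hPe (hneg _ _ _ hu h0 h1 hx)
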